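/- arXiv:2310.17727 — 13 statements merged into one kernel-verified Lean document; each statement's English description precedes it below -/
import Mathlib

section
/- Injectivity of the BCFW map (Proposition 7.2): Suppose M(A, α, β, γ, δ, ε, B) and M(A′, α′, β′, γ′, δ′, ε′, B′) are two BCFW matrices, built for the same data k_L, k_R, a, b, c, d, n with both input triples satisfying the stated coindependence hypotheses, and suppose their row spans in ℝⁿ coincide. Then the row span of A equals the row span of A′, the row span of B equals the row span of B′, and there is a real λ > 0 with (α, β, γ, δ, ε) = λ·(α′, β′, γ′, δ′, ε′). -/
open Matrix

/-- A real `k × n` matrix is totally nonnegative if all of its `k × k` minors,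
taken with columns in increasing order, are nonnegative. -/
def TotNonneg {k n : ℕ} (M : Matrix (Fin k) (Fin n) ℝ) : Prop :=
  ∀ f : Fin k → Fin n, StrictMono f → 0 ≤ (M.submatrix id f).det

/-- Hypotheses on the left input `A` of the BCFW product: the columns outside
`N_L = {1,…,b} ∪ {n}` vanish, `A` is totally nonnegative, and `A` has a nonzero
maximal minor using only columns in `{1,…,a−1}` (i.e. columns `< a`). -/
def LeftInput (kL n : ℕ) (a b nn : Fin n) (A : Matrix (Fin kL) (Fin n) ℝ) : Prop :=
  (∀ j : Fin n, ¬(j ≤ b ∨ j = nn) → ∀ i, A i j = 0) ∧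
    TotNonneg A ∧
    ∃ f : Fin kL → Fin n, StrictMono f ∧ (∀ i, f i < a) ∧ (A.submatrix id f).det ≠ 0

/-- Hypotheses on the right input `B` of the BCFW product: the columns outside
`N_R = {b,…,c,d,n}` vanish, `B` is totally nonnegative, and `B` has a nonzero
maximal minor using only columns in `{b+1,…,c−1}`. -/
def RightInput (kR n : ℕ) (b c : Fin n) (B : Matrix (Fin kR) (Fin n) ℝ) : Prop :=
  (∀ j : Fin n, j < b → ∀ i, B i j = 0) ∧
    TotNonneg B ∧
    ∃ f : Fin kR → Fin n, StrictMono f ∧ (∀ i, b < f i ∧ f i < c) ∧ (B.submatrix id f).det ≠ 0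

/-- The BCFW matrix `M(A, α, β, γ, δ, ε, B)`: the first `kL` rows are the rows of `A`
with column `a` replaced by `A_a + (α/β)·A_b` and column `n` replaced by
`(−1)^{kR+1}·A_n`; the middle row has entries `α, β, (−1)^{kR}γ, (−1)^{kR}δ, (−1)^{kR}ε`
in columns `a, b, c, d, n` and `0` elsewhere; the last `kR` rows are the rows of `B`
with column `d` replaced by `B_d' = B_d + (δ/ε)·B_n` and column `c` replaced by
`B_c + (γ/δ)·B_d'`. -/
noncomputable def bcfwMatrix (kL kR n : ℕ) (A : Matrix (Fin kL) (Fin n) ℝ)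
    (B : Matrix (Fin kR) (Fin n) ℝ) (α β γ δ ε : ℝ) (a b c d nn : Fin n) :
    Matrix (Fin (kL + 1 + kR)) (Fin n) ℝ :=
  Matrix.of fun i j =>
    if h1 : (i : ℕ) < kL then
      if j = a then A ⟨(i : ℕ), h1⟩ a + α / β * A ⟨(i : ℕ), h1⟩ b
      else if j = nn then (-1 : ℝ) ^ (kR + 1) * A ⟨(i : ℕ), h1⟩ nn
      else A ⟨(i : ℕ), h1⟩ j
    else if h2 : (i : ℕ) = kL then
      if j = a then α
      else if j = b then β
      else if j = c then (-1 : ℝ) ^ kR * γ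
      else if j = d then (-1 : ℝ) ^ kR * δ
      else if j = nn then (-1 : ℝ) ^ kR * ε
      else 0
    else
      have hi : (i : ℕ) - kL - 1 < kR := by
        have h3 := i.isLt
        omega
      if j = c then
        B ⟨(i : ℕ) - kL - 1, hi⟩ c +
          γ / δ * (B ⟨(i : ℕ) - kL - 1, hi⟩ d + δ / ε * B ⟨(i : ℕ) - kL - 1, hi⟩ nn)
      else if j = d then B ⟨(i : ℕ) - kL - 1, hi⟩ d + δ / ε * B ⟨(i : ℕ) - kL - 1, hi⟩ nn
      else B ⟨(i : ℕ) - kL - 1, hi⟩ j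

/-- The row span of a matrix, as a submodule of `ℝⁿ`. -/
def rowSpan {k n : ℕ} (M : Matrix (Fin k) (Fin n) ℝ) : Submodule ℝ (Fin n → ℝ) :=
  Submodule.span ℝ (Set.range fun i => M i)

/-- left column operation -/
noncomputable def phiL {n : ℕ} (kR : ℕ) (q : ℝ) (a b nn : Fin n) (x : Fin n → ℝ) : Fin n → ℝ :=
  fun j => if j = a then x a + q * x b else if j = nn then (-1 : ℝ) ^ (kR + 1) * x nn else x j

/-- right column operation -/
noncomputable def psiR {n : ℕ} (r s : ℝ) (c d nn : Fin n) (x : Fin n → ℝ) : Fin n → ℝ :=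
  fun j => if j = c then x c + r * (x d + s * x nn) else if j = d then x d + s * x nn else x j

/-- middle row -/
noncomputable def midRow {n : ℕ} (kR : ℕ) (α β γ δ ε : ℝ) (a b c d nn : Fin n) : Fin n → ℝ :=
  fun j => if j = a then α
      else if j = b then β
      else if j = c then (-1 : ℝ) ^ kR * γ
      else if j = d then (-1 : ℝ) ^ kR * δ
      else if j = nn then (-1 : ℝ) ^ kR * ε
      else 0

noncomputable def phiLin {n : ℕ} (kR : ℕ) (q : ℝ) (a b nn : Fin n) :
    (Fin n → ℝ) →ₗ[ℝ] (Fin n → ℝ) where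
  toFun := phiL kR q a b nn
  map_add' x y := by
    ext j; simp only [phiL, Pi.add_apply]; split_ifs <;> ring
  map_smul' t y := by
    ext j; simp only [phiL, Pi.smul_apply, smul_eq_mul, RingHom.id_apply]; split_ifs <;> ring

noncomputable def psiLin {n : ℕ} (r s : ℝ) (c d nn : Fin n) :
    (Fin n → ℝ) →ₗ[ℝ] (Fin n → ℝ) where
  toFun := psiR r s c d nn
  map_add' x y := by
    ext j; simp only [psiR, Pi.add_apply]; split_ifs <;> ring
  map_smul' t y := by
    ext j; simp only [psiR, Pi.smul_apply, smul_eq_mul, RingHom.id_apply]; split_ifs <;> ring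

lemma phiL_inj {n : ℕ} (kR : ℕ) (q : ℝ) (a b nn : Fin n) (hab : b ≠ a) (hbn : b ≠ nn)
    {x y : Fin n → ℝ}
    (h : phiL kR q a b nn x = phiL kR q a b nn y) : x = y := by
  have hb : x b = y b := by
    have := congrFun h b
    simpa [phiL, hab, hbn] using this
  ext j
  have hj := congrFun h j
  simp only [phiL] at hj
  split_ifs at hj with h1 h2
  · subst h1; rw [hb] at hj; linarith
  · subst h2
    exact mul_left_cancel₀ (pow_ne_zero _ (by norm_num)) hj
  · exact hj

lemma psiR_inj {n : ℕ} (r s : ℝ) (c d nn : Fin n) (hcd : d ≠ c) (hcn : nn ≠ c) (hdn : nn ≠ d)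
    {x y : Fin n → ℝ}
    (h : psiR r s c d nn x = psiR r s c d nn y) : x = y := by
  have hn : x nn = y nn := by
    have := congrFun h nn
    simpa [psiR, hcn, hdn] using this
  have hd : x d = y d := by
    have := congrFun h d
    simp only [psiR, hcd, if_false, if_true] at this
    rw [hn] at this; linarith
  ext j
  have hj := congrFun h j
  simp only [psiR] at hj
  split_ifs at hj with h1 h2
  · subst h1; rw [hn, hd] at hj; linarith
  · subst h2; exact hd
  · exact hj

lemma rowSpan_eq_zero {k n : ℕ} (A : Matrix (Fin k) (Fin n) ℝ) (f : Fin k → Fin n)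
    (hdet : (A.submatrix id f).det ≠ 0) (x : Fin n → ℝ) (hx : x ∈ rowSpan A)
    (h0 : ∀ i, x (f i) = 0) : x = 0 := by
  obtain ⟨w, hw⟩ := (Submodule.mem_span_range_iff_exists_fun ℝ).1 hx
  have hw0 : w = 0 := by
    apply Matrix.eq_zero_of_vecMul_eq_zero hdet
    ext i
    have h1 := h0 i
    rw [← hw] at h1
    simpa [Matrix.vecMul, dotProduct, Finset.sum_apply] using h1
  rw [← hw, hw0]; simp

lemma rowSpan_zero_col {k n : ℕ} (A : Matrix (Fin k) (Fin n) ℝ) (j : Fin n)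
    (h : ∀ i, A i j = 0) (x : Fin n → ℝ) (hx : x ∈ rowSpan A) : x j = 0 := by
  obtain ⟨w, hw⟩ := (Submodule.mem_span_range_iff_exists_fun ℝ).1 hx
  rw [← hw]; simp [Finset.sum_apply, h]

lemma rowSpan_bcfw (kL kR n : ℕ) (a b c d nn : Fin n)
    (A : Matrix (Fin kL) (Fin n) ℝ) (B : Matrix (Fin kR) (Fin n) ℝ) (α β γ δ ε : ℝ) :
    rowSpan (bcfwMatrix kL kR n A B α β γ δ ε a b c d nn) =
      (rowSpan A).map (phiLin kR (α / β) a b nn) ⊔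
      (Submodule.span ℝ {midRow kR α β γ δ ε a b c d nn} ⊔
        (rowSpan B).map (psiLin (γ / δ) (δ / ε) c d nn)) := by
  unfold rowSpan
  rw [Submodule.map_span, Submodule.map_span, ← Submodule.span_union, ← Submodule.span_union]
  congr 1
  ext v
  simp only [Set.mem_range, Set.mem_union, Set.mem_image, Set.mem_singleton_iff]
  constructor
  · rintro ⟨i, rfl⟩
    by_cases h1 : (i : ℕ) < kL
    · refine Or.inl ⟨_, ⟨⟨i, h1⟩, rfl⟩, ?_⟩
      ext j
      simp [bcfwMatrix, h1, phiLin, phiL]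
    · by_cases h2 : (i : ℕ) = kL
      · refine Or.inr (Or.inl ?_)
        ext j
        simp [bcfwMatrix, h2, midRow]
      · refine Or.inr (Or.inr ⟨_, ⟨⟨(i : ℕ) - kL - 1, by omega⟩, rfl⟩, ?_⟩)
        ext j
        simp [bcfwMatrix, h1, h2, psiLin, psiR]
  · rintro (⟨_, ⟨i, rfl⟩, rfl⟩ | rfl | ⟨_, ⟨i, rfl⟩, rfl⟩)
    · refine ⟨⟨i, by omega⟩, ?_⟩
      ext j
      simp [bcfwMatrix, phiLin, phiL]
    · refine ⟨⟨kL, by omega⟩, ?_⟩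
      ext j
      simp [bcfwMatrix, midRow]
    · refine ⟨⟨kL + 1 + i, by omega⟩, ?_⟩
      have e1 : ¬ (kL + 1 + (i : ℕ) < kL) := by omega
      have e2 : ¬ (kL + 1 + (i : ℕ) = kL) := by omega
      have e3 : kL + 1 + (i : ℕ) - kL - 1 = i := by omega
      ext j
      simp [bcfwMatrix, psiLin, psiR, e1, e2, e3]

lemma mem_bcfw (kL kR n : ℕ) (a b c d nn : Fin n)
    (A : Matrix (Fin kL) (Fin n) ℝ) (B : Matrix (Fin kR) (Fin n) ℝ) (α β γ δ ε : ℝ)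
    (v : Fin n → ℝ) :
    v ∈ rowSpan (bcfwMatrix kL kR n A B α β γ δ ε a b c d nn) ↔
      ∃ x ∈ rowSpan A, ∃ t : ℝ, ∃ y ∈ rowSpan B,
        v = phiL kR (α / β) a b nn x + (t • midRow kR α β γ δ ε a b c d nn +
          psiR (γ / δ) (δ / ε) c d nn y) := by
  rw [rowSpan_bcfw]
  constructor
  · intro h
    obtain ⟨_, ⟨x, hx, rfl⟩, w, hw, rfl⟩ := Submodule.mem_sup.1 h
    obtain ⟨u, hu, _, ⟨y, hy, rfl⟩, rfl⟩ := Submodule.mem_sup.1 hw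
    obtain ⟨t, rfl⟩ := Submodule.mem_span_singleton.1 hu
    exact ⟨x, hx, t, y, hy, rfl⟩
  · rintro ⟨x, hx, t, y, hy, rfl⟩
    exact Submodule.add_mem_sup (Submodule.mem_map_of_mem (f := phiLin kR (α / β) a b nn) hx)
      (Submodule.add_mem_sup (Submodule.mem_span_singleton.2 ⟨t, rfl⟩)
        (Submodule.mem_map_of_mem (f := psiLin (γ / δ) (δ / ε) c d nn) hy))

lemma phiL_zero {n : ℕ} (kR : ℕ) (q : ℝ) (a b nn : Fin n) : phiL kR q a b nn 0 = 0 :=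
  (phiLin kR q a b nn).map_zero

lemma psiR_zero {n : ℕ} (r s : ℝ) (c d nn : Fin n) : psiR r s c d nn 0 = 0 :=
  (psiLin r s c d nn).map_zero

lemma bcfw_extract (kL kR n : ℕ) (a b c d nn : Fin n)
    (hab : (b : ℕ) = (a : ℕ) + 1) (hbc : b < c) (hcd : (d : ℕ) = (c : ℕ) + 1)
    (hdn : (nn : ℕ) = (d : ℕ) + 1)
    (A : Matrix (Fin kL) (Fin n) ℝ) (B : Matrix (Fin kR) (Fin n) ℝ)
    (α β γ δ ε : ℝ) (hα : 0 < α) (hγ : 0 < γ)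
    (hA : LeftInput kL n a b nn A) (hB : RightInput kR n b c B)
    (v : Fin n → ℝ)
    (hv : v ∈ rowSpan (bcfwMatrix kL kR n A B α β γ δ ε a b c d nn)) :
    ((∀ j, j < a → v j = 0) → (∀ j, b < j → j < c → v j = 0) →
      ∃ t : ℝ, v = t • midRow kR α β γ δ ε a b c d nn) ∧
    ((∀ j, b < j → j ≤ c → v j = 0) → ∃ x ∈ rowSpan A, v = phiL kR (α / β) a b nn x) ∧
    ((∀ j, j ≤ a → v j = 0) → ∃ y ∈ rowSpan B, v = psiR (γ / δ) (δ / ε) c d nn y) := by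
  obtain ⟨x, hx, t, y, hy, hv⟩ := (mem_bcfw kL kR n a b c d nn A B α β γ δ ε v).1 hv
  obtain ⟨hA0, -, f, -, hf, hfd⟩ := hA
  obtain ⟨hB0, -, g, -, hg, hgd⟩ := hB
  have hx0 : ∀ j, b < j → j ≠ nn → x j = 0 := fun j h1 h2 =>
    rowSpan_zero_col A j (hA0 j (by
      rintro (h | h)
      · exact absurd h (not_le.2 h1)
      · exact h2 h)) x hx
  have hy0 : ∀ j, j < b → y j = 0 := fun j h1 => rowSpan_zero_col B j (hB0 j h1) y hy
  have hbc' : (b : ℕ) < c := hbc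
  have X : (∀ j, j < a → v j = 0) → x = 0 := by
    intro h
    refine rowSpan_eq_zero A f hfd x hx fun i => ?_
    have h1 := h _ (hf i)
    have h2 : (f i : ℕ) < a := hf i
    have n1 : f i ≠ a := by intro h; rw [h] at h2; omega
    have n2 : f i ≠ b := by intro h; rw [h] at h2; omega
    have n3 : f i ≠ c := by intro h; rw [h] at h2; omega
    have n4 : f i ≠ d := by intro h; rw [h] at h2; omega
    have n5 : f i ≠ nn := by intro h; rw [h] at h2; omega
    have h3 := hy0 (f i) (by rw [Fin.lt_def]; omega)
    rw [hv] at h1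
    simpa [phiL, psiR, midRow, n1, n2, n3, n4, n5, h3] using h1
  have Y : (∀ j, b < j → j < c → v j = 0) → y = 0 := by
    intro h
    refine rowSpan_eq_zero B g hgd y hy fun i => ?_
    have h1 := h _ (hg i).1 (hg i).2
    have h2 : (b : ℕ) < g i := (hg i).1
    have h2' : (g i : ℕ) < c := (hg i).2
    have n1 : g i ≠ a := by intro h; rw [h] at h2; omega
    have n2 : g i ≠ b := by intro h; rw [h] at h2; omega
    have n3 : g i ≠ c := by intro h; rw [h] at h2'; omega
    have n4 : g i ≠ d := by intro h; rw [h] at h2'; omega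
    have n5 : g i ≠ nn := by intro h; rw [h] at h2'; omega
    have h3 := hx0 (g i) (hg i).1 n5
    rw [hv] at h1
    simpa [phiL, psiR, midRow, n1, n2, n3, n4, n5, h3] using h1
  refine ⟨fun h1 h2 => ⟨t, ?_⟩, fun h => ⟨x, hx, ?_⟩, fun h => ⟨y, hy, ?_⟩⟩
  · rw [hv, X h1, Y h2, phiL_zero, psiR_zero]; simp
  · have y0 := Y fun j h1 h2 => h j h1 h2.le
    have h1 := h c hbc le_rfl
    have n1 : c ≠ a := by rintro rfl; omega
    have n2 : c ≠ b := by rintro rfl; omega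
    have n3 : c ≠ nn := by rintro rfl; omega
    have h3 := hx0 c hbc n3
    rw [hv, y0, psiR_zero] at h1
    simp [phiL, midRow, n1, n2, n3, h3, hγ.ne'] at h1
    rw [hv, y0, psiR_zero, h1]; simp
  · have x0 := X fun j h1 => h j h1.le
    have h1 := h a le_rfl
    have n1 : a ≠ c := by rintro rfl; omega
    have n2 : a ≠ d := by rintro rfl; omega
    have h3 := hy0 a (by rw [Fin.lt_def]; omega)
    rw [hv, x0, phiL_zero] at h1
    simp [psiR, midRow, n1, n2, h3, hα.ne'] at h1
    rw [hv, x0, phiL_zero, h1]; simp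

lemma bcfw_half (kL kR n : ℕ) (a b c d nn : Fin n)
    (hab : (b : ℕ) = (a : ℕ) + 1) (hbc : b < c) (hcd : (d : ℕ) = (c : ℕ) + 1)
    (hdn : (nn : ℕ) = (d : ℕ) + 1)
    (A A' : Matrix (Fin kL) (Fin n) ℝ) (B B' : Matrix (Fin kR) (Fin n) ℝ)
    (α β γ δ ε α' β' γ' δ' ε' : ℝ)
    (hα' : 0 < α') (hγ' : 0 < γ')
    (hA : LeftInput kL n a b nn A) (hA' : LeftInput kL n a b nn A')
    (hB : RightInput kR n b c B) (hB' : RightInput kR n b c B')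
    (e1 : α / β = α' / β') (e2 : γ / δ = γ' / δ') (e3 : δ / ε = δ' / ε')
    (hspan : rowSpan (bcfwMatrix kL kR n A B α β γ δ ε a b c d nn) =
      rowSpan (bcfwMatrix kL kR n A' B' α' β' γ' δ' ε' a b c d nn)) :
    rowSpan A ≤ rowSpan A' ∧ rowSpan B ≤ rowSpan B' := by
  have hbc' : (b : ℕ) < c := hbc
  constructor
  · intro x hx
    have hm : phiL kR (α / β) a b nn x ∈
        rowSpan (bcfwMatrix kL kR n A B α β γ δ ε a b c d nn) :=
      (mem_bcfw ..).2 ⟨x, hx, 0, 0, Submodule.zero_mem _, by simp [psiR_zero]⟩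
    rw [hspan] at hm
    obtain ⟨x', hx', h⟩ := (bcfw_extract kL kR n a b c d nn hab hbc hcd hdn A' B' α' β' γ' δ' ε'
      hα' hγ' hA' hB' _ hm).2.1 (by
        intro j h1 h2
        have h1' : (b : ℕ) < j := h1
        have h2' : (j : ℕ) ≤ c := h2
        have n1 : j ≠ a := by rintro rfl; omega
        have n2 : j ≠ nn := by rintro rfl; omega
        have := rowSpan_zero_col A j (hA.1 j (by
          rintro (h | h)
          · exact absurd h (not_le.2 h1)
          · exact n2 h)) x hx
        simp [phiL, n1, n2, this])
    rw [e1] at h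
    have := phiL_inj kR _ a b nn (by rintro rfl; omega) (by rintro rfl; omega) h
    rwa [this]
  · intro x hx
    have hm : psiR (γ / δ) (δ / ε) c d nn x ∈
        rowSpan (bcfwMatrix kL kR n A B α β γ δ ε a b c d nn) :=
      (mem_bcfw ..).2 ⟨0, Submodule.zero_mem _, 0, x, hx, by simp [phiL_zero]⟩
    rw [hspan] at hm
    obtain ⟨x', hx', h⟩ := (bcfw_extract kL kR n a b c d nn hab hbc hcd hdn A' B' α' β' γ' δ' ε'
      hα' hγ' hA' hB' _ hm).2.2 (by
        intro j h1
        have h1' : (j : ℕ) ≤ a := h1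
        have n1 : j ≠ c := by rintro rfl; omega
        have n2 : j ≠ d := by rintro rfl; omega
        have := rowSpan_zero_col B j (hB.1 j (by rw [Fin.lt_def]; omega)) x hx
        simp [psiR, n1, n2, this])
    rw [e2, e3] at h
    have := psiR_inj _ _ c d nn (by rintro rfl; omega) (by rintro rfl; omega)
      (by rintro rfl; omega) h
    rwa [this]

/-- **Injectivity of the BCFW map** (Proposition 7.2).  If two BCFW matrices, built for the
same data `k_L, k_R, a, b, c, d, n` with both input triples satisfying the coindependence
hypotheses, have the same row span, then the row spans of `A` and `A'` agree, the row spans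
of `B` and `B'` agree, and the parameter vectors `(α,β,γ,δ,ε)` and `(α',β',γ',δ',ε')` are
positively proportional. -/
theorem bcfw_map_injective (kL kR n : ℕ) (a b c d nn : Fin n)
    (hab : (b : ℕ) = (a : ℕ) + 1) (hbc : b < c) (hcd : (d : ℕ) = (c : ℕ) + 1)
    (hdn : (nn : ℕ) = (d : ℕ) + 1) (hlast : (nn : ℕ) + 1 = n)
    (A A' : Matrix (Fin kL) (Fin n) ℝ) (B B' : Matrix (Fin kR) (Fin n) ℝ)
    (α β γ δ ε α' β' γ' δ' ε' : ℝ)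
    (hα : 0 < α) (hβ : 0 < β) (hγ : 0 < γ) (hδ : 0 < δ) (hε : 0 < ε)
    (hα' : 0 < α') (hβ' : 0 < β') (hγ' : 0 < γ') (hδ' : 0 < δ') (hε' : 0 < ε')
    (hA : LeftInput kL n a b nn A) (hA' : LeftInput kL n a b nn A')
    (hB : RightInput kR n b c B) (hB' : RightInput kR n b c B')
    (hspan : rowSpan (bcfwMatrix kL kR n A B α β γ δ ε a b c d nn) =
      rowSpan (bcfwMatrix kL kR n A' B' α' β' γ' δ' ε' a b c d nn)) :
    rowSpan A = rowSpan A' ∧ rowSpan B = rowSpan B' ∧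
      ∃ l : ℝ, 0 < l ∧ α = l * α' ∧ β = l * β' ∧ γ = l * γ' ∧ δ = l * δ' ∧ ε = l * ε' := by
  have hbc' : (b : ℕ) < c := hbc
  have hm : midRow kR α β γ δ ε a b c d nn ∈
      rowSpan (bcfwMatrix kL kR n A B α β γ δ ε a b c d nn) :=
    (mem_bcfw ..).2 ⟨0, Submodule.zero_mem _, 1, 0, Submodule.zero_mem _, by
      simp [phiL_zero, psiR_zero]⟩
  rw [hspan] at hm
  obtain ⟨l, hl⟩ := (bcfw_extract kL kR n a b c d nn hab hbc hcd hdn A' B' α' β' γ' δ' ε'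
      hα' hγ' hA' hB' _ hm).1 (by
        intro j h1
        have h1' : (j : ℕ) < a := h1
        have n1 : j ≠ a := by rintro rfl; omega
        have n2 : j ≠ b := by rintro rfl; omega
        have n3 : j ≠ c := by rintro rfl; omega
        have n4 : j ≠ d := by rintro rfl; omega
        have n5 : j ≠ nn := by rintro rfl; omega
        simp [midRow, n1, n2, n3, n4, n5]) (by
        intro j h1 h2
        have h1' : (b : ℕ) < j := h1
        have h2' : (j : ℕ) < c := h2
        have n1 : j ≠ a := by rintro rfl; omega
        have n2 : j ≠ b := by rintro rfl; omega
        have n3 : j ≠ c := by rintro rfl; omega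
        have n4 : j ≠ d := by rintro rfl; omega
        have n5 : j ≠ nn := by rintro rfl; omega
        simp [midRow, n1, n2, n3, n4, n5])
  have ba : b ≠ a := by rintro rfl; omega
  have ca : c ≠ a := by rintro rfl; omega
  have cb : c ≠ b := by rintro rfl; omega
  have da : d ≠ a := by rintro rfl; omega
  have db : d ≠ b := by rintro rfl; omega
  have dc : d ≠ c := by rintro rfl; omega
  have na : nn ≠ a := by rintro rfl; omega
  have nb : nn ≠ b := by rintro rfl; omega
  have nc : nn ≠ c := by rintro rfl; omega
  have nd : nn ≠ d := by rintro rfl; omega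
  have s0 : (-1 : ℝ) ^ kR ≠ 0 := pow_ne_zero _ (by norm_num)
  have la : α = l * α' := by simpa [midRow] using congrFun hl a
  have lb : β = l * β' := by simpa [midRow, ba] using congrFun hl b
  have lc : γ = l * γ' := by
    have := congrFun hl c
    simp only [midRow, ca, cb, if_false, if_true, Pi.smul_apply, smul_eq_mul] at this
    exact mul_left_cancel₀ s0 (by linarith)
  have ld : δ = l * δ' := by
    have := congrFun hl d
    simp only [midRow, da, db, dc, if_false, if_true, Pi.smul_apply, smul_eq_mul] at this
    exact mul_left_cancel₀ s0 (by linarith)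
  have le : ε = l * ε' := by
    have := congrFun hl nn
    simp only [midRow, na, nb, nc, nd, if_false, if_true, Pi.smul_apply, smul_eq_mul] at this
    exact mul_left_cancel₀ s0 (by linarith)
  have hl0 : 0 < l := by
    rw [la] at hα
    exact pos_of_mul_pos_left hα hα'.le
  have e1 : α / β = α' / β' := by rw [la, lb]; exact mul_div_mul_left _ _ hl0.ne'
  have e2 : γ / δ = γ' / δ' := by rw [lc, ld]; exact mul_div_mul_left _ _ hl0.ne'
  have e3 : δ / ε = δ' / ε' := by rw [ld, le]; exact mul_div_mul_left _ _ hl0.ne'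
  have H1 := bcfw_half kL kR n a b c d nn hab hbc hcd hdn A A' B B' α β γ δ ε α' β' γ' δ' ε'
    hα' hγ' hA hA' hB hB' e1 e2 e3 hspan
  have H2 := bcfw_half kL kR n a b c d nn hab hbc hcd hdn A' A B' B α' β' γ' δ' ε' α β γ δ ε
    hα hγ hA' hA hB' hB e1.symm e2.symm e3.symm hspan.symm
  exact ⟨le_antisymm H1.1 H2.1, le_antisymm H1.2 H2.2, l, hl0, la, lb, lc, ld, le⟩
end

section
/- Coindependence for BCFW matrices (first part of Lemma 7.5): Every BCFW matrix M = M(A, α, β, γ, δ, ε, B) has rank k, and for every 4-element subset J of {a, b, c, d, n} there exists a k-element subset I of {1,…,n} disjoint from J such that the k × k minor of M on the columns I is nonzero. -/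
theorem exists_sorted {k n : ℕ} {X : Type} [Fintype X] [DecidableEq X]
    (M : Matrix (Fin k) (Fin n) ℝ) (e : X ≃ Fin k) (g : X → Fin n)
    (hg : Function.Injective g) (hdet : (M.submatrix e g).det ≠ 0) :
    ∃ f : Fin k → Fin n, StrictMono f ∧ (∀ i, ∃ x, g x = f i) ∧
      (M.submatrix id f).det ≠ 0 := by
  classical
  have hc : (Finset.univ.image g).card = k := by
    rw [Finset.card_image_of_injective _ hg, Finset.card_univ, Fintype.card_congr e,
      Fintype.card_fin]
  let f := (Finset.univ.image g).orderEmbOfFin hc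
  have hf : ∀ i, ∃ x, g x = f i := by
    intro i
    have := Finset.orderEmbOfFin_mem (Finset.univ.image g) hc i
    obtain ⟨x, -, hx⟩ := Finset.mem_image.1 this
    exact ⟨x, hx⟩
  refine ⟨f, f.strictMono, hf, ?_⟩
  choose σ hσ using hf
  have hinj : Function.Injective σ := by
    intro i j hij
    apply f.injective
    rw [← hσ, ← hσ, hij]
  have hbij : Function.Bijective σ :=
    (Fintype.bijective_iff_injective_and_card σ).2 ⟨hinj, (Fintype.card_congr e).symm⟩
  let σ' : Fin k ≃ X := Equiv.ofBijective σ hbij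
  have h : M.submatrix id f = (M.submatrix e g).submatrix e.symm σ' := by
    ext i j
    simp [σ', hσ]
  have h1 : IsUnit (M.submatrix e g) := by
    rw [Matrix.isUnit_iff_isUnit_det]
    exact isUnit_iff_ne_zero.2 hdet
  have h2 : IsUnit (M.submatrix id f) := by
    rw [h]
    exact (Matrix.isUnit_submatrix_equiv _ _).2 h1
  rw [Matrix.isUnit_iff_isUnit_det] at h2
  exact h2.ne_zero

theorem rank_of_minor {k n : ℕ} (M : Matrix (Fin k) (Fin n) ℝ) (f : Fin k → Fin n)
    (h : (M.submatrix id f).det ≠ 0) : M.rank = k := by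
  apply le_antisymm
  · simpa using M.rank_le_card_height
  · have h1 : IsUnit (M.submatrix id f) := by
      rw [Matrix.isUnit_iff_isUnit_det]
      exact isUnit_iff_ne_zero.2 h
    have h2 := Matrix.rank_of_isUnit _ h1
    have h3 : M.submatrix id f = M * (1 : Matrix (Fin n) (Fin n) ℝ).submatrix id f := by
      ext i j
      simp [Matrix.mul_apply, Matrix.one_apply]
    rw [h3, Fintype.card_fin] at h2
    calc k = _ := h2.symm
      _ ≤ _ := Matrix.rank_mul_le_left _ _

open Matrix

/-- **Coindependence for BCFW matrices** (first part of Lemma 7.5).  Every BCFW matrix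
`M = M(A, α, β, γ, δ, ε, B)` has rank `k = k_L + 1 + k_R`, and for every 4-element subset
`J` of `{a, b, c, d, n}` there is a `k`-element set of columns disjoint from `J` on which
the `k × k` minor of `M` is nonzero. -/
theorem bcfw_rank_and_coindependence (kL kR n : ℕ) (a b c d nn : Fin n)
    (hab : (b : ℕ) = (a : ℕ) + 1) (hbc : b < c) (hcd : (d : ℕ) = (c : ℕ) + 1)
    (hdn : (nn : ℕ) = (d : ℕ) + 1) (hlast : (nn : ℕ) + 1 = n)
    (A : Matrix (Fin kL) (Fin n) ℝ) (B : Matrix (Fin kR) (Fin n) ℝ)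
    (α β γ δ ε : ℝ)
    (hα : 0 < α) (hβ : 0 < β) (hγ : 0 < γ) (hδ : 0 < δ) (hε : 0 < ε)
    (hA : LeftInput kL n a b nn A) (hB : RightInput kR n b c B) :
    (bcfwMatrix kL kR n A B α β γ δ ε a b c d nn).rank = kL + 1 + kR ∧
      ∀ J : Finset (Fin n), J ⊆ {a, b, c, d, nn} → J.card = 4 →
        ∃ f : Fin (kL + 1 + kR) → Fin n, StrictMono f ∧ (∀ i, f i ∉ J) ∧
          ((bcfwMatrix kL kR n A B α β γ δ ε a b c d nn).submatrix id f).det ≠ 0 := by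
  obtain ⟨hA0, -, fA, hfA, hfAa, hdA⟩ := hA
  obtain ⟨hB0, -, fB, hfB, hfBb, hdB⟩ := hB
  have key : ∀ J : Finset (Fin n), J ⊆ {a, b, c, d, nn} → J.card = 4 →
        ∃ f : Fin (kL + 1 + kR) → Fin n, StrictMono f ∧ (∀ i, f i ∉ J) ∧
          ((bcfwMatrix kL kR n A B α β γ δ ε a b c d nn).submatrix id f).det ≠ 0 := by
    intro J hJ hJc
    rw [Fin.lt_def] at hbc
    have hcard : ({a, b, c, d, nn} : Finset (Fin n)).card = 5 := by
      repeat rw [Finset.card_insert_of_notMem]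
      · simp
      all_goals
        simp only [Finset.mem_insert, Finset.mem_singleton, Fin.ext_iff]
        omega
    obtain ⟨x, hx, hxJ⟩ : ∃ x ∈ ({a, b, c, d, nn} : Finset (Fin n)), x ∉ J := by
      by_contra! hcon
      have := Finset.card_le_card (show ({a, b, c, d, nn} : Finset (Fin n)) ⊆ J from hcon)
      omega
    have hxs : (x : ℕ) = a ∨ (x : ℕ) = b ∨ (x : ℕ) = c ∨ (x : ℕ) = d ∨ (x : ℕ) = nn := by
      simpa [Fin.ext_iff] using hx
    have hJs : ∀ y ∈ J, (y : ℕ) = a ∨ (y : ℕ) = b ∨ (y : ℕ) = c ∨ (y : ℕ) = d ∨ (y : ℕ) = nn := by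
      intro y hy
      simpa [Fin.ext_iff] using hJ hy
    have hA' : ∀ i, (fA i : ℕ) < a := fun i => hfAa i
    have hB' : ∀ i, (b : ℕ) < fB i ∧ (fB i : ℕ) < c := fun i => hfBb i
    let g : (Fin kL ⊕ Fin 1) ⊕ Fin kR → Fin n := Sum.elim (Sum.elim fA (fun _ => x)) fB
    let e : (Fin kL ⊕ Fin 1) ⊕ Fin kR ≃ Fin (kL + 1 + kR) :=
      (Equiv.sumCongr finSumFinEquiv (Equiv.refl _)).trans finSumFinEquiv
    have hg : Function.Injective g := by
      rintro ((i | i) | i) ((j | j) | j) hij <;>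
        simp only [g, Sum.elim_inl, Sum.elim_inr] at hij
      · rw [hfA.injective hij]
      · have := hA' i
        rw [Fin.ext_iff] at hij; omega
      · have := hA' i
        have := hB' j
        rw [Fin.ext_iff] at hij; omega
      · have := hA' j
        rw [Fin.ext_iff] at hij; omega
      · rw [Subsingleton.elim i j]
      · have := hB' j
        rw [Fin.ext_iff] at hij; omega
      · have := hA' j
        have := hB' i
        rw [Fin.ext_iff] at hij; omega
      · have := hB' i
        rw [Fin.ext_iff] at hij; omega
      · rw [hfB.injective hij]
    let M := bcfwMatrix kL kR n A B α β γ δ ε a b c d nn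
    have hdet : (M.submatrix e g).det ≠ 0 := by
      have hblock : M.submatrix e g = Matrix.fromBlocks
          (Matrix.fromBlocks (A.submatrix id fA)
            (M.submatrix (fun i => e (Sum.inl (Sum.inl i))) (fun _ => x)) 0
            (M.submatrix (fun i => e (Sum.inl (Sum.inr i))) (fun _ => x))) 0
          (M.submatrix (fun i => e (Sum.inr i)) (fun j => g (Sum.inl j)))
          (B.submatrix id fB) := by
        ext i j
        rcases i with (i | i) | i <;> rcases j with (j | j) | j
        · have h1 := hA' j
          have e1 : fA j ≠ a := by rw [Ne, Fin.ext_iff]; omega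
          have e2 : fA j ≠ nn := by rw [Ne, Fin.ext_iff]; omega
          simp [M, e, g, bcfwMatrix, e1, e2]
        · simp [g]
        · have h1 := hB' j
          have e1 : fB j ≠ a := by rw [Ne, Fin.ext_iff]; omega
          have e2 : fB j ≠ nn := by rw [Ne, Fin.ext_iff]; omega
          have e3 : ¬(fB j ≤ b ∨ fB j = nn) := by rw [Fin.le_def, Fin.ext_iff]; omega
          simp [M, e, g, bcfwMatrix, e1, e2, hA0 _ e3]
        · have h1 := hA' j
          have e1 : fA j ≠ a := by rw [Ne, Fin.ext_iff]; omega
          have e2 : fA j ≠ b := by rw [Ne, Fin.ext_iff]; omega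
          have e3 : fA j ≠ c := by rw [Ne, Fin.ext_iff]; omega
          have e4 : fA j ≠ d := by rw [Ne, Fin.ext_iff]; omega
          have e5 : fA j ≠ nn := by rw [Ne, Fin.ext_iff]; omega
          simp [M, e, g, bcfwMatrix, e1, e2, e3, e4, e5]
        · simp [g]
        · have h1 := hB' j
          have e1 : fB j ≠ a := by rw [Ne, Fin.ext_iff]; omega
          have e2 : fB j ≠ b := by rw [Ne, Fin.ext_iff]; omega
          have e3 : fB j ≠ c := by rw [Ne, Fin.ext_iff]; omega
          have e4 : fB j ≠ d := by rw [Ne, Fin.ext_iff]; omega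
          have e5 : fB j ≠ nn := by rw [Ne, Fin.ext_iff]; omega
          simp [M, e, g, bcfwMatrix, e1, e2, e3, e4, e5]
        · simp
        · simp
        · have h1 := hB' j
          have e3 : fB j ≠ c := by rw [Ne, Fin.ext_iff]; omega
          have e4 : fB j ≠ d := by rw [Ne, Fin.ext_iff]; omega
          have h2 : ¬ (kL + 1 + (i : ℕ) < kL) := by omega
          have h3 : ¬ (kL + 1 + (i : ℕ) = kL) := by omega
          have h4 : kL + 1 + (i : ℕ) - kL - 1 = i := by omega
          simp [M, e, g, bcfwMatrix, e3, e4, h2, h3, h4]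
      rw [hblock, Matrix.det_fromBlocks_zero₁₂, Matrix.det_fromBlocks_zero₂₁]
      refine mul_ne_zero (mul_ne_zero hdA ?_) hdB
      rw [Matrix.det_fin_one]
      simp only [Finset.mem_insert, Finset.mem_singleton] at hx
      simp only [M, e, bcfwMatrix, Matrix.submatrix_apply, Matrix.of_apply]
      rw [dif_neg (by simp), dif_pos (by simp)]
      have hs : (-1 : ℝ) ^ kR ≠ 0 := pow_ne_zero _ (by norm_num)
      split_ifs
      · exact hα.ne'
      · exact hβ.ne'
      · exact mul_ne_zero hs hγ.ne'
      · exact mul_ne_zero hs hδ.ne'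
      · exact mul_ne_zero hs hε.ne'
      · tauto
    obtain ⟨f, hf, hfg, hfd⟩ := exists_sorted M e g hg hdet
    refine ⟨f, hf, ?_, hfd⟩
    intro i hi
    obtain ⟨y, hy⟩ := hfg i
    rw [← hy] at hi
    rcases y with (y | y) | y
    · have := hJs _ hi
      have h2 := hA' y
      simp only [g, Sum.elim_inl] at this
      omega
    · exact hxJ hi
    · have := hJs _ hi
      have h2 := hB' y
      simp only [g, Sum.elim_inr] at this
      omega
  refine ⟨?_, key⟩
  obtain ⟨f, -, -, hf⟩ := key {a, b, c, d} (by
      intro y; simp only [Finset.mem_insert, Finset.mem_singleton]; tauto) (by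
      rw [Fin.lt_def] at hbc
      repeat rw [Finset.card_insert_of_notMem]
      · simp
      all_goals
        simp only [Finset.mem_insert, Finset.mem_singleton, Fin.ext_iff]
        omega)
  exact rank_of_minor _ f hf
end

section
/- Signs of the five special twistor coordinates on a BCFW product (Lemma 8.5): Let M = M(A, α, β, γ, δ, ε, B) be a BCFW matrix and let Z be a real n × (k+4) matrix all of whose (k+4) × (k+4) minors (on increasing row sets) are positive. Write Y := M·Z, and for indices i₁, i₂, i₃, i₄ let ⟨⟨Z_{i₁} Z_{i₂} Z_{i₃} Z_{i₄}⟩⟩ denote the determinant of the (k+4) × (k+4) matrix whose rows are the k rows of Y followed by rows i₁, i₂, i₃, i₄ of Z. Then the following five numbers are strictly positive: (−1)^{k_R}·⟨⟨Z_b Z_c Z_d Z_n⟩⟩, (−1)^{k_R+1}·⟨⟨Z_a Z_c Z_d Z_n⟩⟩, ⟨⟨Z_a Z_b Z_d Z_n⟩⟩, −⟨⟨Z_a Z_b Z_c Z_n⟩⟩, and ⟨⟨Z_a Z_b Z_c Z_d⟩⟩. -/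
open Matrix

/-- An `n × m` real matrix is positive if all of its `m × m` minors,
taken with rows in increasing order, are positive. -/
def PosMat {n m : ℕ} (Z : Matrix (Fin n) (Fin m) ℝ) : Prop :=
  ∀ g : Fin m → Fin n, StrictMono g → 0 < (Z.submatrix g id).det

/-- The twistor coordinate `⟨⟨Y w₁ w₂ w₃ w₄⟩⟩`: the determinant of the `(k+4) × (k+4)`
matrix whose rows are the `k` rows of `Y` followed by `w₁, w₂, w₃, w₄`. -/
noncomputable def twistor {k : ℕ} (Y : Matrix (Fin k) (Fin (k + 4)) ℝ)
    (w₁ w₂ w₃ w₄ : Fin (k + 4) → ℝ) : ℝ :=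
  (Matrix.of (Fin.append (fun i : Fin k => Y i) ![w₁, w₂, w₃, w₄])).det


namespace BCFW

open Finset in
theorem cb_sum {k n : ℕ} {V : Type*} [AddCommGroup V] [Module ℝ V]
    (φ : V [⋀^Fin k]→ₗ[ℝ] ℝ) (A : Matrix (Fin k) (Fin n) ℝ) (z : Fin n → V) :
    (Fintype.card (Equiv.Perm (Fin k)) : ℝ) * φ (fun i => ∑ j, A i j • z j) =
      ∑ f : Fin k → Fin n, (A.submatrix id f).det * φ (z ∘ f) := by
  have h1 : φ (fun i => ∑ j, A i j • z j) =
      ∑ f : Fin k → Fin n, (∏ i, A i (f i)) * φ (z ∘ f) := by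
    have := φ.toMultilinearMap.map_sum (fun i j => A i j • z j)
    simp only [AlternatingMap.coe_multilinearMap] at this
    rw [this]
    refine Finset.sum_congr rfl fun f _ => ?_
    have := φ.toMultilinearMap.map_smul_univ (fun i => A i (f i)) (fun i => z (f i))
    simp only [AlternatingMap.coe_multilinearMap, smul_eq_mul] at this
    exact this
  have h2 : ∀ σ : Equiv.Perm (Fin k), φ (fun i => ∑ j, A i j • z j) =
      ∑ f : Fin k → Fin n, ((Equiv.Perm.sign σ : ℤ) : ℝ) * (∏ i, A i (f (σ i))) * φ (z ∘ f) := by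
    intro σ
    rw [h1, ← Equiv.sum_comp (Equiv.arrowCongr σ.symm (Equiv.refl (Fin n)))]
    refine Finset.sum_congr rfl fun f _ => ?_
    have := φ.map_perm (z ∘ f) σ
    change (∏ i, A i (f (σ i))) * φ (z ∘ f ∘ ⇑σ) = _
    have e : (z ∘ f ∘ ⇑σ) = (z ∘ f) ∘ ⇑σ := rfl
    rw [e, this, Units.smul_def, zsmul_eq_mul]
    ring
  have h3 : (Fintype.card (Equiv.Perm (Fin k)) : ℝ) * φ (fun i => ∑ j, A i j • z j) =
      ∑ σ : Equiv.Perm (Fin k), φ (fun i => ∑ j, A i j • z j) := by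
    simp [Finset.sum_const, Finset.card_univ]
  rw [h3, Finset.sum_congr rfl (fun σ _ => h2 σ), Finset.sum_comm]
  refine Finset.sum_congr rfl fun f _ => ?_
  rw [← Finset.sum_mul, ← Matrix.det_transpose, Matrix.det_apply']
  simp

theorem cb_pos {k n : ℕ} {V : Type*} [AddCommGroup V] [Module ℝ V]
    (φ : V [⋀^Fin k]→ₗ[ℝ] ℝ) (A : Matrix (Fin k) (Fin n) ℝ) (z : Fin n → V) (S : Fin n → Prop)
    (hA0 : ∀ j, ¬ S j → ∀ i, A i j = 0)
    (hA : ∀ f : Fin k → Fin n, StrictMono f → (∀ i, S (f i)) → 0 ≤ (A.submatrix id f).det)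
    (hφ : ∀ f : Fin k → Fin n, StrictMono f → (∀ i, S (f i)) → 0 < φ (z ∘ f))
    (f₀ : Fin k → Fin n) (hf₀ : StrictMono f₀) (hS₀ : ∀ i, S (f₀ i))
    (hd : (A.submatrix id f₀).det ≠ 0) :
    0 < φ (fun i => ∑ j, A i j • z j) := by
  have hc : (0 : ℝ) < (Fintype.card (Equiv.Perm (Fin k)) : ℝ) := by
    exact_mod_cast Fintype.card_pos
  refine pos_of_mul_pos_right (a := (Fintype.card (Equiv.Perm (Fin k)) : ℝ)) ?_ hc.le
  rw [cb_sum]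
  refine Finset.sum_pos' (fun f _ => ?_) ⟨f₀, Finset.mem_univ _, ?_⟩
  · by_cases hS : ∀ i, S (f i)
    · by_cases hi : Function.Injective f
      · set σ := Tuple.sort f
        have hm : StrictMono (f ∘ σ) :=
          (Tuple.monotone_sort f).strictMono_of_injective (hi.comp σ.injective)
        have a1 := hA _ hm (fun i => hS _)
        have a2 := hφ _ hm (fun i => hS _)
        have e1 : (A.submatrix id (f ∘ σ)).det =
            ((Equiv.Perm.sign σ : ℤ) : ℝ) * (A.submatrix id f).det := by
          rw [← Matrix.det_permute' σ (A.submatrix id f)]; rfl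
        have e2 : φ (z ∘ (f ∘ σ)) = ((Equiv.Perm.sign σ : ℤ) : ℝ) * φ (z ∘ f) := by
          have := φ.map_perm (z ∘ f) σ
          rw [Units.smul_def, zsmul_eq_mul] at this
          exact this
        rw [e1] at a1
        rw [e2] at a2
        have := mul_nonneg a1 a2.le
        have hs : ((Equiv.Perm.sign σ : ℤ) : ℝ) * ((Equiv.Perm.sign σ : ℤ) : ℝ) = 1 := by
          rcases Int.units_eq_one_or (Equiv.Perm.sign σ) with h | h <;> simp [h]
        calc (0:ℝ) ≤ _ := this
          _ = (((Equiv.Perm.sign σ : ℤ) : ℝ) * ((Equiv.Perm.sign σ : ℤ) : ℝ)) *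
            ((A.submatrix id f).det * φ (z ∘ f)) := by ring
          _ = _ := by rw [hs, one_mul]
      · have : φ (z ∘ f) = 0 := by
          simp only [Function.Injective, not_forall] at hi
          obtain ⟨i, j, hij, hne⟩ := hi
          exact φ.map_eq_zero_of_eq _ (by simp [hij]) hne
        rw [this, mul_zero]
    · push Not at hS
      obtain ⟨i, hi⟩ := hS
      rw [Matrix.det_eq_zero_of_column_eq_zero i (fun j => hA0 _ hi _), zero_mul]
  · exact mul_pos (lt_of_le_of_ne (hA _ hf₀ hS₀) (Ne.symm hd)) (hφ _ hf₀ hS₀)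

/-- Fix the second and third block. -/
def fixL {p q r : ℕ} {V : Type*} [AddCommGroup V] [Module ℝ V]
    (Φ : V [⋀^((Fin p ⊕ Fin q) ⊕ Fin r)]→ₗ[ℝ] ℝ) (w : Fin q → V) (u : Fin r → V) :
    V [⋀^Fin p]→ₗ[ℝ] ℝ where
  toFun v := Φ (Sum.elim (Sum.elim v w) u)
  map_update_add' := by
    intro inst v i x y
    rw [Subsingleton.elim inst (instDecidableEqFin p)]
    simp only [← Sum.update_elim_inl, AlternatingMap.map_update_add]
  map_update_smul' := by
    intro inst v i c x
    rw [Subsingleton.elim inst (instDecidableEqFin p)]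
    simp only [← Sum.update_elim_inl, AlternatingMap.map_update_smul]
  map_eq_zero_of_eq' v i j h hij :=
    Φ.map_eq_zero_of_eq _ (i := Sum.inl (Sum.inl i)) (j := Sum.inl (Sum.inl j))
      (by simpa using h) (by simpa using hij)

/-- Fix the first and third block. -/
def fixR {p q r : ℕ} {V : Type*} [AddCommGroup V] [Module ℝ V]
    (Φ : V [⋀^((Fin p ⊕ Fin q) ⊕ Fin r)]→ₗ[ℝ] ℝ) (w : Fin p → V) (u : Fin r → V) :
    V [⋀^Fin q]→ₗ[ℝ] ℝ where
  toFun v := Φ (Sum.elim (Sum.elim w v) u)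
  map_update_add' := by
    intro inst v i x y
    rw [Subsingleton.elim inst (instDecidableEqFin q)]
    simp only [← Sum.update_elim_inl, ← Sum.update_elim_inr, AlternatingMap.map_update_add]
  map_update_smul' := by
    intro inst v i c x
    rw [Subsingleton.elim inst (instDecidableEqFin q)]
    simp only [← Sum.update_elim_inl, ← Sum.update_elim_inr, AlternatingMap.map_update_smul]
  map_eq_zero_of_eq' v i j h hij :=
    Φ.map_eq_zero_of_eq _ (i := Sum.inl (Sum.inr i)) (j := Sum.inl (Sum.inr j))
      (by simpa using h) (by simpa using hij)

/-- The ordering of the rows. -/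
def eFun (kL kR : ℕ) : (Fin kL ⊕ Fin kR) ⊕ Fin 5 → Fin (kL + 1 + kR + 4) :=
  Sum.elim (Sum.elim
    (fun i => Fin.castAdd 4 ⟨i, by have := i.isLt; omega⟩)
    (fun j => Fin.castAdd 4 ⟨kL + 1 + j, by have := j.isLt; omega⟩))
    (Fin.cons (Fin.castAdd 4 ⟨kL, by omega⟩) (fun s : Fin 4 => Fin.natAdd (kL + 1 + kR) s))

theorem eFun_bij (kL kR : ℕ) : Function.Bijective (eFun kL kR) := by
  rw [Fintype.bijective_iff_injective_and_card]
  constructor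
  · rintro ((i | i) | i) ((j | j) | j) h <;>
      have h := congrArg Fin.val h <;>
      (try (revert h; refine Fin.cases ?_ (fun s => ?_) i <;> intro h)) <;>
      (try (revert h; refine Fin.cases ?_ (fun s' => ?_) j <;> intro h)) <;>
      simp [eFun] at h ⊢ <;> (try apply Fin.ext) <;> omega
  · simp; omega

noncomputable def eEq (kL kR : ℕ) : (Fin kL ⊕ Fin kR) ⊕ Fin 5 ≃ Fin (kL + 1 + kR + 4) :=
  Equiv.ofBijective _ (eFun_bij kL kR)

noncomputable def Phi (kL kR : ℕ) : (Fin (kL + 1 + kR + 4) → ℝ)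
    [⋀^((Fin kL ⊕ Fin kR) ⊕ Fin 5)]→ₗ[ℝ] ℝ :=
  (Matrix.detRowAlternating (n := Fin (kL + 1 + kR + 4)) (R := ℝ)).domDomCongr (eEq kL kR).symm

theorem Phi_apply (kL kR : ℕ) (w : (Fin kL ⊕ Fin kR) ⊕ Fin 5 → (Fin (kL + 1 + kR + 4) → ℝ)) :
    Phi kL kR w = (Matrix.of (fun i => w ((eEq kL kR).symm i))).det := rfl

/-- The sorted row selection. -/
def qFun (kL kR n : ℕ) (f : Fin kL → Fin n) (g : Fin kR → Fin n) (a b c d nn : Fin n) :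
    Fin (kL + 1 + kR + 4) → Fin n := fun p =>
  if h : (p : ℕ) < kL then f ⟨p, h⟩
  else if (p : ℕ) = kL then a
  else if (p : ℕ) = kL + 1 then b
  else if h : (p : ℕ) - (kL + 2) < kR then g ⟨p - (kL + 2), h⟩
  else if (p : ℕ) = kL + 2 + kR then c
  else if (p : ℕ) = kL + 3 + kR then d else nn

theorem qFun_mono (kL kR n : ℕ) (f : Fin kL → Fin n) (g : Fin kR → Fin n) (a b c d nn : Fin n)
    (hf : StrictMono f) (hg : StrictMono g) (hfa : ∀ i, f i < a) (hgb : ∀ i, b < g i)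
    (hgc : ∀ i, g i < c) (hab : a < b) (hbc : b < c) (hcd : c < d) (hdn : d < nn) :
    StrictMono (qFun kL kR n f g a b c d nn) := by
  intro p r hpr
  have hpr' : (p : ℕ) < r := hpr
  have := p.isLt
  have := r.isLt
  unfold qFun
  split_ifs <;> first
    | omega
    | (apply hf; exact hpr)
    | (apply hg; rw [Fin.lt_def]; simp only; omega)
    | (have h1 := hfa ⟨p, by assumption⟩
       first
        | order
        | (have h2 := hgb ⟨r - (kL + 2), by assumption⟩; order))
    | (have h1 := hgc ⟨p - (kL + 2), by assumption⟩; order)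
    | (have h1 := hgb ⟨r - (kL + 2), by assumption⟩; order)
    | order

theorem qFun_a (kL kR n : ℕ) (f : Fin kL → Fin n) (g : Fin kR → Fin n) (a b c d nn : Fin n)
    (p : Fin (kL + 1 + kR + 4)) (hp : (p : ℕ) = kL) :
    qFun kL kR n f g a b c d nn p = a := by
  unfold qFun
  rw [dif_neg (by omega), if_pos hp]

theorem qFun_b (kL kR n : ℕ) (f : Fin kL → Fin n) (g : Fin kR → Fin n) (a b c d nn : Fin n)
    (p : Fin (kL + 1 + kR + 4)) (hp : (p : ℕ) = kL + 1) :
    qFun kL kR n f g a b c d nn p = b := by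
  unfold qFun
  rw [dif_neg (by omega), if_neg (by omega), if_pos hp]

theorem qFun_c (kL kR n : ℕ) (f : Fin kL → Fin n) (g : Fin kR → Fin n) (a b c d nn : Fin n)
    (p : Fin (kL + 1 + kR + 4)) (hp : (p : ℕ) = kL + 1 + kR + 1) :
    qFun kL kR n f g a b c d nn p = c := by
  unfold qFun
  rw [dif_neg (by omega), if_neg (by omega), if_neg (by omega), dif_neg (by omega), if_pos (by omega)]

theorem qFun_d (kL kR n : ℕ) (f : Fin kL → Fin n) (g : Fin kR → Fin n) (a b c d nn : Fin n)
    (p : Fin (kL + 1 + kR + 4)) (hp : (p : ℕ) = kL + 1 + kR + 2) :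
    qFun kL kR n f g a b c d nn p = d := by
  unfold qFun
  rw [dif_neg (by omega), if_neg (by omega), if_neg (by omega), dif_neg (by omega), if_neg (by omega), if_pos (by omega)]

theorem qFun_nn (kL kR n : ℕ) (f : Fin kL → Fin n) (g : Fin kR → Fin n) (a b c d nn : Fin n)
    (p : Fin (kL + 1 + kR + 4)) (hp : (p : ℕ) = kL + 1 + kR + 3) :
    qFun kL kR n f g a b c d nn p = nn := by
  unfold qFun
  rw [dif_neg (by omega), if_neg (by omega), if_neg (by omega), dif_neg (by omega), if_neg (by omega), if_neg (by omega)]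

set_option maxHeartbeats 800000 in
theorem base_pos (kL kR n : ℕ) (f : Fin kL → Fin n) (g : Fin kR → Fin n) (a b c d nn : Fin n)
    (hf : StrictMono f) (hg : StrictMono g) (hfa : ∀ i, f i < a) (hgb : ∀ i, b < g i)
    (hgc : ∀ i, g i < c) (hab : a < b) (hbc : b < c) (hcd : c < d) (hdn : d < nn)
    (Z : Matrix (Fin n) (Fin (kL + 1 + kR + 4)) ℝ) (hZ : PosMat Z) :
    0 < (-1 : ℝ) ^ kR * Phi kL kR
      (Sum.elim (Sum.elim (Z ∘ f) (Z ∘ g)) (Z ∘ ![a, b, c, d, nn])) := by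
  have hq := hZ _ (qFun_mono kL kR n f g a b c d nn hf hg hfa hgb hgc hab hbc hcd hdn)
  let i₀ : Fin (kL + 1 + kR + 4) := ⟨kL + 1, by omega⟩
  let j₀ : Fin (kL + 1 + kR + 4) := ⟨kL + 1 + kR, by omega⟩
  have hij : i₀ ≤ j₀ := by rw [Fin.le_def]; simp [i₀, j₀]
  have key : ∀ t, Sum.elim (Sum.elim f g) ![a, b, c, d, nn] t =
      qFun kL kR n f g a b c d nn (Fin.cycleIcc i₀ j₀ (eEq kL kR t)) := by
    have c1 : ∀ p : Fin (kL + 1 + kR + 4), (p : ℕ) < kL + 1 → (Fin.cycleIcc i₀ j₀ p : ℕ) = p := by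
      intro p hp
      rw [Fin.cycleIcc_of_lt (by rw [Fin.lt_def]; exact hp)]
    have c2 : ∀ p : Fin (kL + 1 + kR + 4), kL + 1 + kR < (p : ℕ) →
        (Fin.cycleIcc i₀ j₀ p : ℕ) = p := by
      intro p hp
      rw [Fin.cycleIcc_of_gt (by rw [Fin.lt_def]; exact hp)]
    have c3 : ∀ p : Fin (kL + 1 + kR + 4), kL + 1 ≤ (p : ℕ) → (p : ℕ) < kL + 1 + kR →
        (Fin.cycleIcc i₀ j₀ p : ℕ) = p + 1 := by
      intro p hp hp'
      rw [Fin.cycleIcc_of_ge_of_lt (by rw [Fin.le_def]; exact hp) (by rw [Fin.lt_def]; exact hp')]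
      rw [Fin.val_add_one_of_lt']
      omega
    have c4 : ∀ p : Fin (kL + 1 + kR + 4), (p : ℕ) = kL + 1 + kR →
        (Fin.cycleIcc i₀ j₀ p : ℕ) = kL + 1 := by
      intro p hp
      have : p = j₀ := Fin.ext hp
      rw [this, Fin.cycleIcc_of_last hij]
    rintro ((i | j) | s)
    · have e : (eEq kL kR (Sum.inl (Sum.inl i)) : ℕ) = i := rfl
      have := c1 (eEq kL kR (Sum.inl (Sum.inl i))) (by have := i.isLt; omega)
      simp [qFun, this, e]
    · have e : (eEq kL kR (Sum.inl (Sum.inr j)) : ℕ) = kL + 1 + j := rfl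
      have hj := j.isLt
      have := c3 (eEq kL kR (Sum.inl (Sum.inr j))) (by omega) (by omega)
      rw [e] at this
      have h5 : kL + 1 + (j : ℕ) + 1 - (kL + 2) = j := by omega
      simp only [qFun, this, h5]
      rw [dif_neg (by omega), if_neg (by omega), if_neg (by omega), dif_pos hj]
      rfl
    · have e0 : (eEq kL kR (Sum.inr 0) : ℕ) = kL := rfl
      have e1 : (eEq kL kR (Sum.inr 1) : ℕ) = kL + 1 + kR := rfl
      have e2 : (eEq kL kR (Sum.inr 2) : ℕ) = kL + 1 + kR + 1 := rfl
      have e3 : (eEq kL kR (Sum.inr 3) : ℕ) = kL + 1 + kR + 2 := rfl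
      have e4 : (eEq kL kR (Sum.inr 4) : ℕ) = kL + 1 + kR + 3 := rfl
      have d0 := c1 _ (by rw [e0]; omega)
      have d1 := c4 _ e1
      have d2 := c2 _ (by rw [e2]; omega)
      have d3 := c2 _ (by rw [e3]; omega)
      have d4 := c2 _ (by rw [e4]; omega)
      rw [e0] at d0
      rw [e2] at d2
      rw [e3] at d3
      rw [e4] at d4
      fin_cases s
      · exact (qFun_a kL kR n f g a b c d nn _ d0).symm
      · exact (qFun_b kL kR n f g a b c d nn _ d1).symm
      · exact (qFun_c kL kR n f g a b c d nn _ d2).symm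
      · exact (qFun_d kL kR n f g a b c d nn _ d3).symm
      · exact (qFun_nn kL kR n f g a b c d nn _ d4).symm
  have h1 : Phi kL kR (Sum.elim (Sum.elim (Z ∘ f) (Z ∘ g)) (Z ∘ ![a, b, c, d, nn])) =
      ((Z.submatrix (qFun kL kR n f g a b c d nn) id).submatrix (Fin.cycleIcc i₀ j₀) id).det := by
    rw [Phi_apply]
    congr 1
    ext p r
    obtain ⟨t, rfl⟩ := (eEq kL kR).surjective p
    have := key t
    simp only [Matrix.of_apply, Equiv.symm_apply_apply, Matrix.submatrix_apply, id, ← this]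
    rcases t with (t | t) | t <;> rfl
  rw [h1, Matrix.det_permute, Fin.sign_cycleIcc_of_le hij]
  have h2 : (j₀ - i₀ : ℕ) = kR := by simp [i₀, j₀]
  rw [h2, ← mul_assoc]
  have : (-1 : ℝ) ^ kR * (((((-1 : ℤˣ) ^ kR) : ℤˣ) : ℤ) : ℝ) = 1 := by
    push_cast
    rw [← mul_pow]; simp
  rw [this, one_mul]
  exact hq

theorem W_pos (kL kR n : ℕ) (a b c d nn : Fin n)
    (hab : a < b) (hbc : b < c) (hcd : c < d) (hdn : d < nn)
    (A : Matrix (Fin kL) (Fin n) ℝ) (B : Matrix (Fin kR) (Fin n) ℝ)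
    (hA : LeftInput kL n a b nn A) (hB : RightInput kR n b c B)
    (Z : Matrix (Fin n) (Fin (kL + 1 + kR + 4)) ℝ) (hZ : PosMat Z) :
    0 < (-1 : ℝ) ^ kR * Phi kL kR
      (Sum.elim (Sum.elim (fun i => ∑ j, (if j < a then A i j else 0) • Z j)
        (fun i => ∑ j, (if b < j ∧ j < c then B i j else 0) • Z j))
        (Z ∘ ![a, b, c, d, nn])) := by
  obtain ⟨-, hA1, f₀, hf₀, hf₀a, hf₀d⟩ := hA
  obtain ⟨-, hB1, g₀, hg₀, hg₀b, hg₀d⟩ := hB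
  have eA : ∀ f : Fin kL → Fin n, (∀ i, f i < a) →
      (Matrix.of fun i j => if j < a then A i j else 0).submatrix id f = A.submatrix id f := by
    intro f hf
    ext i j
    simp [hf j]
  have eB : ∀ f : Fin kR → Fin n, (∀ i, b < f i ∧ f i < c) →
      (Matrix.of fun i j => if b < j ∧ j < c then B i j else 0).submatrix id f =
        B.submatrix id f := by
    intro f hf
    ext i j
    simp [hf j]
  refine cb_pos (fixL ((-1 : ℝ) ^ kR • Phi kL kR)
    (fun i => ∑ j, (if b < j ∧ j < c then B i j else 0) • Z j) (Z ∘ ![a, b, c, d, nn]))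
    (Matrix.of fun i j => if j < a then A i j else 0) Z (fun j => j < a) ?_ ?_ ?_ f₀ hf₀ hf₀a ?_
  · intro j hj i
    simp only [Matrix.of_apply, if_neg hj]
  · intro f hf hfa
    rw [eA f hfa]
    exact hA1 f hf
  · intro f hf hfa
    refine cb_pos (fixR ((-1 : ℝ) ^ kR • Phi kL kR) (Z ∘ f) (Z ∘ ![a, b, c, d, nn]))
      (Matrix.of fun i j => if b < j ∧ j < c then B i j else 0) Z (fun j => b < j ∧ j < c)
      ?_ ?_ ?_ g₀ hg₀ hg₀b ?_
    · intro j hj i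
      simp only [Matrix.of_apply, if_neg hj]
    · intro g hg hgb
      rw [eB g hgb]
      exact hB1 g hg
    · intro g hg hgb
      exact base_pos kL kR n f g a b c d nn hf hg hfa (fun i => (hgb i).1) (fun i => (hgb i).2)
        hab hbc hcd hdn Z hZ
    · rw [eB g₀ hg₀b]
      exact hg₀d
  · rw [eA f₀ hf₀a]
    exact hf₀d

/-- The five by five block. -/
noncomputable def N5 (v : Fin 5 → ℝ) (w : Fin 4 → Fin 5) : Matrix (Fin 5) (Fin 5) ℝ :=
  Matrix.of (Fin.cons v (fun r s => if w r = s then 1 else 0))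

theorem sum_sp {n : ℕ} (a b c d nn : Fin n) (hab : a < b) (hbc : b < c) (hcd : c < d)
    (hdn : d < nn) (v : Fin n → ℝ) (p : Fin n → Prop) [DecidablePred p]
    (hpa : ¬ p a) (hpb : ¬ p b) (hpc : ¬ p c) (hpd : ¬ p d) (hpn : ¬ p nn)
    (h0 : ∀ j, ¬ p j → j ≠ a → j ≠ b → j ≠ c → j ≠ d → j ≠ nn → v j = 0)
    {m : ℕ} (Z : Matrix (Fin n) (Fin m) ℝ) (r : Fin m) :
    ∑ j, v j * Z j r = ∑ j, (if p j then v j else 0) * Z j r +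
      ∑ s, v (![a, b, c, d, nn] s) * Z (![a, b, c, d, nn] s) r := by
  have hv : ∀ j, v j * Z j r = (if p j then v j else 0) * Z j r +
      ((if j = a then v a * Z a r else 0) + (if j = b then v b * Z b r else 0) +
      (if j = c then v c * Z c r else 0) + (if j = d then v d * Z d r else 0) +
      (if j = nn then v nn * Z nn r else 0)) := by
    intro j
    have := hab.trans hbc
    have := hbc.trans hcd
    have := hcd.trans hdn
    by_cases ha : j = a
    · subst ha
      have h1 : j ≠ b := by order
      have h2 : j ≠ c := by order
      have h3 : j ≠ d := by order
      have h4 : j ≠ nn := by order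
      simp [*]
    by_cases hb : j = b
    · subst hb
      have h2 : j ≠ c := by order
      have h3 : j ≠ d := by order
      have h4 : j ≠ nn := by order
      simp [*]
    by_cases hc : j = c
    · subst hc
      have h3 : j ≠ d := by order
      have h4 : j ≠ nn := by order
      simp [*]
    by_cases hd : j = d
    · subst hd
      have h4 : j ≠ nn := by order
      simp [*]
    by_cases hn : j = nn
    · subst hn
      simp [*]
    by_cases hp : p j
    · simp [*]
    · simp [*]
  rw [Finset.sum_congr rfl (fun j _ => hv j)]
  simp only [Finset.sum_add_distrib, Finset.sum_ite_eq', Finset.mem_univ, if_true,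
    Fin.sum_univ_five]
  rfl

theorem twistor_eq (kL kR n : ℕ) (a b c d nn : Fin n)
    (hab : a < b) (hbc : b < c) (hcd : c < d) (hdn : d < nn)
    (hab1 : (b : ℕ) = (a : ℕ) + 1) (hcd1 : (d : ℕ) = (c : ℕ) + 1)
    (hdn1 : (nn : ℕ) = (d : ℕ) + 1) (hlast : (nn : ℕ) + 1 = n)
    (A : Matrix (Fin kL) (Fin n) ℝ) (B : Matrix (Fin kR) (Fin n) ℝ) (α β γ δ ε : ℝ)
    (hA : LeftInput kL n a b nn A) (hB : RightInput kR n b c B)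
    (Z : Matrix (Fin n) (Fin (kL + 1 + kR + 4)) ℝ) (w : Fin 4 → Fin 5)
    (w₁ w₂ w₃ w₄ : Fin n)
    (hw : ∀ r, ![w₁, w₂, w₃, w₄] r = ![a, b, c, d, nn] (w r)) :
    twistor (bcfwMatrix kL kR n A B α β γ δ ε a b c d nn * Z) (Z w₁) (Z w₂) (Z w₃) (Z w₄) =
    (N5 ![α, β, (-1) ^ kR * γ, (-1) ^ kR * δ, (-1) ^ kR * ε] w).det * Phi kL kR
      (Sum.elim (Sum.elim (fun i => ∑ j, (if j < a then A i j else 0) • Z j)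
        (fun i => ∑ j, (if b < j ∧ j < c then B i j else 0) • Z j))
        (Z ∘ ![a, b, c, d, nn])) := by
  set M := bcfwMatrix kL kR n A B α β γ δ ε a b c d nn with hM
  set W : (Fin kL ⊕ Fin kR) ⊕ Fin 5 → Fin (kL + 1 + kR + 4) → ℝ :=
    (Sum.elim (Sum.elim (fun i => ∑ j, (if j < a then A i j else 0) • Z j)
        (fun i => ∑ j, (if b < j ∧ j < c then B i j else 0) • Z j))
        (Z ∘ ![a, b, c, d, nn])) with hW
  let iA : Fin kL → Fin (kL + 1 + kR) := fun i => ⟨i, by have := i.isLt; omega⟩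
  let iB : Fin kR → Fin (kL + 1 + kR) := fun j => ⟨kL + 1 + j, by have := j.isLt; omega⟩
  let i0 : Fin (kL + 1 + kR) := ⟨kL, by omega⟩
  let v : Fin 5 → ℝ := ![α, β, (-1) ^ kR * γ, (-1) ^ kR * δ, (-1) ^ kR * ε]
  let X : Matrix (Fin kL ⊕ Fin kR) (Fin 5) ℝ :=
    Matrix.of fun t s => M (Sum.elim iA iB t) (![a, b, c, d, nn] s)
  have MA : ∀ i j, j < a → M (iA i) j = A i j := by
    intro i j hj
    have h1 : j ≠ a := by order
    have h2 : j ≠ nn := by order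
    simp [hM, bcfwMatrix, iA, h1, h2]
  have MA0 : ∀ i j, ¬ j < a → j ≠ a → j ≠ b → j ≠ c → j ≠ d → j ≠ nn → M (iA i) j = 0 := by
    intro i j hj h1 h2 h3 h4 h5
    have : A i j = 0 := by
      apply hA.1
      rintro (h | h)
      · simp only [Fin.lt_def, Fin.le_def, ne_eq, Fin.ext_iff] at *
        omega
      · exact h5 h
    simp [hM, bcfwMatrix, iA, h1, h5, this]
  have hiB : ∀ i : Fin kR, ∀ (h : kL + 1 + (i : ℕ) - kL - 1 < kR),
      (⟨kL + 1 + (i : ℕ) - kL - 1, h⟩ : Fin kR) = i := by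
    intro i h
    apply Fin.ext
    simp only
    omega
  have MB : ∀ i j, b < j ∧ j < c → M (iB i) j = B i j := by
    intro i j hj
    have h1 : j ≠ c := by have := hj.2; order
    have h2 : j ≠ d := by have := hj.2; order
    simp only [hM, bcfwMatrix, iB, Matrix.of_apply]
    rw [dif_neg (by omega), dif_neg (by omega), if_neg h1, if_neg h2, hiB]
  have MB0 : ∀ i j, ¬ (b < j ∧ j < c) → j ≠ a → j ≠ b → j ≠ c → j ≠ d → j ≠ nn →
      M (iB i) j = 0 := by
    intro i j hj h1 h2 h3 h4 h5
    have hjn := j.isLt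
    have : B i j = 0 := by
      apply hB.1
      simp only [Fin.lt_def, ne_eq, Fin.ext_iff] at *
      omega
    simp only [hM, bcfwMatrix, iB, Matrix.of_apply]
    rw [dif_neg (by omega), dif_neg (by omega), if_neg h3, if_neg h4, hiB, this]
  have M0 : ∀ s, M i0 (![a, b, c, d, nn] s) = v s := by
    have q1 : b ≠ a := by order
    have q2 : c ≠ a := by order
    have q3 : d ≠ a := by order
    have q4 : nn ≠ a := by order
    have q5 : c ≠ b := by order
    have q6 : d ≠ b := by order
    have q7 : nn ≠ b := by order
    have q8 : d ≠ c := by order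
    have q9 : nn ≠ c := by order
    have q10 : nn ≠ d := by order
    intro s
    fin_cases s <;> simp [hM, bcfwMatrix, i0, v, *]
  have M00 : ∀ j, ¬ False → j ≠ a → j ≠ b → j ≠ c → j ≠ d → j ≠ nn → M i0 j = 0 := by
    intro j _ h1 h2 h3 h4 h5
    simp [hM, bcfwMatrix, i0, h1, h2, h3, h4, h5]
  have nlt : ∀ {x y : Fin n}, x ≤ y → ¬ y < x := fun h => not_lt.mpr h
  have hN : (N5 v w).det = ((Matrix.fromBlocks 1 X 0 (N5 v w)).submatrix
      (eEq kL kR).symm (eEq kL kR).symm).det := by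
    rw [Matrix.det_submatrix_equiv_self, Matrix.det_fromBlocks_zero₂₁, Matrix.det_one, one_mul]
  rw [hN, Phi_apply, ← Matrix.det_mul]
  unfold twistor
  congr 1
  ext p r
  obtain ⟨t, rfl⟩ := (eEq kL kR).surjective p
  have hR : ((Matrix.fromBlocks 1 X 0 (N5 v w)).submatrix
      (eEq kL kR).symm (eEq kL kR).symm * Matrix.of (fun i => W ((eEq kL kR).symm i)))
      (eEq kL kR t) r = ∑ t', Matrix.fromBlocks 1 X 0 (N5 v w) t t' * W t' r := by
    rw [Matrix.mul_apply, ← Equiv.sum_comp (eEq kL kR)]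
    simp
  rw [hR, Matrix.of_apply]
  rcases t with (i | i) | s
  · have e : eEq kL kR (Sum.inl (Sum.inl i)) = Fin.castAdd 4 (iA i) := rfl
    rw [e, Fin.append_left, Matrix.mul_apply, sum_sp a b c d nn hab hbc hcd hdn (M (iA i))
      (fun j => j < a) (by order) (by order) (by order) (by order) (by order) (MA0 i) Z r,
      Fintype.sum_sum_type]
    congr 1
    · simp only [Matrix.fromBlocks_apply₁₁, Matrix.one_apply, ite_mul, one_mul, zero_mul,
        Finset.sum_ite_eq, Finset.mem_univ, if_true]
      simp only [hW, Sum.elim_inl, Finset.sum_apply, Pi.smul_apply, smul_eq_mul]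
      refine Finset.sum_congr rfl fun j _ => ?_
      by_cases hj : j < a
      · simp [hj, MA i j hj]
      · simp [hj]
  · have e : eEq kL kR (Sum.inl (Sum.inr i)) = Fin.castAdd 4 (iB i) := rfl
    rw [e, Fin.append_left, Matrix.mul_apply, sum_sp a b c d nn hab hbc hcd hdn (M (iB i))
      (fun j => b < j ∧ j < c) (fun h => by have := h.1; order) (fun h => by have := h.1; order)
      (fun h => by have := h.2; order) (fun h => by have := h.2; order)
      (fun h => by have := h.2; order) (MB0 i) Z r,
      Fintype.sum_sum_type]
    congr 1
    · simp only [Matrix.fromBlocks_apply₁₁, Matrix.one_apply, ite_mul, one_mul, zero_mul,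
        Finset.sum_ite_eq, Finset.mem_univ, if_true]
      simp only [hW, Sum.elim_inl, Sum.elim_inr, Finset.sum_apply, Pi.smul_apply, smul_eq_mul]
      refine Finset.sum_congr rfl fun j _ => ?_
      by_cases hj : b < j ∧ j < c
      · simp [hj, MB i j hj]
      · simp [hj]
  · rw [Fintype.sum_sum_type]
    simp only [Matrix.fromBlocks_apply₂₁, Matrix.fromBlocks_apply₂₂, Matrix.zero_apply, zero_mul,
      Finset.sum_const_zero, zero_add]
    refine Fin.cases ?_ (fun s => ?_) s
    · have e : eEq kL kR (Sum.inr 0) = Fin.castAdd 4 i0 := rfl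
      rw [e, Fin.append_left, Matrix.mul_apply, sum_sp a b c d nn hab hbc hcd hdn (M i0)
        (fun _ => False) id id id id id M00 Z r]
      simp only [if_false, zero_mul, Finset.sum_const_zero, zero_add, M0]
      rfl
    · have e : eEq kL kR (Sum.inr s.succ) = Fin.natAdd (kL + 1 + kR) s := rfl
      rw [e, Fin.append_right]
      have h1 : ![Z w₁, Z w₂, Z w₃, Z w₄] s = Z (![w₁, w₂, w₃, w₄] s) := by
        fin_cases s <;> rfl
      rw [h1, hw]
      have h2 : ∀ x, N5 v w s.succ x = if w s = x then 1 else 0 := fun x => rfl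
      simp only [h2, ite_mul, one_mul, zero_mul, Finset.sum_ite_eq, Finset.mem_univ, if_true]
      rfl

theorem det_a (v : Fin 5 → ℝ) : (N5 v ![1, 2, 3, 4]).det = v 0 := by
  have h : N5 v ![1, 2, 3, 4] = !![v 0, v 1, v 2, v 3, v 4; 0, 1, 0, 0, 0; 0, 0, 1, 0, 0; 0, 0, 0, 1, 0; 0, 0, 0, 0, 1] := by
    ext i j
    fin_cases i <;> fin_cases j <;> first | rfl | exact if_neg (by decide) | exact if_pos rfl
  rw [h]
  simp [Matrix.det_succ_row_zero, Fin.sum_univ_succ, Fin.succAbove, Fin.ext_iff]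
  try ring

theorem det_b (v : Fin 5 → ℝ) : (N5 v ![0, 2, 3, 4]).det = -v 1 := by
  have h : N5 v ![0, 2, 3, 4] = !![v 0, v 1, v 2, v 3, v 4; 1, 0, 0, 0, 0; 0, 0, 1, 0, 0; 0, 0, 0, 1, 0; 0, 0, 0, 0, 1] := by
    ext i j
    fin_cases i <;> fin_cases j <;> first | rfl | exact if_neg (by decide) | exact if_pos rfl
  rw [h]
  simp [Matrix.det_succ_row_zero, Fin.sum_univ_succ, Fin.succAbove, Fin.ext_iff]
  try ring

theorem det_c (v : Fin 5 → ℝ) : (N5 v ![0, 1, 3, 4]).det = v 2 := by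
  have h : N5 v ![0, 1, 3, 4] = !![v 0, v 1, v 2, v 3, v 4; 1, 0, 0, 0, 0; 0, 1, 0, 0, 0; 0, 0, 0, 1, 0; 0, 0, 0, 0, 1] := by
    ext i j
    fin_cases i <;> fin_cases j <;> first | rfl | exact if_neg (by decide) | exact if_pos rfl
  rw [h]
  simp [Matrix.det_succ_row_zero, Fin.sum_univ_succ, Fin.succAbove, Fin.ext_iff]
  try ring

theorem det_d (v : Fin 5 → ℝ) : (N5 v ![0, 1, 2, 4]).det = -v 3 := by
  have h : N5 v ![0, 1, 2, 4] = !![v 0, v 1, v 2, v 3, v 4; 1, 0, 0, 0, 0; 0, 1, 0, 0, 0; 0, 0, 1, 0, 0; 0, 0, 0, 0, 1] := by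
    ext i j
    fin_cases i <;> fin_cases j <;> first | rfl | exact if_neg (by decide) | exact if_pos rfl
  rw [h]
  simp [Matrix.det_succ_row_zero, Fin.sum_univ_succ, Fin.succAbove, Fin.ext_iff]
  try ring

theorem det_n (v : Fin 5 → ℝ) : (N5 v ![0, 1, 2, 3]).det = v 4 := by
  have h : N5 v ![0, 1, 2, 3] = !![v 0, v 1, v 2, v 3, v 4; 1, 0, 0, 0, 0; 0, 1, 0, 0, 0; 0, 0, 1, 0, 0; 0, 0, 0, 1, 0] := by
    ext i j
    fin_cases i <;> fin_cases j <;> first | rfl | exact if_neg (by decide) | exact if_pos rfl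
  rw [h]
  simp [Matrix.det_succ_row_zero, Fin.sum_univ_succ, Fin.succAbove, Fin.ext_iff]
  try ring

end BCFW

/-- **Signs of the five special twistor coordinates on a BCFW product** (Lemma 8.5). -/
theorem bcfw_special_twistor_signs (kL kR n : ℕ) (a b c d nn : Fin n)
    (hab : (b : ℕ) = (a : ℕ) + 1) (hbc : b < c) (hcd : (d : ℕ) = (c : ℕ) + 1)
    (hdn : (nn : ℕ) = (d : ℕ) + 1) (hlast : (nn : ℕ) + 1 = n)
    (A : Matrix (Fin kL) (Fin n) ℝ) (B : Matrix (Fin kR) (Fin n) ℝ)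
    (α β γ δ ε : ℝ)
    (hα : 0 < α) (hβ : 0 < β) (hγ : 0 < γ) (hδ : 0 < δ) (hε : 0 < ε)
    (hA : LeftInput kL n a b nn A) (hB : RightInput kR n b c B)
    (Z : Matrix (Fin n) (Fin (kL + 1 + kR + 4)) ℝ) (hZ : PosMat Z) :
    0 < (-1 : ℝ) ^ kR *
        twistor (bcfwMatrix kL kR n A B α β γ δ ε a b c d nn * Z) (Z b) (Z c) (Z d) (Z nn) ∧
      0 < (-1 : ℝ) ^ (kR + 1) *
        twistor (bcfwMatrix kL kR n A B α β γ δ ε a b c d nn * Z) (Z a) (Z c) (Z d) (Z nn) ∧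
      0 < twistor (bcfwMatrix kL kR n A B α β γ δ ε a b c d nn * Z) (Z a) (Z b) (Z d) (Z nn) ∧
      0 < -twistor (bcfwMatrix kL kR n A B α β γ δ ε a b c d nn * Z) (Z a) (Z b) (Z c) (Z nn) ∧
      0 < twistor (bcfwMatrix kL kR n A B α β γ δ ε a b c d nn * Z) (Z a) (Z b) (Z c) (Z d) := by
  have hab' : a < b := by rw [Fin.lt_def]; omega
  have hcd' : c < d := by rw [Fin.lt_def]; omega
  have hdn' : d < nn := by rw [Fin.lt_def]; omega
  have hW := BCFW.W_pos kL kR n a b c d nn hab' hbc hcd' hdn' A B hA hB Z hZ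
  have key := BCFW.twistor_eq kL kR n a b c d nn hab' hbc hcd' hdn' hab hcd hdn hlast A B
    α β γ δ ε hA hB Z
  rw [key ![1, 2, 3, 4] b c d nn (fun r => by fin_cases r <;> rfl),
    key ![0, 2, 3, 4] a c d nn (fun r => by fin_cases r <;> rfl),
    key ![0, 1, 3, 4] a b d nn (fun r => by fin_cases r <;> rfl),
    key ![0, 1, 2, 4] a b c nn (fun r => by fin_cases r <;> rfl),
    key ![0, 1, 2, 3] a b c d (fun r => by fin_cases r <;> rfl),
    BCFW.det_a, BCFW.det_b, BCFW.det_c, BCFW.det_d, BCFW.det_n]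
  generalize BCFW.Phi kL kR _ = D at hW ⊢
  change 0 < (-1 : ℝ) ^ kR * (α * D) ∧ 0 < (-1 : ℝ) ^ (kR + 1) * (-β * D) ∧
    0 < (-1 : ℝ) ^ kR * γ * D ∧ 0 < -(-((-1 : ℝ) ^ kR * δ) * D) ∧ 0 < (-1 : ℝ) ^ kR * ε * D
  rw [pow_succ]
  refine ⟨?_, ?_, ?_, ?_, ?_⟩
  · linarith [mul_pos hα hW]
  · linarith [mul_pos hβ hW]
  · linarith [mul_pos hγ hW]
  · linarith [mul_pos hδ hW]
  · linarith [mul_pos hε hW]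
end

section
/- Positivity of the quadratic cluster variable ⟨i j n | a b | c d n⟩ (Corollary 4.8, first part): Let M be a real 4 × n matrix all of whose 4 × 4 minors (on increasing column sets) are positive, and let 1 ≤ i < j < a < b < c < d < n be indices (the largest index being the last column n of M). Then ⟨i j n a⟩·⟨b c d n⟩ − ⟨i j n b⟩·⟨a c d n⟩ > 0, where ⟨p q r s⟩ denotes the determinant of the 4 × 4 matrix whose columns are columns p, q, r, s of M, in that listed order. -/
open Matrix

/-- A real `4 × n` matrix is totally positive if all of its `4 × 4` minors,
taken with columns in increasing order, are positive. -/
def TotPos {n : ℕ} (M : Matrix (Fin 4) (Fin n) ℝ) : Prop :=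
  ∀ f : Fin 4 → Fin n, StrictMono f → 0 < (M.submatrix id f).det

/-- `⟨p q r s⟩`: the determinant of the `4 × 4` matrix whose columns are the
columns `p, q, r, s` of `M`, in that listed order. -/
noncomputable def br {n : ℕ} (M : Matrix (Fin 4) (Fin n) ℝ) (p q r s : Fin n) : ℝ :=
  (M.submatrix id ![p, q, r, s]).det

theorem br_expand {n : ℕ} (M : Matrix (Fin 4) (Fin n) ℝ) (p q r s : Fin n) :
    br M p q r s =
      (M 0 p * M 1 q - M 0 q * M 1 p) * (M 2 r * M 3 s - M 2 s * M 3 r)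
      - (M 0 p * M 1 r - M 0 r * M 1 p) * (M 2 q * M 3 s - M 2 s * M 3 q)
      + (M 0 p * M 1 s - M 0 s * M 1 p) * (M 2 q * M 3 r - M 2 r * M 3 q)
      + (M 0 q * M 1 r - M 0 r * M 1 q) * (M 2 p * M 3 s - M 2 s * M 3 p)
      - (M 0 q * M 1 s - M 0 s * M 1 q) * (M 2 p * M 3 r - M 2 r * M 3 p)
      + (M 0 r * M 1 s - M 0 s * M 1 r) * (M 2 p * M 3 q - M 2 q * M 3 p) := by
  simp [br, Matrix.det_succ_row_zero, Fin.sum_univ_succ, Fin.succAbove]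
  ring

theorem br_swap34 {n : ℕ} (M : Matrix (Fin 4) (Fin n) ℝ) (p q r s : Fin n) :
    br M p q s r = - br M p q r s := by
  simp only [br_expand]; ring

theorem br_swap23 {n : ℕ} (M : Matrix (Fin 4) (Fin n) ℝ) (p q r s : Fin n) :
    br M p r q s = - br M p q r s := by
  simp only [br_expand]; ring

theorem br_swap12 {n : ℕ} (M : Matrix (Fin 4) (Fin n) ℝ) (p q r s : Fin n) :
    br M q p r s = - br M p q r s := by
  simp only [br_expand]; ring

set_option maxHeartbeats 4000000 in
theorem br_plucker {n : ℕ} (M : Matrix (Fin 4) (Fin n) ℝ) (x y z w p q : Fin n) :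
    br M x z p q * br M y w p q = br M x y p q * br M z w p q + br M x w p q * br M y z p q := by
  simp only [br_expand]; ring

theorem br_pos {n : ℕ} (M : Matrix (Fin 4) (Fin n) ℝ) (hM : TotPos M) {p q r s : Fin n}
    (h1 : p < q) (h2 : q < r) (h3 : r < s) : 0 < br M p q r s := by
  apply hM
  rw [Fin.strictMono_iff_lt_succ]
  intro k
  fin_cases k
  · exact h1
  · exact h2
  · exact h3

/-- **Positivity of the quadratic cluster variable `⟨i j n | a b | c d n⟩`**
(Corollary 4.8, first part).  Here `nn` is the last column of `M` (the paper's index `n`). -/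
theorem quadratic_chain_positive (n : ℕ) (M : Matrix (Fin 4) (Fin n) ℝ) (hM : TotPos M)
    (i j a b c d nn : Fin n) (hnn : (nn : ℕ) + 1 = n)
    (h1 : i < j) (h2 : j < a) (h3 : a < b) (h4 : b < c) (h5 : c < d) (h6 : d < nn) :
    0 < br M i j nn a * br M b c d nn - br M i j nn b * br M a c d nn := by
  have P1 := br_plucker M i a b d c nn
  rw [br_swap23 M b c d nn, br_swap23 M a c d nn, br_swap23 M i c d nn] at P1
  have P2 := br_plucker M j a b c i nn
  rw [br_swap23 M j i b nn, br_swap12 M i j b nn, br_swap23 M a i c nn, br_swap12 M i a c nn,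
    br_swap23 M j i a nn, br_swap12 M i j a nn, br_swap23 M b i c nn, br_swap12 M i b c nn,
    br_swap23 M j i c nn, br_swap12 M i j c nn, br_swap23 M a i b nn, br_swap12 M i a b nn] at P2
  rw [br_swap34 M i j a nn, br_swap34 M i j b nn]
  have p1 := br_pos M hM (h1.trans (h2.trans (h3.trans h4)) : i < c) h5 h6
  have q1 := br_pos M hM (h1.trans (h2.trans h3) : i < b) h4 (h5.trans h6)
  have q2 := br_pos M hM h1 (h2.trans (h3.trans h4)) (h5.trans h6)
  have q3 := br_pos M hM (h1.trans h2) h3 (h4.trans (h5.trans h6))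
  have q4 := br_pos M hM h4 h5 h6
  have q5 := br_pos M hM h1 (h2.trans h3) (h4.trans (h5.trans h6))
  have q6 := br_pos M hM h3 h4 (h5.trans h6)
  have key : br M i b c nn * (-br M i j a nn * br M b c d nn - -br M i j b nn * br M a c d nn)
      = br M i j c nn * br M i a b nn * br M b c d nn
        + br M i j b nn * br M i c d nn * br M a b c nn := by
    linear_combination (-br M i j b nn) * P1 + br M b c d nn * P2
  exact pos_of_mul_pos_right (by rw [key]; positivity) q1.le
end

section
/- Positivity of the quadratic cluster variable ⟨i j ℓ | b a | c d n⟩ (Corollary 4.8, second part): Let M be a real 4 × n matrix all of whose 4 × 4 minors (on increasing column sets) are positive. Then ⟨i j ℓ b⟩·⟨a c d n⟩ − ⟨i j ℓ a⟩·⟨b c d n⟩ > 0 whenever the seven indices satisfy one of the following orderings, with n the last column of M: (i) i < j < ℓ < a < b < c < d < n; (ii) c < d < i < j < ℓ < a < b < n; (iii) a < b < i < j < ℓ < c < d < n. Here ⟨p q r s⟩ denotes the determinant of the 4 × 4 matrix whose columns are columns p, q, r, s of M, in that listed order. -/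
open Matrix

/-- Explicit 4 × 4 determinant of four vectors. -/
def D4 (p q r s : Fin 4 → ℝ) : ℝ :=
  (p 0 * q 1 - p 1 * q 0) * (r 2 * s 3 - r 3 * s 2)
  - (p 0 * q 2 - p 2 * q 0) * (r 1 * s 3 - r 3 * s 1)
  + (p 0 * q 3 - p 3 * q 0) * (r 1 * s 2 - r 2 * s 1)
  + (p 1 * q 2 - p 2 * q 1) * (r 0 * s 3 - r 3 * s 0)
  - (p 1 * q 3 - p 3 * q 1) * (r 0 * s 2 - r 2 * s 0)
  + (p 2 * q 3 - p 3 * q 2) * (r 0 * s 1 - r 1 * s 0)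

theorem br_eq_D4 {n : ℕ} (M : Matrix (Fin 4) (Fin n) ℝ) (p q r s : Fin n) :
    br M p q r s = D4 (fun k => M k p) (fun k => M k q) (fun k => M k r) (fun k => M k s) := by
  unfold br D4
  simp [Matrix.det_succ_row_zero, Fin.sum_univ_succ, Fin.succAbove]
  ring

theorem D4_rot (p q r s : Fin 4 → ℝ) : D4 q r s (-p) = D4 p q r s := by
  simp only [D4, Pi.neg_apply]; ring

theorem D4_neg (p q r s : Fin 4 → ℝ) : D4 q r s p = - D4 p q r s := by
  simp only [D4]; ring

theorem D4_swap1 (p q r s : Fin 4 → ℝ) : D4 q p r s = - D4 p q r s := by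
  simp only [D4]; ring

theorem D4_neg1 (p q r s : Fin 4 → ℝ) : D4 (-p) q r s = - D4 p q r s := by
  simp only [D4, Pi.neg_apply]; ring

/-- three-term Plücker relation -/
theorem D4_plucker (a b c d x y : Fin 4 → ℝ) :
    D4 a b x y * D4 c d x y - D4 a c x y * D4 b d x y + D4 a d x y * D4 b c x y = 0 := by
  simp only [D4]; ring

theorem D4_cramer (a b c d e : Fin 4 → ℝ) (k : Fin 4) :
    a k * D4 b c d e - b k * D4 a c d e + c k * D4 a b d e - d k * D4 a b c e
      + e k * D4 a b c d = 0 := by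
  fin_cases k <;> simp only [D4] <;> simp <;> ring

theorem D4_lin (x y z : Fin 4 → ℝ) : ∃ w : Fin 4 → ℝ, ∀ p, D4 p x y z = ∑ k, p k * w k := by
  refine ⟨![D4 ![1,0,0,0] x y z, D4 ![0,1,0,0] x y z, D4 ![0,0,1,0] x y z, D4 ![0,0,0,1] x y z], ?_⟩
  intro p
  simp [D4, Fin.sum_univ_succ]
  ring

theorem D4_five (a b c d e x y z : Fin 4 → ℝ) :
    D4 a x y z * D4 b c d e - D4 b x y z * D4 a c d e + D4 c x y z * D4 a b d e
      - D4 d x y z * D4 a b c e + D4 e x y z * D4 a b c d = 0 := by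
  obtain ⟨w, hw⟩ := D4_lin x y z
  simp only [hw, Fin.sum_univ_four]
  linear_combination w 0 * D4_cramer a b c d e 0 + w 1 * D4_cramer a b c d e 1
    + w 2 * D4_cramer a b c d e 2 + w 3 * D4_cramer a b c d e 3

theorem D4_core (a b c d e f g h : Fin 4 → ℝ)
    (h1 : 0 < D4 b c d h) (h2 : 0 < D4 b c d e) (h3 : 0 < D4 a b c h) (h4 : 0 < D4 c d g h)
    (h5 : 0 < D4 a b c d) (h6 : 0 < D4 c d e h) (h7 : 0 < D4 b c g h) (h8 : 0 < D4 d e g h)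
    (h9 : 0 < D4 c f g h) (h10 : 0 < D4 d f g h) :
    0 < D4 a b c e * D4 d f g h - D4 a b c d * D4 e f g h := by
  have z : ∀ x y w : Fin 4 → ℝ, D4 x x y w = 0 := fun x y w => by simp only [D4]; ring
  have X : (D4 a c d e * D4 b c g h - D4 b c d e * D4 a c g h) * D4 b c d h
      = D4 b c d e * D4 a b c h * D4 c d g h + D4 a b c d * D4 c d e h * D4 b c g h := by
    have p1 : D4 a c d e * D4 b c d h - D4 b c d e * D4 a c d h = D4 a b c d * D4 c d e h := by
      have := D4_plucker a b e h c d
      simp only [D4] at this ⊢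
      linear_combination this
    have p2 : D4 a c d h * D4 b c g h - D4 a c g h * D4 b c d h = D4 a b c h * D4 c d g h := by
      have := D4_plucker a b d g c h
      simp only [D4] at this ⊢
      linear_combination this
    linear_combination D4 b c g h * p1 + D4 b c d e * p2
  have Xp : 0 < D4 a c d e * D4 b c g h - D4 b c d e * D4 a c g h := by
    refine pos_of_mul_pos_left (b := D4 b c d h) ?_ h1.le
    rw [X]; positivity
  have Q : (D4 a b c e * D4 d f g h - D4 a b c d * D4 e f g h) * D4 c d g h
      = D4 a b c d * D4 d e g h * D4 c f g h
        + (D4 a c d e * D4 b c g h - D4 b c d e * D4 a c g h) * D4 d f g h := by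
    have q1 := D4_five a b c d e c g h
    rw [z] at q1
    rw [D4_swap1 c d, D4_swap1 c e] at q1
    have q2 := D4_plucker c d e f g h
    linear_combination D4 d f g h * q1 - D4 a b c d * q2
  refine pos_of_mul_pos_left (b := D4 c d g h) ?_ h4.le
  rw [Q]; positivity

/-- **Positivity of the quadratic cluster variable `⟨i j ℓ | b a | c d n⟩`**
(Corollary 4.8, second part).  Here `nn` is the last column of `M` (the paper's index `n`). -/
theorem quadratic_chain_positive' (n : ℕ) (M : Matrix (Fin 4) (Fin n) ℝ) (hM : TotPos M)
    (i j l a b c d nn : Fin n) (hnn : (nn : ℕ) + 1 = n)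
    (hord :
      (i < j ∧ j < l ∧ l < a ∧ a < b ∧ b < c ∧ c < d ∧ d < nn) ∨
      (c < d ∧ d < i ∧ i < j ∧ j < l ∧ l < a ∧ a < b ∧ b < nn) ∨
      (a < b ∧ b < i ∧ i < j ∧ j < l ∧ l < c ∧ c < d ∧ d < nn)) :
    0 < br M i j l b * br M a c d nn - br M i j l a * br M b c d nn := by
  have key : ∀ p q r s : Fin n, p < q → q < r → r < s →
      0 < D4 (fun k => M k p) (fun k => M k q) (fun k => M k r) (fun k => M k s) := by
    intro p q r s h1 h2 h3
    rw [← br_eq_D4]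
    apply hM
    rw [Fin.strictMono_iff_lt_succ]
    intro k
    fin_cases k <;> simpa
  simp only [br_eq_D4]
  rcases hord with ⟨h1, h2, h3, h4, h5, h6, h7⟩ | ⟨h1, h2, h3, h4, h5, h6, h7⟩ |
    ⟨h1, h2, h3, h4, h5, h6, h7⟩
  · apply D4_core <;> apply key <;> order
  · have := D4_core (fun k => M k i) (fun k => M k j) (fun k => M k l) (fun k => M k a)
      (fun k => M k b) (fun k => M k nn) (-(fun k => M k c)) (-(fun k => M k d))
    simp only [D4_rot] at this
    have t := this (by apply key <;> order) (by apply key <;> order) (by apply key <;> order)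
      (by apply key <;> order) (by apply key <;> order) (by apply key <;> order)
      (by apply key <;> order) (by apply key <;> order) (by apply key <;> order)
      (by apply key <;> order)
    have e : ∀ x y z w : Fin 4 → ℝ, D4 x y z w = D4 y z x w := by
      intro x y z w; simp only [D4]; ring
    rw [e (fun k => M k c) (fun k => M k d) (fun k => M k a),
      e (fun k => M k c) (fun k => M k d) (fun k => M k b),
      e (fun k => M k d), e (fun k => M k d)] at t
    exact t
  · have := D4_core (fun k => M k c) (fun k => M k d) (fun k => M k nn) (-(fun k => M k a))
      (-(fun k => M k b)) (-(fun k => M k i)) (-(fun k => M k j)) (-(fun k => M k l))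
    simp only [D4_rot] at this
    have t := this (by apply key <;> order) (by apply key <;> order) (by apply key <;> order)
      (by apply key <;> order) (by apply key <;> order) (by apply key <;> order)
      (by apply key <;> order) (by apply key <;> order) (by apply key <;> order)
      (by apply key <;> order)
    rw [D4_neg (fun k => M k b), D4_neg (fun k => M k a)]
    linarith
end

section
/- Enumeration of chord diagrams by Narayana numbers (claim following Definition 5.4): For all integers n ≥ 4 and k ≥ 0, the number of chord diagrams with n markers and k chords equals the Narayana number N(n−3, k+1); equivalently, (k+1) · |CD_{n,k}| = C(n−4, k) · C(n−3, k), where C(·,·) denotes the binomial coefficient. -/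
/-- A chord diagram on `n` markers: a finite set of quadruples `(a, b, c, d)` of integers
(chords) with `b = a + 1`, `d = c + 1`, `1 ≤ a < b < c < d ≤ n − 1`, such that no two
distinct chords have the same first entry, and no two chords `(a,b,c,d)`, `(a',b',c',d')`
satisfy `a < a' < c < c'`. -/
def IsChordDiagram (n : ℕ) (D : Finset (ℕ × ℕ × ℕ × ℕ)) : Prop :=
  (∀ a b c d : ℕ, (a, b, c, d) ∈ D →
      b = a + 1 ∧ d = c + 1 ∧ 1 ≤ a ∧ a < b ∧ b < c ∧ c < d ∧ d ≤ n - 1) ∧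
  (∀ a b c d a' b' c' d' : ℕ, (a, b, c, d) ∈ D → (a', b', c', d') ∈ D →
      (a, b, c, d) ≠ (a', b', c', d') → a ≠ a') ∧
  (∀ a b c d a' b' c' d' : ℕ, (a, b, c, d) ∈ D → (a', b', c', d') ∈ D →
      ¬(a < a' ∧ a' < c ∧ c < c'))

/-- Recursive enumeration of diagrams (as sets of pairs) with left endpoints in `1..j`. -/
def chordEnum : ℕ → ℕ → Finset ℕ → Finset (Finset (ℕ × ℕ))
  | 0, 0, _ => {∅}
  | 0, _ + 1, _ => ∅
  | j + 1, 0, V => chordEnum j 0 (insert (j + 1) V)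
  | j + 1, k + 1, V => chordEnum j (k + 1) (insert (j + 1) V) ∪
      (V.erase (j + 2)).biUnion fun c =>
        (chordEnum j k (insert (j + 1) (V.filter (c ≤ ·)))).image (insert (j + 1, c))

def chordCnt : ℕ → ℕ → ℕ → ℕ
  | 0, 0, _ => 1
  | 0, _ + 1, _ => 0
  | j + 1, 0, s => chordCnt j 0 (s + 1)
  | j + 1, k + 1, s => chordCnt j (k + 1) (s + 1) + ∑ i ∈ Finset.range s, chordCnt j k (i + 1)

def ChordP (j : ℕ) (V : Finset ℕ) (S : Finset (ℕ × ℕ)) : Prop :=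
  (∀ a c, (a, c) ∈ S → 1 ≤ a ∧ a ≤ j ∧ a + 2 ≤ c ∧ (c ∈ V ∨ c ≤ j)) ∧
  (∀ a c c', (a, c) ∈ S → (a, c') ∈ S → c = c') ∧
  (∀ a c a' c', (a, c) ∈ S → (a', c') ∈ S → ¬(a < a' ∧ a' < c ∧ c < c'))

lemma chordP_zero (V : Finset ℕ) (S : Finset (ℕ × ℕ)) : ChordP 0 V S ↔ S = ∅ := by
  constructor
  · intro h
    apply Finset.eq_empty_of_forall_notMem
    rintro ⟨a, c⟩ hx
    have := h.1 a c hx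
    omega
  · rintro rfl
    simp [ChordP]

lemma chordP_none (j : ℕ) (V : Finset ℕ) (S : Finset (ℕ × ℕ)) :
    ChordP j (insert (j + 1) V) S ↔ (ChordP (j + 1) V S ∧ ∀ c, (j + 1, c) ∉ S) := by
  constructor
  · rintro ⟨h1, h2, h3⟩
    refine ⟨⟨?_, h2, h3⟩, ?_⟩
    · intro a c h
      have := h1 a c h
      simp only [Finset.mem_insert] at this
      refine ⟨this.1, by omega, this.2.2.1, ?_⟩
      rcases this.2.2.2 with (h | h) | h
      · right; omega
      · left; exact h
      · right; omega
    · intro c h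
      have := h1 _ c h
      omega
  · rintro ⟨⟨h1, h2, h3⟩, h4⟩
    refine ⟨?_, h2, h3⟩
    intro a c h
    have := h1 a c h
    have hne : a ≠ j + 1 := by
      rintro rfl
      exact h4 c h
    simp only [Finset.mem_insert]
    refine ⟨this.1, by omega, this.2.2.1, ?_⟩
    rcases this.2.2.2 with h | h
    · left; right; exact h
    · rcases Nat.lt_or_ge c (j + 1) with h' | h'
      · right; omega
      · left; left; omega

lemma chordP_some (j c : ℕ) (V : Finset ℕ) (hV : ∀ v ∈ V, j + 1 < v) (hc : c ∈ V)
    (hc2 : c ≠ j + 2) (T : Finset (ℕ × ℕ)) (hT : ∀ x, (j + 1, x) ∉ T) :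
    ChordP j (insert (j + 1) (V.filter (c ≤ ·))) T ↔ ChordP (j + 1) V (insert (j + 1, c) T) := by
  have hcj := hV c hc
  constructor
  · rintro ⟨h1, h2, h3⟩
    refine ⟨?_, ?_, ?_⟩
    · intro a x h
      simp only [Finset.mem_insert, Prod.mk.injEq] at h
      rcases h with ⟨rfl, rfl⟩ | h
      · exact ⟨by omega, le_rfl, by omega, Or.inl hc⟩
      · have := h1 a x h
        simp only [Finset.mem_insert, Finset.mem_filter] at this
        refine ⟨this.1, by omega, this.2.2.1, ?_⟩
        rcases this.2.2.2 with (h | h) | h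
        · right; omega
        · left; exact h.1
        · right; omega
    · intro a x x' h h'
      simp only [Finset.mem_insert, Prod.mk.injEq] at h h'
      rcases h with ⟨rfl, rfl⟩ | h <;> rcases h' with ⟨h', rfl⟩ | h'
      · rfl
      · exact absurd h' (hT _)
      · subst h'; exact absurd h (hT _)
      · exact h2 a x x' h h'
    · intro a x a' x' h h'
      simp only [Finset.mem_insert, Prod.mk.injEq] at h h'
      rcases h with ⟨rfl, rfl⟩ | h <;> rcases h' with ⟨rfl, rfl⟩ | h'
      · omega
      · have := h1 a' x' h'
        omega
      · have := h1 a x h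
        simp only [Finset.mem_insert, Finset.mem_filter] at this
        omega
      · exact h3 a x a' x' h h'
  · rintro ⟨h1, h2, h3⟩
    refine ⟨?_, ?_, ?_⟩
    · intro a x h
      have := h1 a x (Finset.mem_insert_of_mem h)
      have hne : a ≠ j + 1 := by
        rintro rfl
        exact hT x h
      have hx := h3 a x (j + 1) c (Finset.mem_insert_of_mem h) (Finset.mem_insert_self _ _)
      simp only [Finset.mem_insert, Finset.mem_filter]
      refine ⟨this.1, by omega, this.2.2.1, ?_⟩
      rcases this.2.2.2 with h | h
      · have := hV x h
        left; right; exact ⟨h, by omega⟩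
      · rcases Nat.lt_or_ge x (j + 1) with h' | h'
        · right; omega
        · left; left; omega
    · intro a x x' h h'
      exact h2 a x x' (Finset.mem_insert_of_mem h) (Finset.mem_insert_of_mem h')
    · intro a x a' x' h h'
      exact h3 a x a' x' (Finset.mem_insert_of_mem h) (Finset.mem_insert_of_mem h')

lemma chordV_insert (j : ℕ) (V W : Finset ℕ) (hV : ∀ v ∈ V, j + 1 < v) (hW : W ⊆ V) :
    ∀ v ∈ insert (j + 1) W, j < v := by
  intro v hv
  rcases Finset.mem_insert.1 hv with rfl | hv
  · omega
  · have := hV v (hW hv); omega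

lemma mem_chordEnum (j k : ℕ) (V : Finset ℕ) (hV : ∀ v ∈ V, j < v) (S : Finset (ℕ × ℕ)) :
    S ∈ chordEnum j k V ↔ ChordP j V S ∧ S.card = k := by
  induction j generalizing k V S with
  | zero =>
    rw [chordP_zero]
    cases k with
    | zero =>
      simp only [chordEnum, Finset.mem_singleton]
      constructor
      · rintro rfl; simp
      · exact fun h => h.1
    | succ k =>
      simp only [chordEnum, Finset.notMem_empty, false_iff]
      rintro ⟨rfl, h⟩
      simp at h
  | succ j ih =>
    have hV1 := chordV_insert j V V hV (Finset.Subset.refl _)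
    cases k with
    | zero =>
      rw [chordEnum, ih _ _ hV1, chordP_none]
      constructor
      · rintro ⟨⟨h, -⟩, h'⟩; exact ⟨h, h'⟩
      · rintro ⟨h, h'⟩
        refine ⟨⟨h, ?_⟩, h'⟩
        rw [Finset.card_eq_zero] at h'
        subst h'; simp
    | succ k =>
      rw [chordEnum, Finset.mem_union, ih _ _ hV1, chordP_none, Finset.mem_biUnion]
      constructor
      · rintro (⟨⟨h, -⟩, h'⟩ | ⟨c, hc, h⟩)
        · exact ⟨h, h'⟩
        · rw [Finset.mem_image] at h
          obtain ⟨T, hT, rfl⟩ := h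
          rw [ih _ _ (chordV_insert j V _ hV (Finset.filter_subset _ _))] at hT
          rw [Finset.mem_erase] at hc
          have hn : ∀ x, (j + 1, x) ∉ T := by
            intro x hx
            have := hT.1.1 _ _ hx
            omega
          refine ⟨(chordP_some j c V hV hc.2 hc.1 T hn).1 hT.1, ?_⟩
          rw [Finset.card_insert_of_notMem (hn c), hT.2]
      · rintro ⟨h, hk⟩
        by_cases hex : ∃ c, (j + 1, c) ∈ S
        · right
          obtain ⟨c, hc⟩ := hex
          have h1 := h.1 _ _ hc
          have hcV : c ∈ V := by
            rcases h1.2.2.2 with h | h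
            · exact h
            · omega
          have hn : ∀ x, (j + 1, x) ∉ S.erase (j + 1, c) := by
            intro x hx
            rw [Finset.mem_erase] at hx
            exact hx.1 (by rw [h.2.1 _ _ _ hc hx.2])
          refine ⟨c, Finset.mem_erase.2 ⟨by omega, hcV⟩, ?_⟩
          rw [Finset.mem_image]
          refine ⟨S.erase (j + 1, c), ?_, Finset.insert_erase hc⟩
          rw [ih _ _ (chordV_insert j V _ hV (Finset.filter_subset _ _)),
            chordP_some j c V hV hcV (by omega) _ hn, Finset.insert_erase hc]
          refine ⟨h, ?_⟩
          rw [Finset.card_erase_of_mem hc, hk]; rfl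
        · left
          push Not at hex
          exact ⟨⟨h, hex⟩, hk⟩

lemma sum_rank (f : ℕ → ℕ) (W : Finset ℕ) :
    ∑ c ∈ W, f (W.filter (c ≤ ·)).card = ∑ i ∈ Finset.range W.card, f (i + 1) := by
  induction W using Finset.induction_on_min with
  | empty => simp
  | insert a s ha ih =>
    have hna : a ∉ s := fun h => lt_irrefl _ (ha a h)
    rw [Finset.sum_insert hna, Finset.card_insert_of_notMem hna, Finset.sum_range_succ, ← ih,
      add_comm]
    congr 1
    · apply Finset.sum_congr rfl
      intro c hc
      have := ha c hc
      rw [Finset.filter_insert, if_neg (by omega)]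
    · rw [Finset.filter_true_of_mem, Finset.card_insert_of_notMem hna]
      intro x hx
      rcases Finset.mem_insert.1 hx with rfl | hx
      · exact le_rfl
      · exact (ha x hx).le

lemma card_chordEnum (j k s : ℕ) (V : Finset ℕ) (hV : ∀ v ∈ V, j < v) (hj : j + 1 ∈ V)
    (hs : V.card = s + 1) : (chordEnum j k V).card = chordCnt j k s := by
  induction j generalizing k V s with
  | zero => cases k <;> simp [chordEnum, chordCnt]
  | succ j ih =>
    have hV1 := chordV_insert j V V hV (Finset.Subset.refl _)
    have hnj : j + 1 ∉ V := fun h => lt_irrefl _ (hV _ h)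
    have hc1 : (insert (j + 1) V).card = (s + 1) + 1 := by
      rw [Finset.card_insert_of_notMem hnj, hs]
    cases k with
    | zero => 
      rw [chordEnum, chordCnt]
      exact ih _ _ _ hV1 (Finset.mem_insert_self _ _) hc1
    | succ k =>
      have hnT : ∀ c, ∀ T ∈ chordEnum j k (insert (j + 1) (V.filter (c ≤ ·))),
          ∀ x, (j + 1, x) ∉ T := by
        intro c T hT x hx
        rw [mem_chordEnum _ _ _ (chordV_insert j V _ hV (Finset.filter_subset _ _))] at hT
        have := hT.1.1 _ _ hx
        omega
      rw [chordEnum, chordCnt, Finset.card_union_of_disjoint, Finset.card_biUnion]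
      · congr 1
        · exact ih _ _ _ hV1 (Finset.mem_insert_self _ _) hc1
        · have hW : (V.erase (j + 2)).card = s := by
            rw [Finset.card_erase_of_mem hj, hs]; rfl
          rw [← hW, ← sum_rank]
          apply Finset.sum_congr rfl
          intro c hc
          rw [Finset.mem_erase] at hc
          have hcj := hV c hc.2
          rw [Finset.card_image_of_injOn]
          · apply ih _ _ _ (chordV_insert j V _ hV (Finset.filter_subset _ _))
              (Finset.mem_insert_self _ _)
            rw [Finset.card_insert_of_notMem (fun h => hnj (Finset.mem_filter.1 h).1)]
            congr 2
            ext x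
            simp only [Finset.mem_filter, Finset.mem_erase]
            constructor
            · rintro ⟨h1, h2⟩
              exact ⟨⟨by omega, h1⟩, h2⟩
            · rintro ⟨⟨-, h1⟩, h2⟩
              exact ⟨h1, h2⟩
          · intro T hT T' hT' h
            have h1 := hnT c T hT c
            have h2 := hnT c T' hT' c
            have h : insert (j + 1, c) T = insert (j + 1, c) T' := h
            rw [← Finset.erase_insert h1, h, Finset.erase_insert h2]
      · intro c hc c' hc' hne
        rw [Function.onFun, Finset.disjoint_left]
        intro S h h'
        rw [Finset.mem_image] at h h'
        obtain ⟨T, hT, rfl⟩ := h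
        obtain ⟨T', hT', h'⟩ := h'
        have : (j + 1, c') ∈ insert (j + 1, c) T := by
          rw [← h']; exact Finset.mem_insert_self _ _
        rcases Finset.mem_insert.1 this with h | h
        · simp only [Prod.mk.injEq, true_and] at h
          exact hne h.symm
        · exact hnT c T hT _ h
      · rw [Finset.disjoint_left]
        intro S h h'
        rw [mem_chordEnum _ _ _ hV1, chordP_none] at h
        rw [Finset.mem_biUnion] at h'
        obtain ⟨c, hc, h'⟩ := h'
        rw [Finset.mem_image] at h'
        obtain ⟨T, hT, rfl⟩ := h'
        exact h.1.2 c (Finset.mem_insert_self _ _)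

/-- choose with index shifted down by one -/
def chB (A : ℕ) : ℕ → ℤ
  | 0 => 0
  | k + 1 => (A.choose k : ℤ)

lemma chB_succ (A k : ℕ) : chB (A + 1) k.succ = chB A k.succ + chB A k := by
  cases k with
  | zero => simp [chB]
  | succ k => simp only [chB, Nat.choose_succ_succ]; push_cast; ring

def chF (r A k : ℕ) : ℤ := chB r (k + 1) * chB A (k + 1) - chB r (k + 2) * chB A k

lemma chF_sum (j k s : ℕ) :
    ∑ i ∈ Finset.range s, chF (j + 1) (j + (i + 1)) k =
      chF (j + 2) (j + 1 + s) (k + 1) - chF (j + 1) (j + 1 + s) (k + 1) := by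
  induction s with
  | zero =>
    simp only [chF, Finset.range_zero, Finset.sum_empty, add_zero]
    rw [show j + 2 = (j + 1) + 1 from rfl, chB_succ (j + 1) (k + 1), chB_succ (j + 1) (k + 2)]
    ring
  | succ s ih =>
    rw [Finset.sum_range_succ, ih]
    simp only [chF]
    rw [show j + 1 + (s + 1) = (j + 1 + s) + 1 from rfl, show j + (s + 1) = j + 1 + s by ring]
    rw [show j + 2 = (j + 1) + 1 from rfl, chB_succ (j + 1) (k + 1), chB_succ (j + 1) (k + 2),
      chB_succ (j + 1 + s) (k + 1), chB_succ (j + 1 + s) k]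
    ring

lemma chordCnt_eq (j k s : ℕ) : (chordCnt (j + 1) k s : ℤ) = chF (j + 1) (j + s) k := by
  induction j generalizing k s with
  | zero =>
    rcases k with _ | _ | k
    · simp [chordCnt, chF, chB]
    · simp [chordCnt, chF, chB]
    · simp [chordCnt, chF, chB, Nat.choose_succ_succ]
  | succ j ih =>
    rcases k with _ | k
    · rw [chordCnt, ih]
      simp [chF, chB]
    · rw [chordCnt]
      push_cast
      rw [ih, Finset.sum_congr rfl (fun i _ => ih k (i + 1)), chF_sum,
        show j + (s + 1) = j + 1 + s by ring]
      ring

lemma chF_narayana (j k : ℕ) :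
    ((k : ℤ) + 1) * chF (j + 1) j k = (j.choose k : ℤ) * ((j + 1).choose k : ℤ) := by
  rcases k with _ | k
  · simp [chF, chB]
  · simp only [chF, chB]
    have h1 := Nat.add_one_mul_choose_eq j (k + 1)
    have h2 := Nat.add_one_mul_choose_eq j k
    zify at h1 h2
    push_cast
    linear_combination (j.choose k : ℤ) * h1 - (j.choose (k + 1) : ℤ) * h2

def quadEmb : (ℕ × ℕ) ↪ (ℕ × ℕ × ℕ × ℕ) :=
  ⟨fun p => (p.1, p.1 + 1, p.2, p.2 + 1), by
    rintro ⟨a, c⟩ ⟨a', c'⟩ h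
    simp only [Prod.mk.injEq] at h
    simp [h.1, h.2.2.1]⟩

lemma quadEmb_mem (S : Finset (ℕ × ℕ)) (a b c d : ℕ) :
    (a, b, c, d) ∈ S.map quadEmb ↔ (a, c) ∈ S ∧ b = a + 1 ∧ d = c + 1 := by
  rw [Finset.mem_map]
  constructor
  · rintro ⟨⟨x, y⟩, h, e⟩
    simp only [quadEmb, Function.Embedding.coeFn_mk, Prod.mk.injEq] at e
    obtain ⟨rfl, rfl, rfl, rfl⟩ := e
    exact ⟨h, rfl, rfl⟩
  · rintro ⟨h, rfl, rfl⟩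
    exact ⟨(a, c), h, rfl⟩

lemma isChord_map (m : ℕ) (S : Finset (ℕ × ℕ)) :
    IsChordDiagram (m + 4) (S.map quadEmb) ↔ ChordP (m + 1) {m + 2} S := by
  simp only [IsChordDiagram, ChordP, quadEmb_mem, Finset.mem_singleton]
  constructor
  · rintro ⟨h1, h2, h3⟩
    refine ⟨?_, ?_, ?_⟩
    · intro a c h
      have := h1 a (a + 1) c (c + 1) ⟨h, rfl, rfl⟩
      omega
    · intro a c c' h h'
      by_contra hne
      refine h2 a (a + 1) c (c + 1) a (a + 1) c' (c' + 1) ⟨h, rfl, rfl⟩ ⟨h', rfl, rfl⟩ ?_ rfl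
      intro e
      simp only [Prod.mk.injEq] at e
      exact hne e.2.2.1
    · intro a c a' c' h h'
      exact h3 a _ c _ a' _ c' _ ⟨h, rfl, rfl⟩ ⟨h', rfl, rfl⟩
  · rintro ⟨h1, h2, h3⟩
    refine ⟨?_, ?_, ?_⟩
    · rintro a b c d ⟨h, rfl, rfl⟩
      have := h1 a c h
      omega
    · rintro a b c d a' b' c' d' ⟨h, rfl, rfl⟩ ⟨h', rfl, rfl⟩ hne rfl
      apply hne
      rw [h2 a c c' h h']
    · rintro a b c d a' b' c' d' ⟨h, -, -⟩ ⟨h', -, -⟩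
      exact h3 a c a' c' h h'

/-- **Enumeration of chord diagrams by Narayana numbers** (claim following Definition 5.4):
`(k+1) · |CD_{n,k}| = C(n−4, k) · C(n−3, k)`. -/
theorem chord_diagrams_narayana (n k : ℕ) (hn : 4 ≤ n) :
    (k + 1) * Nat.card {D : Finset (ℕ × ℕ × ℕ × ℕ) // IsChordDiagram n D ∧ D.card = k} =
      Nat.choose (n - 4) k * Nat.choose (n - 3) k := by
  obtain ⟨m, rfl⟩ : ∃ m, n = m + 4 := ⟨n - 4, by omega⟩
  have hV : ∀ v ∈ ({m + 2} : Finset ℕ), m + 1 < v := by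
    intro v hv
    rw [Finset.mem_singleton] at hv
    omega
  rw [Nat.subtype_card ((chordEnum (m + 1) k {m + 2}).map (Finset.mapEmbedding quadEmb).toEmbedding)]
  · rw [Finset.card_map, card_chordEnum (m + 1) k 0 {m + 2} hV (by simp) (by simp)]
    have h := chF_narayana m k
    have h2 := chordCnt_eq m k 0
    rw [add_zero] at h2
    rw [← h2] at h
    rw [show m + 4 - 4 = m by omega, show m + 4 - 3 = m + 1 by omega]
    exact_mod_cast h
  · intro D
    rw [Finset.mem_map]
    constructor
    · rintro ⟨S, hS, rfl⟩
      rw [mem_chordEnum _ _ _ hV] at hS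
      refine ⟨(isChord_map m S).2 hS.1, ?_⟩
      exact (Finset.card_map _).trans hS.2
    · rintro ⟨h, hk⟩
      have hD : (D.image (fun q : ℕ × ℕ × ℕ × ℕ => (q.1, q.2.2.1))).map quadEmb = D := by
        ext ⟨a, b, c, d⟩
        rw [quadEmb_mem, Finset.mem_image]
        constructor
        · rintro ⟨⟨⟨a', b', c', d'⟩, hq, e⟩, rfl, rfl⟩
          simp only [Prod.mk.injEq] at e
          obtain ⟨rfl, rfl⟩ := e
          have := h.1 _ _ _ _ hq
          obtain ⟨rfl, rfl, -⟩ := this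
          exact hq
        · intro hq
          have := h.1 _ _ _ _ hq
          exact ⟨⟨_, hq, rfl⟩, this.1, this.2.1⟩
      refine ⟨D.image (fun q : ℕ × ℕ × ℕ × ℕ => (q.1, q.2.2.1)), ?_, hD⟩
      rw [mem_chordEnum _ _ _ hV, ← isChord_map, hD]
      refine ⟨h, ?_⟩
      rw [← hk]
      conv_rhs => rw [← hD]
      rw [Finset.card_map]
end

section
/- Mutation preserves signed seeds (Proposition 7.31): Let (B, σ) be a signed seed and let k be a mutable index (1 ≤ k ≤ r). Then μ_k(B, σ) = (B′, σ′) is again a signed seed; that is, for every mutable index i one has ∏_{j=1}^{s} σ′(j)^{B′_{ji}} = 1. -/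
open Matrix Finset

/-- The mutated extended exchange matrix `μ_k(B)`: `B'_{ij} = −B_{ij}` if `i = k` or
`j = k` (where the row index `i = k` means the row corresponding to the mutable index
`k`), and `B'_{ij} = B_{ij} + (|B_{ik}|·B_{kj} + B_{ik}·|B_{kj}|)/2` otherwise. -/
def mutMatrix {r s : ℕ} (hr : r ≤ s) (B : Matrix (Fin s) (Fin r) ℤ) (k : Fin r) :
    Matrix (Fin s) (Fin r) ℤ :=
  Matrix.of fun i j =>
    if i = Fin.castLE hr k ∨ j = k then -B i j
    else B i j + (|B i k| * B (Fin.castLE hr k) j + B i k * |B (Fin.castLE hr k) j|) / 2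

/-- The mutated sign assignment: `σ'(j) = σ(j)` for `j ≠ k`, and
`σ'(k) = σ(k) · ∏_{j : B_{jk} > 0} σ(j)^{B_{jk}}`. -/
noncomputable def mutSign {r s : ℕ} (hr : r ≤ s) (B : Matrix (Fin s) (Fin r) ℤ)
    (σ : Fin s → ℝ) (k : Fin r) : Fin s → ℝ :=
  fun j =>
    if j = Fin.castLE hr k then
      σ j * ∏ l ∈ Finset.univ.filter (fun l : Fin s => 0 < B l k), σ l ^ (B l k)
    else σ j

/-- **Mutation preserves signed seeds** (Proposition 7.31).  If `(B, σ)` is a signed seed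
(`B` an extended exchange matrix with skew-symmetric top `r × r` part, `σ` a `±1` sign
assignment with `∏_j σ(j)^{B_{ji}} = 1` for every mutable `i`), then for any mutable
index `k`, the mutated pair `μ_k(B, σ) = (B', σ')` is again a signed seed. -/
theorem signed_seed_mutation {r s : ℕ} (hr : r ≤ s)
    (B : Matrix (Fin s) (Fin r) ℤ) (σ : Fin s → ℝ)
    (hskew : ∀ i j : Fin r, B (Fin.castLE hr i) j = -B (Fin.castLE hr j) i)
    (hσ : ∀ j, σ j = 1 ∨ σ j = -1)
    (hsigned : ∀ i : Fin r, ∏ j : Fin s, σ j ^ (B j i) = 1)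
    (k : Fin r) :
    ∀ i : Fin r, ∏ j : Fin s, mutSign hr B σ k j ^ (mutMatrix hr B k j i) = 1 := by
  intro i
  have h0 : ∀ j, σ j ≠ 0 := by
    intro j
    rcases hσ j with h | h <;> rw [h] <;> norm_num
  have hKK : B (Fin.castLE hr k) k = 0 := by
    have := hskew k k
    omega
  by_cases hik : i = k
  · subst hik
    have : ∀ j, mutSign hr B σ i j ^ (mutMatrix hr B i j i) = (σ j ^ (B j i))⁻¹ := by
      intro j
      by_cases hj : j = Fin.castLE hr i
      · subst hj
        simp [mutMatrix, hKK]
      · simp [mutMatrix, mutSign, hj]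
    simp only [this]
    rw [Finset.prod_inv_distrib, hsigned, inv_one]
  · set K := Fin.castLE hr k with hK
    set P : ℝ := ∏ l ∈ Finset.univ.filter (fun l : Fin s => 0 < B l k), σ l ^ (B l k) with hP
    have hPp : ∏ j, σ j ^ (max (B j k) 0) = P := by
      rw [hP, Finset.prod_filter]
      refine Finset.prod_congr rfl fun j _ => ?_
      split_ifs with h
      · rw [max_eq_left h.le]
      · rw [max_eq_right (not_lt.mp h), zpow_zero]
    have hP0 : P ≠ 0 := by
      rw [hP]
      exact Finset.prod_ne_zero_iff.mpr fun j _ => zpow_ne_zero _ (h0 j)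
    have hPm : ∏ j, σ j ^ (max (-B j k) 0) = P := by
      rw [← hPp, ← mul_one (∏ j, σ j ^ (max (-B j k) 0)), ← hsigned k,
        ← Finset.prod_mul_distrib]
      refine Finset.prod_congr rfl fun j _ => ?_
      rw [← zpow_add₀ (h0 j)]
      congr 1
      omega
    obtain ⟨c, hc1, hcK, hc⟩ : ∃ c : Fin s → ℤ, ∏ j, σ j ^ c j = P ∧ c K = 0 ∧
        ∀ j, (|B j k| * B K i + B j k * |B K i|) / 2 = c j * B K i := by
      rcases le_total 0 (B K i) with hb | hb
      · refine ⟨fun j => max (B j k) 0, hPp, by simp [hKK], fun j => ?_⟩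
        rw [abs_of_nonneg hb]
        apply Int.ediv_eq_of_eq_mul_left (by norm_num)
        rcases le_total 0 (B j k) with h | h
        · simp only [abs_of_nonneg h, max_eq_left h]; ring
        · simp only [abs_of_nonpos h, max_eq_right h]; ring
      · refine ⟨fun j => max (-B j k) 0, hPm, by simp [hKK], fun j => ?_⟩
        rw [abs_of_nonpos hb]
        apply Int.ediv_eq_of_eq_mul_left (by norm_num)
        rcases le_total 0 (B j k) with h | h
        · simp only [abs_of_nonneg h, max_eq_right (neg_nonpos.mpr h)]; ring
        · simp only [abs_of_nonpos h, max_eq_left (neg_nonneg.mpr h)]; ring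
    have key : ∀ j, mutSign hr B σ k j ^ (mutMatrix hr B k j i) =
        σ j ^ (B j i) * (σ j ^ c j) ^ (B K i) * (if j = K then P ^ (-(B K i)) else 1) := by
      intro j
      by_cases hj : j = K
      · subst hj
        have hinv : (σ K)⁻¹ = σ K := by
          rcases hσ K with h | h <;> rw [h] <;> norm_num
        have e1 : mutSign hr B σ k K = σ K * P := by simp [mutSign, hP, hK]
        have e2 : mutMatrix hr B k K i = -B K i := by simp [mutMatrix, hK]
        rw [e1, e2, mul_zpow, hcK, _root_.zpow_neg, ← _root_.inv_zpow, hinv]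
        simp
      · have e1 : mutSign hr B σ k j = σ j := by simp [mutSign, ← hK, hj]
        have e2 : mutMatrix hr B k j i = B j i + c j * B K i := by
          rw [← hc j]
          simp [mutMatrix, ← hK, hj, hik]
        rw [e1, e2, if_neg hj, mul_one, zpow_add₀ (h0 j), _root_.zpow_mul]
    simp only [key]
    rw [Finset.prod_mul_distrib, Finset.prod_mul_distrib, hsigned, Finset.prod_zpow, hc1,
      Finset.prod_ite_eq' Finset.univ K, if_pos (Finset.mem_univ _), one_mul,
      ← zpow_add₀ hP0, add_neg_cancel, zpow_zero]
end

section
/- Intersection of a k-plane with a 5-plane via twistors (Lemma 10.1): Let k ≥ 1, let Y be a real k × (k+4) matrix with rows Y₁,…,Y_k and let Z be a real 5 × (k+4) matrix with rows Z₁,…,Z₅. For a 4-element subset I ⊂ {1,…,5} let ⟨⟨I⟩⟩ denote the determinant of the (k+4) × (k+4) matrix whose rows are Y₁,…,Y_k followed by the rows Z_i for i ∈ I in increasing order. Define v := ⟨⟨2345⟩⟩·Z₁ − ⟨⟨1345⟩⟩·Z₂ + ⟨⟨1245⟩⟩·Z₃ − ⟨⟨1235⟩⟩·Z₄ + ⟨⟨1234⟩⟩·Z₅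 ∈ ℝ^{k+4}. If at least one of the five numbers ⟨⟨2345⟩⟩, ⟨⟨1345⟩⟩, ⟨⟨1245⟩⟩, ⟨⟨1235⟩⟩, ⟨⟨1234⟩⟩ is nonzero, then span(Y₁,…,Y_k) ∩ span(Z₁,…,Z₅) = span(v); in particular this intersection is the zero subspace if and only if v = 0. -/
open Matrix

/-- The twistor coordinate `⟨⟨I⟩⟩` for a 4-element subset of the rows of `Z`: the
determinant of the `(k+4) × (k+4)` matrix whose rows are the `k` rows of `Y` followed by
the rows `Z_{i₁}, Z_{i₂}, Z_{i₃}, Z_{i₄}`. -/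
noncomputable def twst {k : ℕ} (Y : Matrix (Fin k) (Fin (k + 4)) ℝ)
    (Z : Matrix (Fin 5) (Fin (k + 4)) ℝ) (i₁ i₂ i₃ i₄ : Fin 5) : ℝ :=
  (Matrix.of (Fin.append (fun i : Fin k => Y i) ![Z i₁, Z i₂, Z i₃, Z i₄])).det

/-- The vector `v := ⟨⟨2345⟩⟩·Z₁ − ⟨⟨1345⟩⟩·Z₂ + ⟨⟨1245⟩⟩·Z₃ − ⟨⟨1235⟩⟩·Z₄ + ⟨⟨1234⟩⟩·Z₅`
(with 1-based row indices of the paper corresponding to `Fin 5` values `0,…,4`). -/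
noncomputable def vvec {k : ℕ} (Y : Matrix (Fin k) (Fin (k + 4)) ℝ)
    (Z : Matrix (Fin 5) (Fin (k + 4)) ℝ) : Fin (k + 4) → ℝ :=
  twst Y Z 1 2 3 4 • Z 0 - twst Y Z 0 2 3 4 • Z 1 + twst Y Z 0 1 3 4 • Z 2
    - twst Y Z 0 1 2 4 • Z 3 + twst Y Z 0 1 2 3 • Z 4


noncomputable def dD {k : ℕ} (Y : Matrix (Fin k) (Fin (k + 4)) ℝ)
    (a b c d : Fin (k + 4) → ℝ) : ℝ :=
  (Matrix.of (Fin.append (fun i : Fin k => Y i) ![a, b, c, d])).det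

lemma dD_lin {k : ℕ} (Y : Matrix (Fin k) (Fin (k + 4)) ℝ) (b c d : Fin (k + 4) → ℝ) :
    ∃ L : (Fin (k + 4) → ℝ) →ₗ[ℝ] ℝ, ∀ a, L a = dD Y a b c d := by
  refine ⟨(Matrix.detRowAlternating (n := Fin (k+4)) (R := ℝ)).toMultilinearMap.toLinearMap
    (Fin.append (fun i : Fin k => Y i) ![0, b, c, d]) (Fin.natAdd k 0), fun a => ?_⟩
  have : Function.update (Fin.append (fun i : Fin k => Y i) ![0, b, c, d]) (Fin.natAdd k 0) a
      = Fin.append (fun i : Fin k => Y i) ![a, b, c, d] := by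
    funext i
    refine Fin.addCases (fun i => ?_) (fun i => ?_) i
    · rw [Function.update_of_ne, Fin.append_left, Fin.append_left]
      intro h
      have := congrArg Fin.val h
      simp at this
      omega
    · fin_cases i
      · simp
      all_goals
        rw [Function.update_of_ne, Fin.append_right, Fin.append_right]
        · rfl
        · intro h
          have := congrArg Fin.val h
          simp at this
  rw [MultilinearMap.toLinearMap_apply, this]
  rfl

lemma dD_swap {k : ℕ} (Y : Matrix (Fin k) (Fin (k + 4)) ℝ) (x y : Fin 4 → (Fin (k + 4) → ℝ))
    (p q : Fin 4) (hpq : p ≠ q) (h : y = x ∘ Equiv.swap p q) :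
    dD Y (y 0) (y 1) (y 2) (y 3) = - dD Y (x 0) (x 1) (x 2) (x 3) := by
  have e : ∀ x : Fin 4 → (Fin (k + 4) → ℝ), ![x 0, x 1, x 2, x 3] = x := by
    intro x; funext i; fin_cases i <;> rfl
  unfold dD
  rw [e, e]
  have hne : Fin.natAdd k p ≠ Fin.natAdd k q := by
    intro h
    have := congrArg Fin.val h
    simp at this
    omega
  have := (Matrix.detRowAlternating (n := Fin (k+4)) (R := ℝ)).map_swap
    (Fin.append (fun i : Fin k => Y i) x) hne
  have h2 : (Fin.append (fun i : Fin k => Y i) x) ∘ Equiv.swap (Fin.natAdd k p) (Fin.natAdd k q)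
     = Fin.append (fun i : Fin k => Y i) y := by
    funext i
    refine Fin.addCases (fun i => ?_) (fun i => ?_) i
    · rw [Function.comp_apply, Equiv.swap_apply_of_ne_of_ne, Fin.append_left, Fin.append_left]
      all_goals
        intro h
        have := congrArg Fin.val h
        simp at this
        omega
    · have e2 : Equiv.swap (Fin.natAdd k p) (Fin.natAdd k q) (Fin.natAdd k i)
          = Fin.natAdd k (Equiv.swap p q i) :=
        (Fin.natAdd_injective 4 k).swap_apply p q i
      rw [Function.comp_apply, e2, Fin.append_right, Fin.append_right, h]
      rfl
  rw [h2] at this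
  exact this

lemma dD_s1 {k : ℕ} (Y : Matrix (Fin k) (Fin (k + 4)) ℝ) (a b c d : Fin (k + 4) → ℝ) :
    dD Y b a c d = - dD Y a b c d :=
  dD_swap Y ![a, b, c, d] ![b, a, c, d] 0 1 (by decide) (by funext i; fin_cases i <;> rfl)

lemma dD_s2 {k : ℕ} (Y : Matrix (Fin k) (Fin (k + 4)) ℝ) (a b c d : Fin (k + 4) → ℝ) :
    dD Y a c b d = - dD Y a b c d :=
  dD_swap Y ![a, b, c, d] ![a, c, b, d] 1 2 (by decide) (by funext i; fin_cases i <;> rfl)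

lemma dD_s3 {k : ℕ} (Y : Matrix (Fin k) (Fin (k + 4)) ℝ) (a b c d : Fin (k + 4) → ℝ) :
    dD Y a b d c = - dD Y a b c d :=
  dD_swap Y ![a, b, c, d] ![a, b, d, c] 2 3 (by decide) (by funext i; fin_cases i <;> rfl)

lemma dD_z1 {k : ℕ} (Y : Matrix (Fin k) (Fin (k + 4)) ℝ) (a b c : Fin (k + 4) → ℝ) :
    dD Y a a b c = 0 := by
  have := dD_s1 Y a a b c
  linarith

lemma dD_z2 {k : ℕ} (Y : Matrix (Fin k) (Fin (k + 4)) ℝ) (a b c : Fin (k + 4) → ℝ) :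
    dD Y a b a c = 0 := by
  rw [dD_s2, dD_z1, neg_zero]

lemma dD_z3 {k : ℕ} (Y : Matrix (Fin k) (Fin (k + 4)) ℝ) (a b c : Fin (k + 4) → ℝ) :
    dD Y a b c a = 0 := by
  rw [dD_s3, dD_z2, neg_zero]

lemma dD_span {k : ℕ} (Y : Matrix (Fin k) (Fin (k + 4)) ℝ) (a b c d : Fin (k + 4) → ℝ)
    (h : a ∈ Submodule.span ℝ (Set.range fun i => Y i)) : dD Y a b c d = 0 := by
  obtain ⟨L, hL⟩ := dD_lin Y b c d
  have : Submodule.span ℝ (Set.range fun i => Y i) ≤ LinearMap.ker L := by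
    rw [Submodule.span_le]
    rintro _ ⟨i, rfl⟩
    simp only [SetLike.mem_coe, LinearMap.mem_ker, hL]
    unfold dD
    refine Matrix.det_zero_of_row_eq (i := Fin.castAdd 4 i) (j := Fin.natAdd k 0) ?_ ?_
    · intro h
      have := congrArg Fin.val h
      simp at this
      omega
    · exact (Fin.append_left (fun i : Fin k => Y i) ![Y i, b, c, d] i).trans
        (Fin.append_right (fun i : Fin k => Y i) ![Y i, b, c, d] 0).symm
  rw [← hL]
  exact this h

lemma dD_rel {k : ℕ} (Y : Matrix (Fin k) (Fin (k + 4)) ℝ) (Z : Matrix (Fin 5) (Fin (k + 4)) ℝ)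
    (w : Fin 5 → ℝ)
    (h : ∑ i, w i • Z i ∈ Submodule.span ℝ (Set.range fun i => Y i)) (b c d : Fin (k + 4) → ℝ) :
    w 0 * dD Y (Z 0) b c d + w 1 * dD Y (Z 1) b c d + w 2 * dD Y (Z 2) b c d
      + w 3 * dD Y (Z 3) b c d + w 4 * dD Y (Z 4) b c d = 0 := by
  have h1 := dD_span Y _ b c d h
  obtain ⟨L, hL⟩ := dD_lin Y b c d
  rw [← hL, map_sum] at h1
  have hs : ∀ i, dD Y (w i • Z i) b c d = w i * dD Y (Z i) b c d := by
    intro i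
    rw [← hL, ← hL]
    exact L.map_smul (w i) (Z i)
  simp only [Fin.sum_univ_five, hL, hs] at h1
  exact h1

/-- signed twistors -/
noncomputable def tv {k : ℕ} (Y : Matrix (Fin k) (Fin (k + 4)) ℝ)
    (Z : Matrix (Fin 5) (Fin (k + 4)) ℝ) : Fin 5 → ℝ :=
  ![twst Y Z 1 2 3 4, - twst Y Z 0 2 3 4, twst Y Z 0 1 3 4, - twst Y Z 0 1 2 4, twst Y Z 0 1 2 3]

lemma vvec_eq {k : ℕ} (Y : Matrix (Fin k) (Fin (k + 4)) ℝ)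
    (Z : Matrix (Fin 5) (Fin (k + 4)) ℝ) : vvec Y Z = ∑ i, tv Y Z i • Z i := by
  simp [vvec, tv, Fin.sum_univ_five, sub_eq_add_neg]

lemma tv_rel {k : ℕ} (Y : Matrix (Fin k) (Fin (k + 4)) ℝ) (Z : Matrix (Fin 5) (Fin (k + 4)) ℝ)
    (w : Fin 5 → ℝ)
    (h : ∑ i, w i • Z i ∈ Submodule.span ℝ (Set.range fun i => Y i)) (i j : Fin 5) :
    w i * tv Y Z j = w j * tv Y Z i := by
  have R := dD_rel Y Z w h
  have key : ∀ i j : Fin 5, i < j → w i * tv Y Z j = w j * tv Y Z i := by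
    have T : ∀ a b c d, twst Y Z a b c d = dD Y (Z a) (Z b) (Z c) (Z d) := fun _ _ _ _ => rfl
    have N1 : ∀ i a b c : Fin 5, dD Y (Z i) (Z a) (Z b) (Z c) = - dD Y (Z a) (Z i) (Z b) (Z c) :=
      fun i a b c => dD_s1 _ _ _ _ _
    have N2 : ∀ i a b c : Fin 5, dD Y (Z i) (Z a) (Z b) (Z c) = dD Y (Z a) (Z b) (Z i) (Z c) :=
      fun i a b c => by rw [dD_s1, dD_s2, neg_neg]
    have N3 : ∀ i a b c : Fin 5, dD Y (Z i) (Z a) (Z b) (Z c) = - dD Y (Z a) (Z b) (Z c) (Z i) :=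
      fun i a b c => by rw [dD_s1, dD_s2, dD_s3, neg_neg]
    intro i j hij
    fin_cases i <;> fin_cases j <;> first | (exact absurd hij (by decide)) | skip
    · have r := R (Z 2) (Z 3) (Z 4)
      rw [dD_z1, dD_z2, dD_z3] at r
      simp [tv, T]
      linarith
    · have r := R (Z 1) (Z 3) (Z 4)
      rw [dD_z1, dD_z2, dD_z3, N1 2 1 3 4] at r
      simp [tv, T]
      linarith
    · have r := R (Z 1) (Z 2) (Z 4)
      rw [dD_z1, dD_z2, dD_z3, N2 3 1 2 4] at r
      simp [tv, T]
      linarith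
    · have r := R (Z 1) (Z 2) (Z 3)
      rw [dD_z1, dD_z2, dD_z3, N3 4 1 2 3] at r
      simp [tv, T]
      linarith
    · have r := R (Z 0) (Z 3) (Z 4)
      rw [dD_z1, dD_z2, dD_z3, N1 1 0 3 4, N1 2 0 3 4] at r
      simp [tv, T]
      linarith
    · have r := R (Z 0) (Z 2) (Z 4)
      rw [dD_z1, dD_z2, dD_z3, N1 1 0 2 4, N2 3 0 2 4] at r
      simp [tv, T]
      linarith
    · have r := R (Z 0) (Z 2) (Z 3)
      rw [dD_z1, dD_z2, dD_z3, N1 1 0 2 3, N3 4 0 2 3] at r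
      simp [tv, T]
      linarith
    · have r := R (Z 0) (Z 1) (Z 4)
      rw [dD_z1, dD_z2, dD_z3, N2 2 0 1 4, N2 3 0 1 4] at r
      simp [tv, T]
      linarith
    · have r := R (Z 0) (Z 1) (Z 3)
      rw [dD_z1, dD_z2, dD_z3, N2 2 0 1 3, N3 4 0 1 3] at r
      simp [tv, T]
      linarith
    · have r := R (Z 0) (Z 1) (Z 2)
      rw [dD_z1, dD_z2, dD_z3, N3 3 0 1 2, N3 4 0 1 2] at r
      simp [tv, T]
      linarith
  rcases lt_trichotomy i j with hh | hh | hh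
  · exact key i j hh
  · rw [hh]
  · exact (key j i hh).symm

lemma dD_indep {k : ℕ} (Y : Matrix (Fin k) (Fin (k + 4)) ℝ) (a b c d : Fin (k + 4) → ℝ)
    (h : dD Y a b c d ≠ 0) : LinearIndependent ℝ (fun i => Y i) := by
  have h1 := Matrix.linearIndependent_rows_of_det_ne_zero h
  have h2 := h1.comp (Fin.castAdd 4) (Fin.castAdd_injective k 4)
  have h3 : (fun i => Y i) =
      (Fin.append (fun i : Fin k => Y i) ![a, b, c, d]) ∘ Fin.castAdd 4 := by
    funext i
    exact (Fin.append_left (fun i : Fin k => Y i) ![a, b, c, d] i).symm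
  rw [h3]
  exact h2

lemma exists_w {k : ℕ} (Y : Matrix (Fin k) (Fin (k + 4)) ℝ) (Z : Matrix (Fin 5) (Fin (k + 4)) ℝ)
    (hY : LinearIndependent ℝ (fun i => Y i)) : ∃ w : Fin 5 → ℝ, w ≠ 0 ∧
      ∑ i, w i • Z i ∈ Submodule.span ℝ (Set.range fun i => Y i) := by
  have hn : ¬ LinearIndependent ℝ (Sum.elim (fun i => Y i) (fun i => Z i)) := by
    intro h
    have := h.fintype_card_le_finrank
    simp at this
  rw [Fintype.not_linearIndependent_iff] at hn
  obtain ⟨g, hg, i, hi⟩ := hn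
  simp only [Fintype.sum_sum_type, Sum.elim_inl, Sum.elim_inr] at hg
  refine ⟨fun j => g (Sum.inr j), ?_, ?_⟩
  · intro h0
    have h0' : ∀ j, g (Sum.inr j) = 0 := fun j => congrFun h0 j
    simp only [h0', zero_smul, Finset.sum_const_zero, add_zero] at hg
    have := Fintype.linearIndependent_iff.1 hY _ hg
    rcases i with i | i
    · exact hi (this i)
    · exact hi (h0' i)
  · rw [eq_neg_of_add_eq_zero_right hg]
    exact Submodule.neg_mem _ (Submodule.sum_mem _ fun j _ =>
      Submodule.smul_mem _ _ (Submodule.subset_span ⟨j, rfl⟩))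

/-- **Intersection of a `k`-plane with a 5-plane via twistors** (Lemma 10.1).  If at least
one of the five maximal twistor coordinates is nonzero then
`span(Y₁,…,Y_k) ∩ span(Z₁,…,Z₅) = span(v)`; in particular the intersection is the zero
subspace if and only if `v = 0`. -/
theorem span_intersection_eq_span_vvec (k : ℕ) (hk : 1 ≤ k)
    (Y : Matrix (Fin k) (Fin (k + 4)) ℝ) (Z : Matrix (Fin 5) (Fin (k + 4)) ℝ)
    (hne : twst Y Z 1 2 3 4 ≠ 0 ∨ twst Y Z 0 2 3 4 ≠ 0 ∨ twst Y Z 0 1 3 4 ≠ 0 ∨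
      twst Y Z 0 1 2 4 ≠ 0 ∨ twst Y Z 0 1 2 3 ≠ 0) :
    Submodule.span ℝ (Set.range fun i => Y i) ⊓ Submodule.span ℝ (Set.range fun i => Z i) =
        Submodule.span ℝ {vvec Y Z} ∧
      (Submodule.span ℝ (Set.range fun i => Y i) ⊓
          Submodule.span ℝ (Set.range fun i => Z i) = ⊥ ↔ vvec Y Z = 0) := by
  have hj : ∃ j, tv Y Z j ≠ 0 := by
    rcases hne with h | h | h | h | h
    · exact ⟨0, by simpa [tv] using h⟩
    · exact ⟨1, by simpa [tv] using h⟩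
    · exact ⟨2, by simpa [tv] using h⟩
    · exact ⟨3, by simpa [tv] using h⟩
    · exact ⟨4, by simpa [tv] using h⟩
  have hY : LinearIndependent ℝ (fun i => Y i) := by
    rcases hne with h | h | h | h | h <;> exact dD_indep Y _ _ _ _ h
  obtain ⟨j, hj⟩ := hj
  have prop : ∀ w : Fin 5 → ℝ,
      ∑ i, w i • Z i ∈ Submodule.span ℝ (Set.range fun i => Y i) →
      ∀ i, w i = (w j / tv Y Z j) * tv Y Z i := by
    intro w hw i
    have := tv_rel Y Z w hw i j
    field_simp
    linarith
  have sm : ∀ w : Fin 5 → ℝ,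
      ∑ i, w i • Z i ∈ Submodule.span ℝ (Set.range fun i => Y i) →
      ∑ i, w i • Z i = (w j / tv Y Z j) • vvec Y Z := by
    intro w hw
    rw [vvec_eq, Finset.smul_sum]
    refine Finset.sum_congr rfl fun i _ => ?_
    rw [smul_smul, ← prop w hw i]
  have hv : vvec Y Z ∈ Submodule.span ℝ (Set.range fun i => Y i) := by
    obtain ⟨w, hw0, hw⟩ := exists_w Y Z hY
    have hl : w j / tv Y Z j ≠ 0 := by
      intro h0
      apply hw0
      funext i
      rw [prop w hw i, h0, zero_mul]
      rfl
    have := sm w hw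
    rw [this] at hw
    exact (Submodule.smul_mem_iff _ hl).1 hw
  have main : Submodule.span ℝ (Set.range fun i => Y i) ⊓
      Submodule.span ℝ (Set.range fun i => Z i) = Submodule.span ℝ {vvec Y Z} := by
    apply le_antisymm
    · rintro x ⟨hx1, hx2⟩
      obtain ⟨w, rfl⟩ := (Submodule.mem_span_range_iff_exists_fun ℝ).1 hx2
      rw [sm w hx1]
      exact Submodule.smul_mem _ _ (Submodule.mem_span_singleton_self _)
    · rw [Submodule.span_singleton_le_iff_mem]
      refine ⟨hv, ?_⟩
      rw [vvec_eq]
      exact Submodule.sum_mem _ fun j _ =>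
        Submodule.smul_mem _ _ (Submodule.subset_span ⟨j, rfl⟩)
  refine ⟨main, ?_⟩
  rw [main, Submodule.span_singleton_eq_bot]
end

section
/- Twistor expansion lemma (Lemma 2.10): Let C be a real k × n matrix, Z a real n × (k+m) matrix, and I = {i₁ < … < i_m} ⊂ {1,…,n}. Then the determinant of the (k+m) × (k+m) matrix whose first k rows are the rows of C·Z and whose last m rows are rows i₁,…,i_m of Z equals Σ_J ⟨J⟩_C · det(Z_{j₁},…,Z_{j_k}, Z_{i₁},…,Z_{i_m}), where the sum is over all k-element subsets J = {j₁ < … < j_k} of {1,…,n}, ⟨J⟩_C is the k × k minor of C on the columns J, and det(Z_{j₁},…,Z_{j_k}, Z_{i₁},…,Z_{i_m}) is the determinant of the (k+m) × (k+m) matrix whose rows are the listed rows of Z in that order. Moreover, every summand with J ∩ I ≠ ∅ is zero, so the sum may be restricted to subsets J disjoint from I. -/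
open Matrix

open scoped Classical

theorem append_update_aux {α : Type*} {k m : ℕ} [DecidableEq (Fin k)] (v : Fin k → α)
    (w : Fin m → α) (i : Fin k) (x : α) :
    Fin.append (Function.update v i x) w =
      Function.update (Fin.append v w) (Fin.castAdd m i) x := by
  funext j
  refine Fin.addCases (fun j => ?_) (fun j => ?_) j
  · by_cases h : j = i
    · subst h; simp
    · have h' : Fin.castAdd m j ≠ Fin.castAdd m i := fun e => h (Fin.castAdd_injective _ _ e)
      simp [Function.update_of_ne h, Function.update_of_ne h']
  · have h' : Fin.natAdd k j ≠ Fin.castAdd m i := by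
      intro e
      have := congrArg Fin.val e
      simp at this
      omega
    simp [Function.update_of_ne h']

noncomputable def appendDet (k m : ℕ) (w : Fin m → Fin (k + m) → ℝ) :
    (Fin (k + m) → ℝ) [⋀^Fin k]→ₗ[ℝ] ℝ where
  toFun v := (Matrix.detRowAlternating (R := ℝ) (n := Fin (k + m))) (Fin.append v w)
  map_update_add' v i x y := by
    simp only [append_update_aux]
    exact AlternatingMap.map_update_add _ _ _ _ _
  map_update_smul' v i c x := by
    simp only [append_update_aux]
    exact AlternatingMap.map_update_smul _ _ _ _ _
  map_eq_zero_of_eq' v i j h hij :=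
    AlternatingMap.map_eq_zero_of_eq _ _ (i := Fin.castAdd m i) (j := Fin.castAdd m j)
      (by simpa using h) (fun e => hij (Fin.castAdd_injective _ _ e))

theorem alt_expand {k n : ℕ} {M : Type*} [AddCommGroup M] [Module ℝ M]
    (A : M [⋀^Fin k]→ₗ[ℝ] ℝ) (C : Matrix (Fin k) (Fin n) ℝ) (z : Fin n → M) :
    A (fun i => ∑ j, C i j • z j) =
      ∑ f ∈ Finset.univ.filter (fun f : Fin k → Fin n => StrictMono f),
        (C.submatrix id f).det * A (fun t => z (f t)) := by
  have h1 : A (fun i => ∑ j, C i j • z j) =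
      ∑ f : Fin k → Fin n, (∏ i, C i (f i)) * A (fun t => z (f t)) := by
    have := A.toMultilinearMap.map_sum (fun i j => C i j • z j)
    refine this.trans (Finset.sum_congr rfl fun f _ => ?_)
    exact A.toMultilinearMap.map_smul_univ (fun i => C i (f i)) (fun i => z (f i))
  have h2 : ∑ f : Fin k → Fin n, (∏ i, C i (f i)) * A (fun t => z (f t)) =
      ∑ f ∈ Finset.univ.filter (fun f : Fin k → Fin n => Function.Injective f),
        (∏ i, C i (f i)) * A (fun t => z (f t)) := by
    symm
    refine Finset.sum_subset (Finset.subset_univ _) fun f _ hf => ?_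
    have hf : ¬ Function.Injective f := fun h =>
      hf (Finset.mem_filter.2 ⟨Finset.mem_univ _, h⟩)
    unfold Function.Injective at hf
    push Not at hf
    obtain ⟨a, b, hab, hne⟩ := hf
    rw [A.map_eq_zero_of_eq _ (i := a) (j := b) (by simp [hab]) hne, mul_zero]
  have h3 : ∀ f : Fin k → Fin n, (C.submatrix id f).det * A (fun t => z (f t)) =
      ∑ σ : Equiv.Perm (Fin k), (∏ i, C i (f (σ i))) * A (fun t => z (f (σ t))) := by
    intro f
    rw [← Matrix.det_transpose, Matrix.det_apply, Finset.sum_mul]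
    refine Finset.sum_congr rfl fun σ _ => ?_
    have := A.map_perm (fun t => z (f t)) σ
    have e : A (fun t => z (f (σ t))) = Equiv.Perm.sign σ • A (fun t => z (f t)) := this
    rw [e]
    simp [Matrix.transpose_apply, Units.smul_def]
    ring
  rw [h1, h2, Finset.sum_congr rfl (fun f _ => h3 f), ← Finset.sum_product']
  symm
  refine Finset.sum_bij (fun p _ => p.1 ∘ p.2) ?_ ?_ ?_ ?_
  · rintro ⟨f, σ⟩ h
    simp only [Finset.mem_product, Finset.mem_filter, Finset.mem_univ, true_and, and_true] at h ⊢
    exact h.injective.comp σ.injective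
  · rintro ⟨f, σ⟩ h ⟨f', σ'⟩ h' e
    simp only [Finset.mem_product, Finset.mem_filter, Finset.mem_univ, true_and, and_true] at h h' e
    have hr : Set.range f = Set.range f' := by
      rw [← σ.surjective.range_comp f, e, σ'.surjective.range_comp f']
    obtain rfl : f = f' := (StrictMono.range_inj h h').1 hr
    have : σ = σ' := Equiv.ext fun t => h.injective (congrFun e t)
    rw [this]
  · intro f hf
    simp only [Finset.mem_filter, Finset.mem_univ, true_and] at hf
    refine ⟨(f ∘ Tuple.sort f, (Tuple.sort f)⁻¹), ?_, ?_⟩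
    · simp only [Finset.mem_product, Finset.mem_filter, Finset.mem_univ, true_and, and_true]
      exact (Tuple.monotone_sort f).strictMono_of_injective (hf.comp (Tuple.sort f).injective)
    · funext t
      simp
  · rintro ⟨f, σ⟩ h
    rfl

/-- **Twistor expansion lemma** (Lemma 2.10).  The determinant of the `(k+m) × (k+m)`
matrix whose first `k` rows are the rows of `C·Z` and whose last `m` rows are the rows
`i₁ < … < i_m` of `Z` (encoded by the strictly monotone map `g`) equals the sum over all
`k`-element column subsets `J = {j₁ < … < j_k}` (encoded by strictly monotone maps `f`)
of `⟨J⟩_C · det(Z_{j₁},…,Z_{j_k}, Z_{i₁},…,Z_{i_m})`.  Moreover every summand whose column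
set meets `{i₁,…,i_m}` vanishes. -/
theorem twistor_expansion (k m n : ℕ)
    (C : Matrix (Fin k) (Fin n) ℝ) (Z : Matrix (Fin n) (Fin (k + m)) ℝ)
    (g : Fin m → Fin n) (hg : StrictMono g) :
    (Matrix.of (Fin.append (fun i : Fin k => (C * Z) i) fun t : Fin m => Z (g t))).det =
        ∑ f ∈ Finset.univ.filter (fun f : Fin k → Fin n => StrictMono f),
          (C.submatrix id f).det *
            (Matrix.of (Fin.append (fun t : Fin k => Z (f t)) fun t : Fin m => Z (g t))).det ∧
      ∀ f : Fin k → Fin n, StrictMono f → (∃ t₁ t₂, f t₁ = g t₂) →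
        (C.submatrix id f).det *
            (Matrix.of (Fin.append (fun t : Fin k => Z (f t)) fun t : Fin m => Z (g t))).det =
          0 := by
  refine ⟨?_, ?_⟩
  · have h := alt_expand (appendDet k m fun t => Z (g t)) C (fun j => Z j)
    have e : (fun i => ∑ j, C i j • Z j) = fun i : Fin k => (C * Z) i := by
      funext i l
      simp [Matrix.mul_apply, Finset.sum_apply]
    rw [e] at h
    exact h
  · rintro f hf ⟨a, b, hab⟩
    have hne : Fin.castAdd m a ≠ Fin.natAdd k b := by
      intro e
      have := congrArg Fin.val e
      simp at this
      omega
    rw [Matrix.det_zero_of_row_eq hne, mul_zero]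
    have e : Fin.append (fun t => Z (f t)) (fun t => Z (g t)) (Fin.castAdd m a) =
        Fin.append (fun t => Z (f t)) (fun t => Z (g t)) (Fin.natAdd k b) := by
      rw [Fin.append_left, Fin.append_right, hab]
    exact e
end

section
/- Twistor coordinates after a cyclic shift (Lemma 9.1, cyclic case): Let k ≥ 1 and n ≥ k+4. Let C be a real k × n matrix and Z′ a real n × (k+4) matrix all of whose (k+4) × (k+4) minors are positive. Let [cyc_{k,n}] be the n × n matrix with (i, i+1)-entry 1 for 1 ≤ i ≤ n−1, (n,1)-entry (−1)^{k−1}, and 0 elsewhere; set C′ := C·[cyc_{k,n}] and Z := [cyc_{k,n}]·Z′. Then: (i) all (k+4) × (k+4) minors of Z are positive; (ii) C·Z = C′·Z′; and (iii) for all 1 ≤ u < v < x < y ≤ n−1 one has ⟨⟨C·Z; Z_u, Z_v, Z_x, Z_y⟩⟩ = ⟨⟨C′·Z′; Z′_{u+1}, Z′_{v+1}, Z′_{x+1}, Z′_{y+1}⟩⟩, and ⟨⟨C·Z; Z_u, Z_v, Z_x, Z_n⟩⟩ = (−1)^k · ⟨⟨C′·Z′; Z′_1, Z′_{u+1}, Z′_{v+1},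 Z′_{x+1}⟩⟩. -/
open Matrix

/-- The matrix `[cyc_{k,n}]`, with `(i, i+1)`-entry `1` for `1 ≤ i ≤ n−1`, `(n,1)`-entry
`(−1)^{k−1}`, and all other entries `0` (here written with 0-based `Fin n` indices). -/
def cycMat (k n : ℕ) : Matrix (Fin n) (Fin n) ℝ :=
  Matrix.of fun i j =>
    if (i : ℕ) + 1 = (j : ℕ) then 1
    else if (i : ℕ) = n - 1 ∧ (j : ℕ) = 0 then (-1 : ℝ) ^ (k - 1)
    else 0

lemma cyc_row {k n m : ℕ} (Z' : Matrix (Fin n) (Fin m) ℝ) (i : Fin n) (h : (i : ℕ) + 1 < n) :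
    (cycMat k n * Z') i = Z' ⟨(i : ℕ) + 1, h⟩ := by
  ext j
  rw [Matrix.mul_apply, Finset.sum_eq_single ⟨(i : ℕ) + 1, h⟩]
  · simp [cycMat]
  · intro b _ hb
    have h1 : ¬ ((i : ℕ) + 1 = (b : ℕ)) := fun e => hb (Fin.ext e.symm)
    have h2 : ¬ ((i : ℕ) = n - 1 ∧ (b : ℕ) = 0) := by omega
    simp only [cycMat, Matrix.of_apply, if_neg h1, if_neg h2, zero_mul]
  · simp

lemma cyc_last {k n m : ℕ} (Z' : Matrix (Fin n) (Fin m) ℝ) (i : Fin n) (h : (i : ℕ) = n - 1)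
    (h0 : 0 < n) :
    (cycMat k n * Z') i = (-1 : ℝ) ^ (k - 1) • Z' ⟨0, h0⟩ := by
  ext j
  rw [Matrix.mul_apply, Finset.sum_eq_single ⟨0, h0⟩]
  · simp [cycMat, h]
  · intro b _ hb
    have h1 : ¬ ((i : ℕ) + 1 = (b : ℕ)) := by omega
    have h2 : ¬ ((i : ℕ) = n - 1 ∧ (b : ℕ) = 0) := fun e => hb (Fin.ext e.2)
    simp only [cycMat, Matrix.of_apply, if_neg h1, if_neg h2, zero_mul]
  · simp

lemma twistor_sum {k : ℕ} (Y : Matrix (Fin k) (Fin (k + 4)) ℝ)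
    (w : Fin 4 → Fin (k + 4) → ℝ) :
    twistor Y (w 0) (w 1) (w 2) (w 3) =
      (Matrix.of (fun (i j : Fin k ⊕ Fin 4) =>
        (Sum.elim (fun a => Y a) w i : Fin (k + 4) → ℝ) (finSumFinEquiv j))).det := by
  have hw : ![w 0, w 1, w 2, w 3] = w := by
    ext i j; fin_cases i <;> rfl
  rw [twistor, hw, ← Matrix.det_submatrix_equiv_self finSumFinEquiv]
  congr 1
  ext i j
  rcases i with i | i <;> simp

lemma twistor_rot {k : ℕ} (Y : Matrix (Fin k) (Fin (k + 4)) ℝ)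
    (a b c d : Fin (k + 4) → ℝ) :
    twistor Y b c d a = - twistor Y a b c d := by
  have h1 := twistor_sum Y ![b, c, d, a]
  have h2 := twistor_sum Y ![a, b, c, d]
  have e1 : twistor Y b c d a = _ := h1
  have e2 : twistor Y a b c d = _ := h2
  rw [e1, e2]
  have := Matrix.det_permute (Equiv.sumCongr (Equiv.refl (Fin k)) (finRotate 4))
    (Matrix.of (fun (i j : Fin k ⊕ Fin 4) =>
        (Sum.elim (fun a => Y a) ![a, b, c, d] i : Fin (k + 4) → ℝ) (finSumFinEquiv j)))
  have hs : Equiv.Perm.sign (Equiv.sumCongr (Equiv.refl (Fin k)) (finRotate 4)) = -1 := by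
    have := Equiv.Perm.sign_sumCongr (Equiv.refl (Fin k)) (finRotate 4)
    refine this.trans ?_
    have h4 : Equiv.Perm.sign (finRotate 4) = -1 := by decide
    rw [h4, show Equiv.Perm.sign (Equiv.refl (Fin k)) = 1 from Equiv.Perm.sign_one, one_mul]
  rw [hs] at this
  have h3 : ∀ x : ℝ, (((-1 : ℤˣ) : ℤ) : ℝ) * x = -x := by intro x; simp
  rw [h3] at this
  rw [← this]
  congr 1
  ext i j
  rcases i with i | i
  · rfl
  · fin_cases i <;> rfl

lemma twistor_smul {k : ℕ} (Y : Matrix (Fin k) (Fin (k + 4)) ℝ)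
    (a b c d : Fin (k + 4) → ℝ) (s : ℝ) :
    twistor Y b c d (s • a) = s * twistor Y b c d a := by
  have e1 : twistor Y b c d (s • a) = _ := twistor_sum Y ![b, c, d, s • a]
  have e2 : twistor Y b c d a = _ := twistor_sum Y ![b, c, d, a]
  rw [e1, e2]
  have := Matrix.det_mul_row (Sum.elim (fun _ : Fin k => (1 : ℝ)) ![1, 1, 1, s])
    (Matrix.of (fun (i j : Fin k ⊕ Fin 4) =>
        (Sum.elim (fun a => Y a) ![b, c, d, a] i : Fin (k + 4) → ℝ) (finSumFinEquiv j)))ᵀ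
  rw [Matrix.det_transpose, ← Matrix.det_transpose] at this
  simp only [Fintype.prod_sum_type, Fin.prod_univ_four] at this
  have hp : (∏ x : Fin k, Sum.elim (fun _ : Fin k => (1 : ℝ)) ![1, 1, 1, s] (Sum.inl x)) = 1 := by
    simp
  rw [hp] at this
  have hq : (1 : ℝ) * (1 * 1 * 1 * s) = s := by ring
  refine Eq.trans ?_ (this.trans (congrArg (· * _) hq))
  congr 1
  ext i j
  rcases i with i | i
  · simp
  · fin_cases i <;> simp

lemma cyc_pos (k n : ℕ) (hk : 1 ≤ k) (hn : k + 4 ≤ n)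
    (Z' : Matrix (Fin n) (Fin (k + 4)) ℝ) (hZ' : PosMat Z') : PosMat (cycMat k n * Z') := by
  intro g hg
  have hlt : ∀ i : Fin (k + 3), ((g i.castSucc : Fin n) : ℕ) < (g (Fin.last (k + 3)) : Fin n) :=
    fun i => hg (Fin.castSucc_lt_last i)
  by_cases hl : ((g (Fin.last (k + 3)) : Fin n) : ℕ) + 1 < n
  · have hall : ∀ i, ((g i : Fin n) : ℕ) + 1 < n := by
      intro i
      have : ((g i : Fin n) : ℕ) ≤ (g (Fin.last (k + 3)) : Fin n) := hg.monotone (Fin.le_last i)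
      omega
    have := hZ' (fun i => ⟨(g i : ℕ) + 1, hall i⟩) (by
      intro a b hab
      have : ((g a : Fin n) : ℕ) < g b := hg hab
      simp only [Fin.mk_lt_mk]; omega)
    convert this using 2
    ext i j
    exact congrFun (cyc_row Z' (g i) (hall i)) j
  · have hlast : ((g (Fin.last (k + 3)) : Fin n) : ℕ) = n - 1 := by
      have := (g (Fin.last (k + 3))).isLt
      omega
    have hc : ∀ i : Fin (k + 3), ((g i.castSucc : Fin n) : ℕ) + 1 < n := by
      intro i; have := hlt i; omega
    let h : Fin (k + 4) → Fin n :=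
      Fin.cons ⟨0, by omega⟩ (fun i : Fin (k + 3) => ⟨(g i.castSucc : ℕ) + 1, hc i⟩)
    have hh : StrictMono h := by
      intro a b hab
      induction b using Fin.cases with
      | zero => exact absurd hab (Fin.not_lt_zero a)
      | succ b =>
        induction a using Fin.cases with
        | zero => simp [h, Fin.lt_def]
        | succ a =>
          have : ((g a.castSucc : Fin n) : ℕ) < g b.castSucc :=
            hg (by simpa using hab)
          simp only [h, Fin.cons_succ, Fin.mk_lt_mk]; omega
    have hpos := hZ' h hh
    let v : Fin (k + 4) → ℝ := Fin.cons ((-1 : ℝ) ^ (k - 1)) (fun _ => 1)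
    have hd := Matrix.det_mul_column v (Z'.submatrix h id)
    have hp := Matrix.det_permute (finRotate (k + 4))
      (Matrix.of fun i j => v i * (Z'.submatrix h id) i j)
    rw [hd, sign_finRotate] at hp
    have hv : ∏ i, v i = (-1 : ℝ) ^ (k - 1) := by
      simp [v, Fin.prod_univ_succ]
    rw [hv] at hp
    have key : (cycMat k n * Z').submatrix g id =
        (Matrix.of fun i j => v i * (Z'.submatrix h id) i j).submatrix (finRotate (k + 4)) id := by
      ext i j
      induction i using Fin.lastCases with
      | last =>
        simp only [Matrix.submatrix_apply, finRotate_last, Matrix.of_apply, id]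
        rw [cyc_last Z' _ hlast (by omega)]
        simp [v, h]
      | cast i =>
        have : finRotate (k + 4) i.castSucc = i.succ := by
          rw [finRotate_succ_apply]; simp
        simp only [Matrix.submatrix_apply, this, Matrix.of_apply, id]
        rw [cyc_row Z' _ (hc i)]
        simp [v, h]
    rw [key, hp]
    obtain ⟨m, rfl⟩ : ∃ m, k = m + 1 := ⟨k - 1, by omega⟩
    have : ((((-1 : ℤˣ) ^ (m + 1 + 3) : ℤˣ) : ℤ) : ℝ) * ((-1 : ℝ) ^ (m + 1 - 1) *
        (Z'.submatrix h id).det) = (Z'.submatrix h id).det := by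
      push_cast
      rw [← mul_assoc, ← pow_add,
        Even.neg_one_pow ⟨m + 2, by ring⟩, one_mul]
    exact lt_of_lt_of_eq hpos this.symm

/-- **Twistor coordinates after a cyclic shift** (Lemma 9.1, cyclic case).  With
`C' := C·[cyc_{k,n}]` and `Z := [cyc_{k,n}]·Z'`: (i) `Z` is positive; (ii) `C·Z = C'·Z'`;
(iii) the twistors transform as stated (1-based row `t` of the paper is the `Fin n`
element with value `t − 1`). -/
theorem cyc_twistors (k n : ℕ) (hk : 1 ≤ k) (hn : k + 4 ≤ n)
    (C : Matrix (Fin k) (Fin n) ℝ) (Z' : Matrix (Fin n) (Fin (k + 4)) ℝ)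
    (hZ' : PosMat Z') :
    PosMat (cycMat k n * Z') ∧
      C * (cycMat k n * Z') = C * cycMat k n * Z' ∧
      (∀ u v x y : Fin n, ∀ _h1 : (u : ℕ) < (v : ℕ), ∀ _h2 : (v : ℕ) < (x : ℕ),
        ∀ _h3 : (x : ℕ) < (y : ℕ), ∀ _h4 : (y : ℕ) + 1 < n,
        twistor (C * (cycMat k n * Z')) ((cycMat k n * Z') u) ((cycMat k n * Z') v)
            ((cycMat k n * Z') x) ((cycMat k n * Z') y) =
          twistor (C * cycMat k n * Z') (Z' ⟨(u : ℕ) + 1, by omega⟩)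
            (Z' ⟨(v : ℕ) + 1, by omega⟩) (Z' ⟨(x : ℕ) + 1, by omega⟩)
            (Z' ⟨(y : ℕ) + 1, by omega⟩)) ∧
      (∀ u v x : Fin n, ∀ _h1 : (u : ℕ) < (v : ℕ), ∀ _h2 : (v : ℕ) < (x : ℕ),
        ∀ _h3 : (x : ℕ) + 1 < n,
        twistor (C * (cycMat k n * Z')) ((cycMat k n * Z') u) ((cycMat k n * Z') v)
            ((cycMat k n * Z') x) ((cycMat k n * Z') ⟨n - 1, by omega⟩) =
          (-1 : ℝ) ^ k *
            twistor (C * cycMat k n * Z') (Z' ⟨0, by omega⟩) (Z' ⟨(u : ℕ) + 1, by omega⟩)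
              (Z' ⟨(v : ℕ) + 1, by omega⟩) (Z' ⟨(x : ℕ) + 1, by omega⟩)) := by
  refine ⟨cyc_pos k n hk hn Z' hZ', (Matrix.mul_assoc _ _ _).symm, ?_, ?_⟩
  · intro u v x y h1 h2 h3 h4
    rw [cyc_row Z' u (by omega), cyc_row Z' v (by omega), cyc_row Z' x (by omega),
      cyc_row Z' y (by omega), Matrix.mul_assoc]
  · intro u v x h1 h2 h3
    rw [cyc_row Z' u (by omega), cyc_row Z' v (by omega), cyc_row Z' x (by omega),
      cyc_last Z' ⟨n - 1, by omega⟩ rfl (by omega), Matrix.mul_assoc, twistor_smul, twistor_rot]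
    obtain ⟨m, rfl⟩ : ∃ m, k = m + 1 := ⟨k - 1, by omega⟩
    rw [Nat.add_sub_cancel, pow_succ]
    ring
end

section
/- Twistor coordinates after reflection (Lemma 9.1, reflection case): Let k ≥ 1 and n ≥ k+4. Let C′ be a real k × n matrix and Z′ a real n × (k+4) matrix all of whose (k+4) × (k+4) minors are positive. Let [refl_n] be the n × n antidiagonal permutation matrix, let P be the k × k diagonal matrix with first diagonal entry (−1)^{C(k,2)} and other diagonal entries 1, and let P′ be the (k+4) × (k+4) diagonal matrix with first diagonal entry (−1)^{C(k+4,2)} and other diagonal entries 1. Set C := P·C′·[refl_n] and Z := [refl_n]·Z′·P′. Then: (i) all (k+4) × (k+4) minors of Z are positive; and (ii) for all 1 ≤ u < v < x < y ≤ n one has ⟨⟨C·Z; Z_u, Z_v, Z_x, Z_y⟩⟩ = ⟨⟨C′·Z′; Z′_{n+1−y}, Z′_{n+1−x}, Z′_{n+1−v}, Z′_{n+1−u}⟩⟩. -/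
open Matrix

/-- The antidiagonal permutation matrix `[refl_n]` (1's on the antidiagonal). -/
def reflMat (n : ℕ) : Matrix (Fin n) (Fin n) ℝ :=
  Matrix.of fun i j => if (i : ℕ) + (j : ℕ) + 1 = n then 1 else 0

/-- The `k × k` diagonal matrix whose first diagonal entry is `(−1)^{C(k,2)}` and whose
other diagonal entries are `1`. -/
def diagSign (k : ℕ) : Matrix (Fin k) (Fin k) ℝ :=
  Matrix.diagonal fun i => if (i : ℕ) = 0 then (-1 : ℝ) ^ Nat.choose k 2 else 1



lemma sign_revPerm_aux (m : ℕ) :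
    Equiv.Perm.sign (Fin.revPerm : Equiv.Perm (Fin m)) = (-1) ^ Nat.choose m 2 := by
  rw [Equiv.Perm.sign_eq_prod_prod_Iio]
  have h : ∀ j : Fin m, (∏ i ∈ Finset.Iio j,
      (if (Fin.revPerm i : Fin m) < Fin.revPerm j then (1 : ℤˣ) else -1)) = (-1) ^ (j : ℕ) := by
    intro j
    rw [Finset.prod_congr rfl (g := fun _ => (-1 : ℤˣ))]
    · simp
    · intro i hi
      have hij : i < j := Finset.mem_Iio.mp hi
      rw [if_neg]
      simp only [Fin.revPerm_apply, Fin.rev_lt_rev]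
      exact not_lt.mpr hij.le
  rw [Finset.prod_congr rfl (fun j _ => h j), Finset.prod_pow_eq_pow_sum,
    Fin.sum_univ_eq_sum_range (fun i => i) m, Finset.sum_range_id, Nat.choose_two_right]

lemma reflMat_mul_aux {n m : ℕ} (A : Matrix (Fin n) (Fin m) ℝ) :
    reflMat n * A = A.submatrix Fin.rev id := by
  ext i j
  rw [Matrix.mul_apply, Finset.sum_eq_single (Fin.rev i)]
  · have : (i : ℕ) + (Fin.rev i : ℕ) + 1 = n := by
      rw [Fin.val_rev]; omega
    simp [reflMat, -Fin.val_rev, this]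
  · intro b _ hb
    have : ¬ ((i : ℕ) + (b : ℕ) + 1 = n) := by
      intro h
      apply hb
      ext
      rw [Fin.val_rev]; omega
    simp [reflMat, this]
  · simp

lemma det_diagSign_aux (m : ℕ) (hm : 1 ≤ m) : (diagSign m).det = (-1) ^ Nat.choose m 2 := by
  obtain ⟨m, rfl⟩ : ∃ l, m = l + 1 := ⟨m - 1, by omega⟩
  rw [diagSign, Matrix.det_diagonal, Fin.prod_univ_succ]
  simp

lemma neg_one_sq_aux (m : ℕ) : ((-1 : ℝ) ^ m) * (-1) ^ m = 1 := by
  rw [← mul_pow]; simp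

lemma twistor_rev_aux {k : ℕ} (Y : Matrix (Fin k) (Fin (k + 4)) ℝ)
    (a b c d : Fin (k + 4) → ℝ) : twistor Y a b c d = twistor Y d c b a := by
  unfold twistor
  set f : Fin 4 → Fin (k + 4) := Fin.natAdd k with hf
  have hinj : Function.Injective f := Fin.natAdd_injective 4 k
  set σ : Equiv.Perm (Fin (k + 4)) := Equiv.swap (f 0) (f 3) * Equiv.swap (f 1) (f 2) with hσ
  have hs : Equiv.Perm.sign σ = 1 := by
    rw [hσ, Equiv.Perm.sign_mul, Equiv.Perm.sign_swap (hinj.ne (by decide)),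
      Equiv.Perm.sign_swap (hinj.ne (by decide))]
    simp
  have h := Matrix.det_permute σ
    (Matrix.of (Fin.append (fun i : Fin k => Y i) ![d, c, b, a]))
  rw [hs] at h
  simp only [Units.val_one, Int.cast_one, one_mul] at h
  rw [← h]
  congr 1
  ext i j
  refine Fin.addCases (fun i => ?_) (fun i => ?_) i
  · have hne : ∀ t : Fin 4, Fin.castAdd 4 i ≠ f t := by
      intro t ht
      have := congrArg Fin.val ht
      simp [hf] at this
      omega
    have : σ (Fin.castAdd 4 i) = Fin.castAdd 4 i := by
      rw [hσ, Equiv.Perm.mul_apply, Equiv.swap_apply_of_ne_of_ne (hne _) (hne _),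
        Equiv.swap_apply_of_ne_of_ne (hne _) (hne _)]
    simp [this]
  · have : σ (f i) = f (Fin.rev i) := by
      have e : ∀ s t : Fin 4, f s = f t ↔ s = t := fun s t => hinj.eq_iff
      simp only [hσ, Equiv.Perm.mul_apply, Equiv.swap_apply_def]
      fin_cases i <;> simp [e]
    simp only [Matrix.submatrix_apply, Matrix.of_apply, id]
    rw [show Fin.natAdd k i = f i from rfl, this]
    simp only [hf, Fin.append_right]
    fin_cases i <;> rfl

lemma twistor_diag_aux {k : ℕ} (hk : 1 ≤ k) (Y : Matrix (Fin k) (Fin (k + 4)) ℝ)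
    (P : Matrix (Fin (k + 4)) (Fin (k + 4)) ℝ) (a b c d : Fin (k + 4) → ℝ) :
    twistor (diagSign k * Y * P) (a ᵥ* P) (b ᵥ* P) (c ᵥ* P) (d ᵥ* P) =
      (-1) ^ Nat.choose k 2 * P.det * twistor Y a b c d := by
  unfold twistor
  obtain ⟨l, rfl⟩ : ∃ l, k = l + 1 := ⟨k - 1, by omega⟩
  set N := Matrix.of (Fin.append (fun i : Fin (l + 1) => Y i) ![a, b, c, d]) with hN
  set v : Fin (l + 1 + 4) → ℝ := Fin.append
    (fun i : Fin (l + 1) => if (i : ℕ) = 0 then (-1 : ℝ) ^ Nat.choose (l + 1) 2 else 1)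
    (fun _ => 1) with hv
  have hM : Matrix.of (Fin.append (fun i : Fin (l + 1) => (diagSign (l + 1) * Y * P) i)
      ![a ᵥ* P, b ᵥ* P, c ᵥ* P, d ᵥ* P]) = Matrix.diagonal v * (N * P) := by
    ext i j
    rw [Matrix.diagonal_mul]
    refine Fin.addCases (fun i => ?_) (fun i => ?_) i
    · simp only [Matrix.of_apply, Fin.append_left, hv]
      rw [Matrix.mul_assoc, diagSign, Matrix.diagonal_mul]
      congr 1
      simp [Matrix.mul_apply, hN]
    · simp only [Matrix.of_apply, Fin.append_right, hv, one_mul]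
      fin_cases i <;> simp [Matrix.mul_apply, hN, Matrix.vecMul, dotProduct]
  rw [hM, Matrix.det_mul, Matrix.det_mul, Matrix.det_diagonal, Fin.prod_univ_add]
  have : (∏ i : Fin (l + 1), v (Fin.castAdd 4 i)) = (-1) ^ Nat.choose (l + 1) 2 := by
    simp only [hv, Fin.append_left]
    rw [Fin.prod_univ_succ]
    simp
  rw [this]
  simp [hv]
  ring

/-- **Twistor coordinates after reflection** (Lemma 9.1, reflection case).  With
`C := P·C'·[refl_n]` and `Z := [refl_n]·Z'·P'`: (i) `Z` is positive; (ii) the twistors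
transform as stated (1-based row `t` of the paper is the `Fin n` element with value
`t − 1`, so the paper's row `n + 1 − t` has value `n − 1 − (t − 1)`). -/
theorem refl_twistors (k n : ℕ) (hk : 1 ≤ k) (hn : k + 4 ≤ n)
    (C' : Matrix (Fin k) (Fin n) ℝ) (Z' : Matrix (Fin n) (Fin (k + 4)) ℝ)
    (hZ' : PosMat Z') :
    PosMat (reflMat n * Z' * diagSign (k + 4)) ∧
      ∀ u v x y : Fin n, (u : ℕ) < (v : ℕ) → (v : ℕ) < (x : ℕ) → (x : ℕ) < (y : ℕ) →
        twistor (diagSign k * C' * reflMat n * (reflMat n * Z' * diagSign (k + 4)))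
            ((reflMat n * Z' * diagSign (k + 4)) u) ((reflMat n * Z' * diagSign (k + 4)) v)
            ((reflMat n * Z' * diagSign (k + 4)) x) ((reflMat n * Z' * diagSign (k + 4)) y) =
          twistor (C' * Z') (Z' ⟨n - 1 - (y : ℕ), by omega⟩)
            (Z' ⟨n - 1 - (x : ℕ), by omega⟩) (Z' ⟨n - 1 - (v : ℕ), by omega⟩)
            (Z' ⟨n - 1 - (u : ℕ), by omega⟩) := by
  have hrefl : ∀ t : Fin n, (reflMat n * Z' * diagSign (k + 4)) t =
      Z' (Fin.rev t) ᵥ* diagSign (k + 4) := by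
    intro t
    rw [reflMat_mul_aux]
    rfl
  constructor
  · intro g hg
    have hg' : StrictMono (fun i => Fin.rev (g (Fin.rev i))) := by
      intro i j hij
      exact Fin.rev_lt_rev.mpr (hg (Fin.rev_lt_rev.mpr hij))
    have h1 := hZ' _ hg'
    have h2 : (reflMat n * Z' * diagSign (k + 4)).submatrix g id =
        ((Z'.submatrix (fun i => Fin.rev (g (Fin.rev i))) id).submatrix
          (Fin.revPerm : Equiv.Perm (Fin (k + 4))) id) * diagSign (k + 4) := by
      rw [reflMat_mul_aux]
      ext i j
      simp [Matrix.mul_apply]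
    rw [h2, Matrix.det_mul, Matrix.det_permute, sign_revPerm_aux,
      det_diagSign_aux _ (by omega)]
    have h3 := neg_one_sq_aux (Nat.choose (k + 4) 2)
    push_cast
    rw [mul_right_comm, h3, one_mul]
    exact h1
  · intro u v x y _ _ _
    rw [hrefl, hrefl, hrefl, hrefl]
    have hC : diagSign k * C' * reflMat n * (reflMat n * Z' * diagSign (k + 4)) =
        diagSign k * (C' * Z') * diagSign (k + 4) := by
      have : reflMat n * (reflMat n * Z') = Z' := by
        rw [reflMat_mul_aux, reflMat_mul_aux]
        ext i j
        simp
      calc _ = diagSign k * C' * (reflMat n * (reflMat n * Z')) * diagSign (k + 4) := by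
            simp only [Matrix.mul_assoc]
        _ = _ := by rw [this]; simp only [Matrix.mul_assoc]
    rw [hC, twistor_diag_aux hk, det_diagSign_aux _ (by omega), twistor_rev_aux]
    have hsgn : ((-1 : ℝ) ^ Nat.choose k 2) * (-1) ^ Nat.choose (k + 4) 2 = 1 := by
      have : Nat.choose (k + 4) 2 = Nat.choose k 2 + 2 * (2 * k + 3) := by
        simp only [Nat.choose_succ_succ' _ 1, Nat.choose_one_right, Nat.reduceAdd]
        omega
      rw [this, pow_add, ← mul_assoc, neg_one_sq_aux, pow_mul]
      simp
    rw [hsgn, one_mul]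
    have hr : ∀ (t : Fin n) (ht : n - 1 - (t : ℕ) < n), Fin.rev t = ⟨n - 1 - (t : ℕ), ht⟩ := by
      intro t ht
      ext
      rw [Fin.val_rev]
      simp only
      omega
    rw [hr u (by omega), hr v (by omega), hr x (by omega), hr y (by omega)]
end

section
/- The cubic Plücker relation underlying the seed Σ₁ (displayed identity in the proof of Theorem 4.5, stated with sorted-column sign conventions): For any seven vectors v₁, v₂, v_a, v_b, v_c, v_d, v_n ∈ ℝ⁴, writing ⟨p q r s⟩ := det(v_p, v_q, v_r, v_s), one has (⟨1 2 b n⟩⟨a c d n⟩ − ⟨1 2 a n⟩⟨b c d n⟩)·⟨1 a d n⟩ = ⟨1 2 d n⟩⟨1 a b n⟩⟨a c d n⟩ + ⟨1 2 a n⟩⟨1 c d n⟩⟨a b d n⟩. (The left-hand parenthesis is, up to the paper's chain-polynomial sign conventions, the chain polynomial ⟨c d n | a b | n 1 2⟩, and the identity is the exchange relation used to show Σ₁ is a seed for Gr_{4,n}.) -/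
open Matrix

/-- `det4 w₁ w₂ w₃ w₄`: the determinant of the `4 × 4` matrix whose columns are
`w₁, w₂, w₃, w₄` in that order; it is alternating in the four vectors. -/
noncomputable def det4 (w₁ w₂ w₃ w₄ : Fin 4 → ℝ) : ℝ :=
  (Matrix.of fun i j => ![w₁, w₂, w₃, w₄] j i).det

theorem det4_expand (x y z w : Fin 4 → ℝ) : det4 x y z w =
    (x 0 * y 1 - x 1 * y 0) * (z 2 * w 3 - z 3 * w 2)
    - (x 0 * y 2 - x 2 * y 0) * (z 1 * w 3 - z 3 * w 1)
    + (x 0 * y 3 - x 3 * y 0) * (z 1 * w 2 - z 2 * w 1)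
    + (x 1 * y 2 - x 2 * y 1) * (z 0 * w 3 - z 3 * w 0)
    - (x 1 * y 3 - x 3 * y 1) * (z 0 * w 2 - z 2 * w 0)
    + (x 2 * y 3 - x 3 * y 2) * (z 0 * w 1 - z 1 * w 0) := by
  unfold det4
  simp [Matrix.det_succ_row_zero, Fin.sum_univ_succ, Fin.succAbove]
  ring

theorem det4_cycle (x y z w : Fin 4 → ℝ) : det4 x y z w = det4 z x y w := by
  simp only [det4_expand]
  ring

set_option maxHeartbeats 4000000 in
theorem det4_plucker (e p q r s w : Fin 4 → ℝ) :
    det4 e p q w * det4 e r s w - det4 e p r w * det4 e q s w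
      + det4 e p s w * det4 e q r w = 0 := by
  simp only [det4_expand]
  ring

/-- **The cubic Plücker relation underlying the seed `Σ₁`** (displayed identity in the
proof of Theorem 4.5, with sorted-column sign conventions):
`(⟨1 2 b n⟩⟨a c d n⟩ − ⟨1 2 a n⟩⟨b c d n⟩)·⟨1 a d n⟩ =
⟨1 2 d n⟩⟨1 a b n⟩⟨a c d n⟩ + ⟨1 2 a n⟩⟨1 c d n⟩⟨a b d n⟩`. -/
theorem sigma_one_cubic_relation (v₁ v₂ a b c d nn : Fin 4 → ℝ) :
    (det4 v₁ v₂ b nn * det4 a c d nn - det4 v₁ v₂ a nn * det4 b c d nn) *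
        det4 v₁ a d nn =
      det4 v₁ v₂ d nn * det4 v₁ a b nn * det4 a c d nn +
        det4 v₁ v₂ a nn * det4 v₁ c d nn * det4 a b d nn := by
  have h1 := det4_plucker v₁ v₂ a b d nn
  have h2 := det4_plucker d v₁ a b c nn
  rw [← det4_cycle v₁ a d, ← det4_cycle b c d, ← det4_cycle v₁ b d, ← det4_cycle a c d,
    ← det4_cycle v₁ c d, ← det4_cycle a b d] at h2
  linear_combination (-det4 a c d nn) * h1 - det4 v₁ v₂ a nn * h2
end

section
/- Well-definedness of the amplituhedron map (implicit in Definition 2.7): Let k ≥ 1 and m ≥ 0 with k + m ≤ n. If C is a real k × n totally nonnegative matrix of rank k (all k × k minors ≥ 0) and Z is a real n × (k+m) matrix all of whose (k+m) × (k+m) minors are positive, then the k × (k+m) matrix C·Z has rank k. Consequently the amplituhedron map, sending the row span of C to the row span of C·Z, gives a well-defined map from the totally nonnegative Grassmannian Gr_{k,n}^{≥0} (the set of k-dimensional row spans of totally nonnegative k × n matrices) to the Grassmannian Gr_{k,k+m} of k-dimensional subspaces of ℝ^{k+m}. -/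
open Matrix

theorem cb_aux {k n : ℕ} {M : Type*} [AddCommGroup M] [Module ℝ M]
    (f : M [⋀^Fin k]→ₗ[ℝ] ℝ) (C : Matrix (Fin k) (Fin n) ℝ) (z : Fin n → M) :
    (Fintype.card (Equiv.Perm (Fin k)) : ℝ) * f (fun i => ∑ j, C i j • z j) =
      ∑ r : Fin k → Fin n, (C.submatrix id r).det * f (z ∘ r) := by
  have h1 : f (fun i => ∑ j, C i j • z j) =
      ∑ r : Fin k → Fin n, (∏ i, C i (r i)) * f (z ∘ r) := by
    have := f.toMultilinearMap.map_sum (fun i j => C i j • z j)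
    refine this.trans (Finset.sum_congr rfl fun r _ => ?_)
    exact f.toMultilinearMap.map_smul_univ (fun i => C i (r i)) (fun i => z (r i))
  have h2 : ∀ σ : Equiv.Perm (Fin k), f (fun i => ∑ j, C i j • z j) =
      ∑ r : Fin k → Fin n, ((Equiv.Perm.sign σ : ℤ) : ℝ) * (∏ i, C i (r (σ i))) * f (z ∘ r) := by
    intro σ
    rw [h1, ← Equiv.sum_comp (Equiv.arrowCongr σ.symm (Equiv.refl (Fin n)))]
    refine Finset.sum_congr rfl fun r _ => ?_
    have : z ∘ (Equiv.arrowCongr σ.symm (Equiv.refl (Fin n))) r = (z ∘ r) ∘ σ := by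
      ext i; simp [Equiv.arrowCongr]
    rw [this, f.map_perm]
    simp only [Equiv.arrowCongr, Equiv.coe_fn_mk, Function.comp, Equiv.refl_apply,
      Equiv.symm_symm, Units.smul_def, zsmul_eq_mul]
    ring
  calc _ = ∑ σ : Equiv.Perm (Fin k), f (fun i => ∑ j, C i j • z j) := by simp
    _ = ∑ σ : Equiv.Perm (Fin k), ∑ r : Fin k → Fin n,
        ((Equiv.Perm.sign σ : ℤ) : ℝ) * (∏ i, C i (r (σ i))) * f (z ∘ r) :=
        Finset.sum_congr rfl fun σ _ => h2 σ
    _ = _ := by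
      rw [Finset.sum_comm]
      refine Finset.sum_congr rfl fun r _ => ?_
      rw [← Finset.sum_mul, ← det_transpose, det_apply']
      simp

theorem cb_nonneg {k n : ℕ} {M : Type*} [AddCommGroup M] [Module ℝ M]
    (f : M [⋀^Fin k]→ₗ[ℝ] ℝ) (C : Matrix (Fin k) (Fin n) ℝ) (z : Fin n → M)
    (hC : TotNonneg C) (hf : ∀ J : Fin k → Fin n, StrictMono J → 0 < f (z ∘ J))
    (r : Fin k → Fin n) :
    0 ≤ (C.submatrix id r).det * f (z ∘ r) ∧
      ((C.submatrix id r).det ≠ 0 → (C.submatrix id r).det * f (z ∘ r) ≠ 0) := by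
  by_cases hr : Function.Injective r
  · have hs : StrictMono (r ∘ Tuple.sort r) :=
      (Tuple.monotone_sort r).strictMono_of_injective (hr.comp (Equiv.injective _))
    have h1 := hC _ hs
    have h2 := hf _ hs
    have e1 : (C.submatrix id (r ∘ Tuple.sort r)).det
        = ((Equiv.Perm.sign (Tuple.sort r) : ℤ) : ℝ) * (C.submatrix id r).det := by
      have := det_permute' (Tuple.sort r) (C.submatrix id r)
      rw [← this]; rfl
    have e2 : f (z ∘ r ∘ Tuple.sort r)
        = ((Equiv.Perm.sign (Tuple.sort r) : ℤ) : ℝ) * f (z ∘ r) := by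
      have := f.map_perm (z ∘ r) (Tuple.sort r)
      rw [Units.smul_def, zsmul_eq_mul] at this
      rw [← this]; rfl
    rw [e1] at h1
    rw [e2] at h2
    rcases Int.units_eq_one_or (Equiv.Perm.sign (Tuple.sort r)) with h | h
    · simp only [h, Units.val_one, Int.cast_one, one_mul] at h1 h2
      exact ⟨mul_nonneg h1 h2.le, fun h => mul_ne_zero h h2.ne'⟩
    · simp only [h, Units.val_neg, Units.val_one, Int.cast_neg, Int.cast_one] at h1 h2
      refine ⟨by nlinarith, fun h => mul_ne_zero h (by linarith)⟩
  · have : (C.submatrix id r).det = 0 := by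
      simp only [Function.Injective, not_forall] at hr
      obtain ⟨a, b, hab, hne⟩ := hr
      exact det_zero_of_column_eq hne (fun i => by simp [hab])
    simp [this]

theorem poly_pos {n : ℕ} (a : Fin n → ℝ) (p : Fin n) (h0 : ∀ i < p, a i = 0) (hp : 0 < a p) :
    ∀ᶠ e : ℝ in nhdsWithin 0 (Set.Ioi 0), 0 < ∑ j : Fin n, e ^ (j : ℕ) * a j := by
  have hq : Continuous (fun e : ℝ => ∑ j : Fin n, e ^ ((j : ℕ) - (p : ℕ)) * a j) := by fun_prop
  have hq0 : 0 < ∑ j : Fin n, (0 : ℝ) ^ ((j : ℕ) - (p : ℕ)) * a j := by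
    rw [Finset.sum_eq_single p]
    · simpa using hp
    · intro j _ hj
      rcases lt_or_gt_of_ne hj with h | h
      · simp [h0 j h]
      · rw [zero_pow (by have : (p : ℕ) < j := h
                         omega), zero_mul]
    · simp
  have h1 : ∀ᶠ e : ℝ in nhds 0, 0 < ∑ j : Fin n, e ^ ((j : ℕ) - (p : ℕ)) * a j :=
    hq.continuousAt.eventually (lt_mem_nhds hq0)
  filter_upwards [nhdsWithin_le_nhds h1, self_mem_nhdsWithin] with e he hpos
  have : ∑ j : Fin n, e ^ (j : ℕ) * a j =
      e ^ (p : ℕ) * ∑ j : Fin n, e ^ ((j : ℕ) - (p : ℕ)) * a j := by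
    rw [Finset.mul_sum]
    refine Finset.sum_congr rfl fun j _ => ?_
    by_cases h : j < p
    · simp [h0 j h]
    · rw [← mul_assoc, ← pow_add]
      have : (p : ℕ) ≤ j := not_lt.mp h
      rw [Nat.add_sub_cancel' this]
  rw [this]
  exact mul_pos (pow_pos hpos _) he

theorem exists_gap {d n : ℕ} (hd : d < n) (J : Fin d → Fin n) (hJ : StrictMono J) :
    ∃ (p : Fin (d + 1)) (q : Fin n), (p : ℕ) = q ∧ (∀ i < q, i ∈ Set.range J) ∧
      StrictMono (p.insertNth q J : Fin (d + 1) → Fin n) := by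
  classical
  have hex : ∃ p : ℕ, p = d ∨ ∃ h : p < d, ((J ⟨p, h⟩ : Fin n) : ℕ) ≠ p := ⟨d, Or.inl rfl⟩
  have hle : Nat.find hex ≤ d := Nat.find_min' hex (Or.inl rfl)
  have hspec := Nat.find_spec hex
  have hmin : ∀ i (h : i < d), i < Nat.find hex → ((J ⟨i, h⟩ : Fin n) : ℕ) = i := by
    intro i h hi
    have := Nat.find_min hex hi
    push Not at this
    exact this.2 h
  generalize Nat.find hex = p at *
  have hge : ∀ i (h : i < d), i ≤ ((J ⟨i, h⟩ : Fin n) : ℕ) := by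
    intro i
    induction i with
    | zero => intro h; exact Nat.zero_le _
    | succ i ih =>
      intro h
      have h1 := ih (by omega)
      have h2 : J ⟨i, by omega⟩ < J ⟨i + 1, h⟩ := hJ (by simp [Fin.lt_def])
      have h3 := Fin.lt_def.mp h2
      omega
  have hgt : ∀ i (h : i < d), p ≤ i → p < ((J ⟨i, h⟩ : Fin n) : ℕ) := by
    intro i h hi
    rcases hspec with h' | ⟨h', hne⟩
    · omega
    · have h1 : J ⟨p, h'⟩ ≤ J ⟨i, h⟩ := hJ.monotone (by simpa [Fin.le_def] using hi)
      have h2 := Fin.le_def.mp h1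
      have h3 := hge p h'
      omega
  refine ⟨⟨p, by omega⟩, ⟨p, by omega⟩, rfl, ?_, ?_⟩
  · intro i hi
    have hi' : (i : ℕ) < p := hi
    exact ⟨⟨i, by omega⟩, Fin.ext (hmin i (by omega) hi')⟩
  · rw [Fin.strictMono_insertNth_iff]
    refine ⟨hJ, fun i hi => ?_, fun i hi => ?_⟩
    · have hi' : (i : ℕ) < p := by simpa [Fin.lt_def] using hi
      have := hmin i i.2 hi'
      rw [Fin.lt_def]; simp only [Fin.eta] at this ⊢; omega
    · have hi' : p ≤ (i : ℕ) := by simpa [Fin.le_def] using hi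
      exact Fin.lt_def.mpr (hgt i i.2 hi')

theorem reduce_one {d n : ℕ} (hd : d < n) {M : Type*} [AddCommGroup M] [Module ℝ M]
    (z : Fin n → M) (f : M [⋀^Fin (d + 1)]→ₗ[ℝ] ℝ)
    (hf : ∀ J : Fin (d + 1) → Fin n, StrictMono J → 0 < f (z ∘ J)) :
    ∃ g : M [⋀^Fin d]→ₗ[ℝ] ℝ, ∀ J : Fin d → Fin n, StrictMono J → 0 < g (z ∘ J) := by
  have key : ∀ J : Fin d → Fin n, StrictMono J → ∀ᶠ e : ℝ in nhdsWithin 0 (Set.Ioi 0),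
      0 < ∑ j : Fin n, e ^ (j : ℕ) * ((-1) ^ (j : ℕ) * f (Fin.cons (z j) (z ∘ J))) := by
    intro J hJ
    obtain ⟨p, q, hpq, hlt, hmono⟩ := exists_gap hd J hJ
    apply poly_pos _ q
    · rintro i hi
      obtain ⟨t, ht⟩ := hlt i hi
      have : f (Fin.cons (z i) (z ∘ J)) = 0 :=
        f.map_eq_zero_of_eq _ (i := 0) (j := t.succ) (by simp [ht]) (Fin.succ_ne_zero t).symm
      simp [this]
    · have h1 := hf _ hmono
      have h2 : z ∘ (p.insertNth q J : Fin (d + 1) → Fin n)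
          = (p.insertNth (z q) (z ∘ J) : Fin (d + 1) → M) := by
        ext i
        refine Fin.succAboveCases p ?_ ?_ i <;> simp
      rw [h2, f.map_insertNth] at h1
      rw [← hpq]
      simpa [Matrix.vecCons] using h1
  have hall : ∀ᶠ e : ℝ in nhdsWithin 0 (Set.Ioi 0), ∀ J : Fin d → Fin n, StrictMono J →
      0 < ∑ j : Fin n, e ^ (j : ℕ) * ((-1) ^ (j : ℕ) * f (Fin.cons (z j) (z ∘ J))) := by
    rw [Filter.eventually_all]
    intro J
    by_cases hJ : StrictMono J
    · filter_upwards [key J hJ] with e he _ using he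
    · exact Filter.Eventually.of_forall fun e h => absurd h hJ
  obtain ⟨e, he⟩ := hall.exists
  refine ⟨f.curryLeft (∑ j : Fin n, (e ^ (j : ℕ) * (-1) ^ (j : ℕ)) • z j), fun J hJ => ?_⟩
  have := he J hJ
  have hs : f.curryLeft (∑ j : Fin n, (e ^ (j : ℕ) * (-1) ^ (j : ℕ)) • z j) (z ∘ J) =
      ∑ j : Fin n, f.curryLeft ((e ^ (j : ℕ) * (-1) ^ (j : ℕ)) • z j) (z ∘ J) :=
    map_sum (AddMonoidHom.mk' (fun x => f.curryLeft x (z ∘ J)) (fun x y => by simp)) _ _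
  rw [hs]
  refine this.trans_eq (Finset.sum_congr rfl fun j _ => ?_)
  rw [map_smul, AlternatingMap.smul_apply, smul_eq_mul, mul_assoc]
  rfl

theorem reduce_many {k n : ℕ} {M : Type*} [AddCommGroup M] [Module ℝ M]
    (z : Fin n → M) : ∀ (m : ℕ) (_ : k + m ≤ n) (f : M [⋀^Fin (k + m)]→ₗ[ℝ] ℝ)
    (_ : ∀ J : Fin (k + m) → Fin n, StrictMono J → 0 < f (z ∘ J)),
    ∃ g : M [⋀^Fin k]→ₗ[ℝ] ℝ, ∀ J : Fin k → Fin n, StrictMono J → 0 < g (z ∘ J)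
  | 0, _, f, hf => ⟨f, hf⟩
  | m + 1, h, f, hf => by
    obtain ⟨g, hg⟩ := reduce_one (d := k + m) (by omega) z f hf
    exact reduce_many z m (by omega) g hg

/-- **Well-definedness of the amplituhedron map** (implicit in Definition 2.7).  If `C` is
a totally nonnegative `k × n` matrix of rank `k` and `Z` is an `n × (k+m)` matrix all of
whose maximal minors are positive, then `C·Z` has rank `k`; consequently sending the row
span of `C` to the row span of `C·Z` gives a well-defined map from `Gr_{k,n}^{≥0}` to
`Gr_{k,k+m}`. -/
theorem amplituhedron_map_well_defined (k m n : ℕ) (hk : 1 ≤ k) (hkm : k + m ≤ n)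
    (C : Matrix (Fin k) (Fin n) ℝ) (hC : TotNonneg C) (hrank : C.rank = k)
    (Z : Matrix (Fin n) (Fin (k + m)) ℝ)
    (hZ : ∀ g : Fin (k + m) → Fin n, StrictMono g → 0 < (Z.submatrix g id).det) :
    (C * Z).rank = k ∧
      ∀ C' : Matrix (Fin k) (Fin n) ℝ, TotNonneg C' →
        Submodule.span ℝ (Set.range fun i => C i) =
          Submodule.span ℝ (Set.range fun i => C' i) →
        Submodule.span ℝ (Set.range fun i => (C * Z) i) =
          Submodule.span ℝ (Set.range fun i => (C' * Z) i) := by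
  constructor
  · have hsurj : Function.Surjective C.mulVec := by
      have : LinearMap.range C.mulVecLin = ⊤ := by
        apply Submodule.eq_top_of_finrank_eq
        rw [← Matrix.rank, hrank]; simp
      exact LinearMap.range_eq_top.mp this
    obtain ⟨B, hB⟩ := mulVec_surjective_iff_exists_right_inverse.mp hsurj
    have hrow : ∀ {p : ℕ} (Y : Matrix (Fin n) (Fin p) ℝ),
        (fun i => ∑ j, C i j • Y j) = (C * Y : Matrix (Fin k) (Fin p) ℝ) := by
      intro p Y
      ext i l
      simp [mul_apply]
    have hcard : (0 : ℝ) < (Fintype.card (Equiv.Perm (Fin k)) : ℝ) := by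
      exact_mod_cast Fintype.card_pos
    have hr : ∃ r : Fin k → Fin n, (C.submatrix id r).det ≠ 0 := by
      by_contra! hcon
      have := cb_aux (detRowAlternating (R := ℝ) (n := Fin k)) C (fun j => B j)
      rw [hrow B, hB] at this
      simp only [hcon, zero_mul, Finset.sum_const_zero] at this
      have h1 : detRowAlternating (R := ℝ) (1 : Matrix (Fin k) (Fin k) ℝ) = 1 := det_one
      rw [h1] at this
      linarith
    obtain ⟨g, hg⟩ := reduce_many (k := k) (fun j => Z j) m hkm
      (detRowAlternating (R := ℝ) (n := Fin (k + m))) (fun J hJ => hZ J hJ)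
    have hpos : 0 < g (fun i => (C * Z) i) := by
      have h := cb_aux g C (fun j => Z j)
      rw [hrow Z] at h
      have h2 : 0 < ∑ r : Fin k → Fin n, (C.submatrix id r).det * g ((fun j => Z j) ∘ r) := by
        obtain ⟨r, hr⟩ := hr
        refine Finset.sum_pos' (fun r _ => (cb_nonneg g C _ hC hg r).1) ⟨r, Finset.mem_univ _, ?_⟩
        have := cb_nonneg g C _ hC hg r
        exact lt_of_le_of_ne this.1 (this.2 hr).symm
      rw [← h] at h2
      exact pos_of_mul_pos_right h2 hcard.le
    have hli : LinearIndependent ℝ (fun i => (C * Z) i) := by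
      by_contra hcon
      exact hpos.ne' (g.map_linearDependent _ hcon)
    simpa using LinearIndependent.rank_matrix (M := C * Z) hli
  · intro C' _ hspan
    have h : ∀ D : Matrix (Fin k) (Fin n) ℝ,
        Submodule.span ℝ (Set.range fun i => (D * Z) i) =
          (Submodule.span ℝ (Set.range fun i => D i)).map Z.vecMulLinear := by
      intro D
      rw [Submodule.map_span, ← Set.range_comp]
      rfl
    rw [h C, h C', hspan]
end
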